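/- For every real α with 0 ≤ α < 1/2 and every nonnegative integer n, there exist real-analytic functions F, A, Z : [0,1] → ℝ which on (0,1) satisfy the system (′ = d/dρ): F″ + (2/ρ)F′ − α(1+Z²)ρ(F′)³ − sin(2F)/(Aρ²(1−Z²)) = 0, A′ = −2αρA(F′)², ρZ′ = Z(1 + α(1−Z²)ρ²(F′)²), together with the constraint 1 − A − 2α sin²F + αAρ²(F′)²(1−Z²) = 0, with boundary values F(0) = 0, Z(0) = 0, A(0) = 1, F(1) = π/2, Z(1) = 1, A(1) = 1 − 2α, and such that the function ρ ↦ F(ρ) − π/2 has exactly n zeros in the open interval (0,1). -/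

import Mathlib

open Real Filter Set Topology

noncomputable section

/-- A real-analytic solution on `[0,1]` of the CSS boundary value problem of
Theorem 1, whose profile `F - π/2` has exactly `n` zeros in `(0,1)`. -/
def Thm1Sol (α : ℝ) (n : ℕ) (F A Z : ℝ → ℝ) : Prop :=
  AnalyticOnNhd ℝ F (Set.Icc 0 1) ∧
  AnalyticOnNhd ℝ A (Set.Icc 0 1) ∧
  AnalyticOnNhd ℝ Z (Set.Icc 0 1) ∧
  (∀ ρ ∈ Set.Ioo (0:ℝ) 1,
    deriv (deriv F) ρ + (2 / ρ) * deriv F ρ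
        - α * (1 + Z ρ ^ 2) * ρ * deriv F ρ ^ 3
        - Real.sin (2 * F ρ) / (A ρ * ρ ^ 2 * (1 - Z ρ ^ 2)) = 0 ∧
    deriv A ρ = -2 * α * ρ * A ρ * deriv F ρ ^ 2 ∧
    ρ * deriv Z ρ = Z ρ * (1 + α * (1 - Z ρ ^ 2) * ρ ^ 2 * deriv F ρ ^ 2) ∧
    1 - A ρ - 2 * α * Real.sin (F ρ) ^ 2
        + α * A ρ * ρ ^ 2 * deriv F ρ ^ 2 * (1 - Z ρ ^ 2) = 0) ∧
  F 0 = 0 ∧ Z 0 = 0 ∧ A 0 = 1 ∧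
  F 1 = π / 2 ∧ Z 1 = 1 ∧ A 1 = 1 - 2 * α ∧
  {ρ ∈ Set.Ioo (0:ℝ) 1 | F ρ = π / 2}.Finite ∧
  {ρ ∈ Set.Ioo (0:ℝ) 1 | F ρ = π / 2}.ncard = n

section Nemytskii

variable {X V E : Type*} [TopologicalSpace X] [CompactSpace X]
  [NormedAddCommGroup V] [NormedSpace ℝ V] [NormedAddCommGroup E] [NormedSpace ℝ E]

/-- Pointwise lift of a continuous multilinear map to continuous functions. -/
def liftMultilinear {n : ℕ} (p : ContinuousMultilinearMap ℝ (fun _ : Fin n => V) E) :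
    ContinuousMultilinearMap ℝ (fun _ : Fin n => C(X, V)) C(X, E) :=
  MultilinearMap.mkContinuous
    { toFun := fun w => ⟨fun x => p fun i => w i x, by fun_prop⟩
      map_update_add' := by
        intro _ w i a b
        ext x
        have key : ∀ c : C(X, V), (fun j => Function.update w i c j x)
            = Function.update (fun j => w j x) i (c x) := by
          intro c
          funext j
          by_cases h : j = i
          · subst h; simp
          · simp [h]
        simp only [ContinuousMap.coe_mk, ContinuousMap.add_apply]
        rw [key, key, key]
        simp
      map_update_smul' := by
        intro _ w i a b
        ext x
        have key : ∀ c : C(X, V), (fun j => Function.update w i c j x)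
            = Function.update (fun j => w j x) i (c x) := by
          intro c
          funext j
          by_cases h : j = i
          · subst h; simp
          · simp [h]
        simp only [ContinuousMap.coe_mk, ContinuousMap.smul_apply]
        rw [key, key]
        simp }
    ‖p‖ (by
      intro w
      rw [ContinuousMap.norm_le _ (by positivity)]
      intro x
      refine (p.le_opNorm _).trans ?_
      gcongr with i
      exact (w i).norm_coe_le_norm x)

theorem norm_liftMultilinear_le {n : ℕ}
    (p : ContinuousMultilinearMap ℝ (fun _ : Fin n => V) E) :
    ‖(liftMultilinear p : ContinuousMultilinearMap ℝ (fun _ : Fin n => C(X, V)) C(X, E))‖ ≤ ‖p‖ :=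
  MultilinearMap.mkContinuous_norm_le _ (norm_nonneg _) _

/-- The superposition operator of an analytic function is analytic at constant functions. -/
theorem exists_analyticAt_superposition [CompleteSpace E] {f : V → E} {v₀ : V}
    (hf : AnalyticAt ℝ f v₀) :
    ∃ N : C(X, V) → C(X, E), AnalyticAt ℝ N (ContinuousMap.const X v₀) ∧
      ∀ᶠ w in 𝓝 (ContinuousMap.const X v₀), ∀ x, N w x = f (w x) := by
  obtain ⟨p, r, hp⟩ := hf
  set P : FormalMultilinearSeries ℝ C(X, V) C(X, E) := fun n => liftMultilinear (p n) with hP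
  have hrad : p.radius ≤ P.radius :=
    FormalMultilinearSeries.radius_le_of_le fun {n} => norm_liftMultilinear_le (p n)
  have hPpos : 0 < P.radius := lt_of_lt_of_le (lt_of_lt_of_le hp.r_pos hp.r_le) hrad
  have hsum := (P.hasFPowerSeriesOnBall hPpos)
  refine ⟨fun w => P.sum (w - ContinuousMap.const X v₀), ?_, ?_⟩
  · have := hsum.comp_sub (ContinuousMap.const X v₀)
    rw [zero_add] at this
    exact this.analyticAt
  · have hball : Metric.eball (ContinuousMap.const X v₀ : C(X, V)) r ∈
        𝓝 (ContinuousMap.const X v₀ : C(X, V)) := Metric.eball_mem_nhds _ hp.r_pos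
    filter_upwards [hball] with w hw x
    have hw' : w - ContinuousMap.const X v₀ ∈ Metric.eball (0 : C(X, V)) r := by
      rw [Metric.mem_eball, edist_eq_enorm_sub] at hw ⊢
      simpa using hw
    have h1 := hsum.hasSum (y := w - ContinuousMap.const X v₀)
      (Metric.eball_subset_eball (hp.r_le.trans hrad) hw')
    have h2 := ContinuousMap.hasSum_apply h1 x
    have h3 : (w x - v₀) ∈ Metric.eball (0 : V) r := by
      rw [Metric.mem_eball, edist_eq_enorm_sub] at hw' ⊢
      refine lt_of_le_of_lt ?_ hw'
      rw [sub_zero, sub_zero, ← ofReal_norm, ← ofReal_norm]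
      exact ENNReal.ofReal_le_ofReal ((w - ContinuousMap.const X v₀).norm_coe_le_norm x)
    have h4 := hp.hasSum h3
    rw [add_sub_cancel] at h4
    rw [zero_add] at h2
    exact h2.unique h4

end Nemytskii

section BriotBouquet

variable {E : Type*} [NormedAddCommGroup E] [NormedSpace ℝ E]

/-- The averaging operator `h ↦ (s ↦ s ∫₀¹ κ(τ) h(sτ) dτ)`. -/
def averageOp (κ : ℝ → E →L[ℝ] E) (hκ : Continuous κ) : C(unitInterval, E) →L[ℝ] C(unitInterval, E) :=
  have hintegr : ∀ (h : C(unitInterval, E)) (s : ℝ), IntervalIntegrable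
      (fun τ => κ τ (Set.IccExtend zero_le_one h (s * τ))) MeasureTheory.volume 0 1 := by
    intro h s
    have := h.continuous.Icc_extend' (h := zero_le_one)
    exact Continuous.intervalIntegrable (hκ.clm_apply (this.comp (by fun_prop))) _ _
  LinearMap.mkContinuousOfExistsBound
    { toFun := fun h => ⟨fun s => (s : ℝ) • ∫ τ in (0:ℝ)..1, κ τ (Set.IccExtend zero_le_one h (s * τ)), by
        have := h.continuous.Icc_extend' (h := zero_le_one)
        refine Continuous.smul (by fun_prop) ?_
        refine intervalIntegral.continuous_parametric_intervalIntegral_of_continuous' ?_ _ _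
        refine (hκ.comp continuous_snd).clm_apply (this.comp ?_)
        fun_prop⟩
      map_add' := by
        intro a b
        ext s
        simp only [ContinuousMap.coe_mk, ContinuousMap.add_apply]
        rw [← smul_add, ← intervalIntegral.integral_add (hintegr a s) (hintegr b s)]
        simp [Set.IccExtend]
      map_smul' := by
        intro c a
        ext s
        simp only [ContinuousMap.coe_mk, ContinuousMap.smul_apply, RingHom.id_apply]
        rw [smul_comm, ← intervalIntegral.integral_smul]
        simp [Set.IccExtend] }
    (by
      obtain ⟨K, hK⟩ := isCompact_Icc.exists_bound_of_continuousOn (s := Icc (0:ℝ) 1) hκ.continuousOn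
      have hK0 : 0 ≤ K := (norm_nonneg _).trans (hK 0 (by simp))
      refine ⟨K, fun h => ?_⟩
      rw [ContinuousMap.norm_le _ (by positivity)]
      intro s
      change ‖(s : ℝ) • ∫ τ in (0:ℝ)..1, κ τ (Set.IccExtend zero_le_one h (s * τ))‖ ≤ _
      rw [norm_smul, Real.norm_eq_abs, abs_of_nonneg s.2.1]
      have h1 : ‖∫ τ in (0:ℝ)..1, κ τ (Set.IccExtend zero_le_one h (s * τ))‖ ≤ (K * ‖h‖) * |1 - 0| := by
        refine intervalIntegral.norm_integral_le_of_norm_le_const fun τ hτ => ?_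
        rw [uIoc_of_le zero_le_one] at hτ
        refine ((κ τ).le_opNorm _).trans ?_
        have := hK τ ⟨hτ.1.le, hτ.2⟩
        gcongr
        exact h.norm_coe_le_norm _
      calc (s : ℝ) * _ ≤ 1 * ((K * ‖h‖) * |1 - 0|) := by
            gcongr
            exact s.2.2
        _ = K * ‖h‖ := by simp)

theorem averageOp_apply (κ : ℝ → E →L[ℝ] E) (hκ : Continuous κ) (h : C(unitInterval, E))
    (s : unitInterval) : averageOp κ hκ h s =
      (s : ℝ) • ∫ τ in (0:ℝ)..1, κ τ (Set.IccExtend zero_le_one h (s * τ)) := rfl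

/-- `(l, v) ↦ (s ↦ (l s, v s))`. -/
def graphMap (E : Type*) [NormedAddCommGroup E] [NormedSpace ℝ E] :
    ℝ × C(unitInterval, E) →L[ℝ] C(unitInterval, ℝ × E) :=
  (ContinuousLinearMap.compLeftContinuous ℝ unitInterval (ContinuousLinearMap.inl ℝ ℝ E) ∘L
      (ContinuousLinearMap.toSpanSingleton ℝ
        (⟨fun s => (s : ℝ), by fun_prop⟩ : C(unitInterval, ℝ)))) ∘L
      ContinuousLinearMap.fst ℝ ℝ C(unitInterval, E) +
  ContinuousLinearMap.compLeftContinuous ℝ unitInterval (ContinuousLinearMap.inr ℝ ℝ E) ∘L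
      ContinuousLinearMap.snd ℝ ℝ C(unitInterval, E)

theorem graphMap_apply (l : ℝ) (v : C(unitInterval, E)) (s : unitInterval) :
    graphMap E (l, v) s = (l * s, v s) := by
  simp [graphMap]

/-- Local existence, uniqueness and analytic dependence for singular integral equations of
Briot–Bouquet type. -/
theorem exists_analyticAt_briotBouquet [CompleteSpace E] (κ : ℝ → E →L[ℝ] E) (hκ : Continuous κ)
    {f : ℝ × E → E} {a₀ : E} (hf : AnalyticAt ℝ f (0, a₀)) :
    ∃ U : ℝ × E → E, AnalyticAt ℝ U (0, a₀) ∧ U (0, a₀) = a₀ ∧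
      ∃ ε > 0,
        (∀ l a, |l| < ε → ‖a - a₀‖ < ε → ∃ v : C(unitInterval, E),
            (∀ s : unitInterval, v s = U (l * s, a)) ∧
            ∀ s : unitInterval, v s = a + (l * s) • ∫ τ in (0:ℝ)..1, κ τ (f (l * s * τ, U (l * s * τ, a)))) ∧
        (∀ l a, |l| < ε → ‖a - a₀‖ < ε → ∀ v : C(unitInterval, E), ‖v - ContinuousMap.const _ a₀‖ < ε →
          (∀ s : unitInterval, v s = a + (l * s) • ∫ τ in (0:ℝ)..1, κ τ (f (l * s * τ,
            Set.IccExtend zero_le_one v (s * τ)))) → v 1 = U (l, a)) := by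
  obtain ⟨N, hN, hNf⟩ := exists_analyticAt_superposition (X := unitInterval) hf
  set c₀ : C(unitInterval, E) := ContinuousMap.const _ a₀ with hc₀
  have hg0 : graphMap E (0, c₀) = ContinuousMap.const _ ((0 : ℝ), a₀) := by
    ext s <;> simp [graphMap_apply, hc₀]
  set T := averageOp κ hκ
  set g : ℝ × C(unitInterval, E) → C(unitInterval, E) := fun x => T (N (graphMap E x)) with hg
  have hgan : AnalyticAt ℝ g (0, c₀) := by
    have h1 : AnalyticAt ℝ (fun x => N (graphMap E x)) ((0 : ℝ), c₀) := by
      have h0 : AnalyticAt ℝ N (graphMap E (0, c₀)) := by rw [hg0]; exact hN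
      exact h0.comp ((graphMap E).analyticAt _)
    exact (T.analyticAt _).comp h1
  set Θ : ℝ × C(unitInterval, E) → ℝ × C(unitInterval, E) := fun x => (x.1, x.2 - x.1 • g x) with hΘ
  have hΘan : AnalyticAt ℝ Θ (0, c₀) :=
    analyticAt_fst.prod (analyticAt_snd.sub (analyticAt_fst.smul hgan))
  set i : (ℝ × C(unitInterval, E)) ≃L[ℝ] (ℝ × C(unitInterval, E)) := (ContinuousLinearEquiv.refl ℝ ℝ).skewProd
    (ContinuousLinearEquiv.refl ℝ C(unitInterval, E)) (-(ContinuousLinearMap.toSpanSingleton ℝ (g (0, c₀)))) with hi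
  have hderiv : HasFDerivAt Θ (i : (ℝ × C(unitInterval, E)) →L[ℝ] (ℝ × C(unitInterval, E))) (0, c₀) := by
    have h1 := hgan.differentiableAt.hasFDerivAt
    have h2 := (hasFDerivAt_snd (𝕜 := ℝ) (p := ((0:ℝ), c₀))).sub
      ((hasFDerivAt_fst (𝕜 := ℝ) (p := ((0:ℝ), c₀))).smul h1)
    have h3 := (hasFDerivAt_fst (𝕜 := ℝ) (p := ((0:ℝ), c₀))).prodMk h2
    refine h3.congr_fderiv ?_
    refine ContinuousLinearMap.ext fun x => ?_
    rcases x with ⟨x1, x2⟩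
    simp [hi, ContinuousLinearEquiv.skewProd_apply, sub_eq_add_neg]
  have hstrict : HasStrictFDerivAt Θ (i : (ℝ × C(unitInterval, E)) →L[ℝ] (ℝ × C(unitInterval, E))) (0, c₀) := by
    have := hΘan.hasStrictFDerivAt
    rwa [hderiv.fderiv] at this
  set e := hstrict.toOpenPartialHomeomorph Θ with he
  have hecoe : ∀ x, e x = Θ x := fun x => rfl
  have hmem : ((0 : ℝ), c₀) ∈ e.source := hstrict.mem_toOpenPartialHomeomorph_source
  have hΘ0 : Θ (0, c₀) = (0, c₀) := by simp [hΘ]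
  have hsymm : AnalyticAt ℝ e.symm (0, c₀) := by
    have := e.analyticAt_symm' (i := i) hmem hΘan hderiv.fderiv
    rwa [hecoe, hΘ0] at this
  have htgt : ((0 : ℝ), c₀) ∈ e.target := by
    have := e.map_source hmem
    rwa [hecoe, hΘ0] at this
  have hsymm0 : e.symm (0, c₀) = (0, c₀) := by
    have := e.left_inv hmem
    rwa [hecoe, hΘ0] at this
  set K : E →L[ℝ] C(unitInterval, E) := ContinuousLinearMap.const ℝ unitInterval with hK
  have hKa : ∀ a, K a = ContinuousMap.const _ a := fun a => rfl
  set V : ℝ × E → C(unitInterval, E) := fun x => (e.symm (x.1, K x.2)).2 with hV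
  have hVan : AnalyticAt ℝ V (0, a₀) := by
    have h1 : AnalyticAt ℝ (fun x : ℝ × E => (x.1, K x.2)) (0, a₀) :=
      analyticAt_fst.prod ((K.analyticAt _).comp analyticAt_snd)
    have h2 : AnalyticAt ℝ e.symm ((fun x : ℝ × E => (x.1, K x.2)) (0, a₀)) := hsymm
    exact analyticAt_snd.comp (h2.comp_of_eq h1 rfl)
  have hV0 : V (0, a₀) = c₀ := by
    change (e.symm (0, c₀)).2 = c₀
    rw [hsymm0]
  -- solutions near the base point are exactly the values of `V`
  have hev1 : ∀ᶠ x in 𝓝 ((0:ℝ), c₀), x ∈ e.source ∧ ∀ s, N (graphMap E x) s = f (graphMap E x s) := by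
    refine Filter.Eventually.and (e.open_source.mem_nhds hmem) ?_
    have h1 : Tendsto (graphMap E) (𝓝 ((0:ℝ), c₀)) (𝓝 (ContinuousMap.const _ ((0 : ℝ), a₀))) := by
      rw [← hg0]; exact (graphMap E).continuous.continuousAt
    exact h1.eventually hNf
  obtain ⟨ε₁, hε₁, hball1⟩ := Metric.eventually_nhds_iff.1 hev1
  have heq : ∀ l v, |l| < ε₁ → ‖v - c₀‖ < ε₁ → ∀ s : unitInterval, g (l, v) s =
      (s : ℝ) • ∫ τ in (0:ℝ)..1, κ τ (f (l * s * τ, Set.IccExtend zero_le_one v (s * τ))) := by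
    intro l v hl hv s
    have h1 := (hball1 (y := (l, v)) (by
      rw [dist_eq_norm, Prod.norm_def]; simpa using ⟨hl, hv⟩)).2
    simp only [hg]
    rw [averageOp_apply]
    congr 1
    refine intervalIntegral.integral_congr fun τ hτ => ?_
    rw [uIcc_of_le zero_le_one] at hτ
    have hm : (s : ℝ) * τ ∈ Icc (0:ℝ) 1 :=
      ⟨mul_nonneg s.2.1 hτ.1, mul_le_one₀ s.2.2 hτ.1 hτ.2⟩
    simp only [Set.IccExtend_of_mem _ _ hm]
    rw [h1, graphMap_apply]
    simp [mul_assoc]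
  have huniq : ∀ l a v, |l| < ε₁ → ‖v - c₀‖ < ε₁ →
      (∀ s : unitInterval, v s = a + (l * s) • ∫ τ in (0:ℝ)..1, κ τ (f (l * s * τ,
            Set.IccExtend zero_le_one v (s * τ)))) → v = V (l, a) := by
    intro l a v hl hv h
    have hsrc := (hball1 (y := (l, v)) (by
      rw [dist_eq_norm, Prod.norm_def]; simpa using ⟨hl, hv⟩)).1
    have : Θ (l, v) = (l, K a) := by
      refine Prod.ext rfl ?_
      ext s
      simp only [hΘ, ContinuousMap.sub_apply, ContinuousMap.smul_apply, heq l v hl hv s]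
      rw [h s, smul_smul, hKa]
      simp
    simp only [hV]
    rw [← this, ← hecoe, e.left_inv hsrc]
  have hev2 : ∀ᶠ x in 𝓝 ((0:ℝ), a₀), ‖V x - c₀‖ < ε₁ ∧ (x.1, K x.2) ∈ e.target := by
    refine Filter.Eventually.and ?_ ?_
    · have := hVan.continuousAt
      rw [ContinuousAt, hV0] at this
      have := (this.sub_const c₀).norm
      rw [sub_self, norm_zero] at this
      exact this.eventually (gt_mem_nhds hε₁)
    · have h1 : Continuous (fun x : ℝ × E => (x.1, K x.2)) := by fun_prop
      exact h1.continuousAt.eventually (e.open_target.mem_nhds htgt)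
  obtain ⟨ε₂, hε₂, hball2⟩ := Metric.eventually_nhds_iff.1 hev2
  have hsol : ∀ l a, |l| < min ε₁ ε₂ → ‖a - a₀‖ < ε₂ → ∀ s : unitInterval,
      V (l, a) s = a + (l * s) • ∫ τ in (0:ℝ)..1, κ τ (f (l * s * τ,
            Set.IccExtend zero_le_one (V (l, a)) (s * τ))) := by
    intro l a hl ha s
    have h2 := hball2 (y := (l, a)) (by
      rw [dist_eq_norm, Prod.norm_def]; simpa using ⟨hl.trans_le (min_le_right _ _), ha⟩)
    have h3 := e.right_inv h2.2
    rw [hecoe] at h3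
    have h4 : (e.symm (l, K a)).1 = l := by
      have := congrArg Prod.fst h3
      simpa [hΘ] using this
    have h5 : e.symm (l, K a) = (l, V (l, a)) := Prod.ext h4 rfl
    simp only at h3
    rw [h5] at h3
    have h6 := congrArg (fun x : ℝ × C(unitInterval, E) => x.2 s) h3
    simp only [hΘ, ContinuousMap.sub_apply, ContinuousMap.smul_apply] at h6
    rw [heq l _ (hl.trans_le (min_le_left _ _)) h2.1, smul_smul, hKa, ContinuousMap.const_apply,
      sub_eq_iff_eq_add] at h6
    exact h6
  have hscale : ∀ l a, |l| < min ε₁ ε₂ → ‖a - a₀‖ < ε₂ → ∀ s : unitInterval,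
      V (l, a) s = V (l * s, a) 1 := by
    intro l a hl ha s
    set v : C(unitInterval, E) := ⟨fun t => V (l, a) (s * t), by fun_prop⟩ with hv
    have hvs : ∀ t, v t = V (l, a) (s * t) := fun t => rfl
    have h2 := hball2 (y := (l, a)) (by
      rw [dist_eq_norm, Prod.norm_def]; simpa using ⟨hl.trans_le (min_le_right _ _), ha⟩)
    have hvε : ‖v - c₀‖ < ε₁ := by
      refine lt_of_le_of_lt ?_ h2.1
      rw [ContinuousMap.norm_le _ (norm_nonneg _)]
      intro t
      exact (V (l, a) - c₀).norm_coe_le_norm (s * t)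
    have hls : |l * s| < ε₁ := by
      rw [abs_mul, abs_of_nonneg s.2.1]
      refine lt_of_le_of_lt (mul_le_of_le_one_right (abs_nonneg _) s.2.2) (hl.trans_le (min_le_left _ _))
    have := huniq (l * s) a v hls hvε (by
      intro t
      rw [hvs, hsol l a hl ha]
      simp only [Set.Icc.coe_mul, ← mul_assoc]
      congr 2
      refine intervalIntegral.integral_congr fun τ hτ => ?_
      rw [uIcc_of_le zero_le_one] at hτ
      have hm : (t : ℝ) * τ ∈ Icc (0:ℝ) 1 :=
        ⟨mul_nonneg t.2.1 hτ.1, mul_le_one₀ t.2.2 hτ.1 hτ.2⟩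
      have hm' : (s : ℝ) * t * τ ∈ Icc (0:ℝ) 1 := by
        rw [mul_assoc]
        exact ⟨mul_nonneg s.2.1 hm.1, mul_le_one₀ s.2.2 hm.1 hm.2⟩
      simp only [Set.IccExtend_of_mem _ _ hm, Set.IccExtend_of_mem _ _ hm', hvs]
      congr 4
      exact Subtype.ext (mul_assoc _ _ _))
    rw [← this, hvs, mul_one]
  set ev1 : C(unitInterval, E) →L[ℝ] E := ContinuousMap.evalCLM ℝ 1
  refine ⟨fun x => V x 1, (ev1.analyticAt _).comp hVan, by simp [hV0, hc₀], min ε₁ ε₂,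
    lt_min hε₁ hε₂, ?_, ?_⟩
  · intro l a hl ha
    have ha' := ha.trans_le (min_le_right _ _)
    refine ⟨V (l, a), hscale l a hl ha', fun s => ?_⟩
    rw [hsol l a hl ha' s]
    congr 2
    refine intervalIntegral.integral_congr fun τ hτ => ?_
    rw [uIcc_of_le zero_le_one] at hτ
    have hm : (s : ℝ) * τ ∈ Icc (0:ℝ) 1 :=
      ⟨mul_nonneg s.2.1 hτ.1, mul_le_one₀ s.2.2 hτ.1 hτ.2⟩
    simp only [Set.IccExtend_of_mem _ _ hm]
    rw [hscale l a hl ha', mul_assoc]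
  · intro l a hl ha v hv h
    rw [huniq l a v (hl.trans_le (min_le_left _ _)) (hv.trans_le (min_le_left _ _)) h]

end BriotBouquet

section WeightedIntegral

theorem eq_add_integral_of_singular_ode (k : ℕ) {h e : ℝ → ℝ} {t : ℝ}
    (hc : ContinuousOn h (uIcc 0 t)) (he : ContinuousOn e (uIcc 0 t))
    (hd : ∀ s ∈ uIcc 0 t, s ≠ 0 → s ≠ t → ∃ d, HasDerivAt h d s ∧
      s * d = -k * (h s - h 0) + s * e s) :
    h t = h 0 + t * ∫ τ in (0:ℝ)..1, τ ^ k * e (t * τ) := by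
  rcases eq_or_ne t 0 with rfl | ht
  · simp
  have hmaps : ∀ τ ∈ Icc (0:ℝ) 1, t * τ ∈ uIcc 0 t := by
    intro τ hτ
    rcases le_total 0 t with h0 | h0
    · rw [uIcc_of_le h0]
      exact ⟨mul_nonneg h0 hτ.1, mul_le_of_le_one_right h0 hτ.2⟩
    · rw [uIcc_of_ge h0]
      exact ⟨by nlinarith [hτ.2], by nlinarith [hτ.1]⟩
  have hcm : ContinuousOn (fun τ => t * τ) (Icc (0:ℝ) 1) := by fun_prop
  have h1 : ContinuousOn (fun τ => τ ^ k * (h (t * τ) - h 0)) (Icc (0:ℝ) 1) :=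
    (by fun_prop : ContinuousOn (fun τ : ℝ => τ ^ k) (Icc (0:ℝ) 1)).mul
      ((hc.comp hcm hmaps).sub continuousOn_const)
  have h2 : ContinuousOn (fun τ => t * (τ ^ k * e (t * τ))) (Icc (0:ℝ) 1) :=
    continuousOn_const.mul ((by fun_prop : ContinuousOn (fun τ : ℝ => τ ^ k) (Icc (0:ℝ) 1)).mul
      (he.comp hcm hmaps))
  have h3 := intervalIntegral.integral_eq_sub_of_hasDerivAt_of_le zero_le_one h1
    (f' := fun τ => t * (τ ^ k * e (t * τ))) (by
      intro τ hτ
      obtain ⟨d, hd1, hd2⟩ := hd (t * τ) (hmaps τ ⟨hτ.1.le, hτ.2.le⟩)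
        (mul_ne_zero ht hτ.1.ne') (by
          intro h; exact hτ.2.ne (mul_left_cancel₀ ht (h.trans (mul_one t).symm)))
      have h5 : HasDerivAt (fun τ => h (t * τ)) (d * (t * 1)) τ :=
        HasDerivAt.comp τ hd1 ((hasDerivAt_id' τ).const_mul t)
      have h4 := (hasDerivAt_pow k τ).mul (h5.sub_const (h 0))
      refine h4.congr_deriv ?_
      have hτ0 := hτ.1.ne'
      rcases k with _ | k
      · have : d = e (t * τ) := by
          have : t * τ * d = t * τ * e (t * τ) := by rw [hd2]; simp
          exact mul_left_cancel₀ (mul_ne_zero ht hτ0) this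
        simp [this, mul_comm]
      · simp only [Nat.add_sub_cancel, pow_succ]
        linear_combination (τ ^ k) * hd2)
    (h2.intervalIntegrable_of_Icc zero_le_one)
  rw [intervalIntegral.integral_const_mul] at h3
  rw [h3]
  rcases k with _ | k <;> simp

theorem hasDerivAt_of_eq_add_integral (k : ℕ) {h e : ℝ → ℝ} {ε h₀ t : ℝ}
    (he : ContinuousOn e (Ioo (-ε) ε))
    (heq : ∀ t ∈ Ioo (-ε) ε, h t = h₀ + t * ∫ τ in (0:ℝ)..1, τ ^ k * e (t * τ))
    (ht : t ∈ Ioo (-ε) ε) (ht0 : t ≠ 0) :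
    HasDerivAt h (-k * (h t - h₀) / t + e t) t := by
  have hkey : ∀ t ∈ Ioo (-ε) ε, t ≠ 0 → h t = h₀ + (∫ s in (0:ℝ)..t, s ^ k * e s) / t ^ k := by
    intro t ht ht0
    have := intervalIntegral.mul_integral_comp_mul_left (a := 0) (b := 1)
      (f := fun s => s ^ k * e s) t
    rw [mul_zero, mul_one] at this
    rw [heq t ht, ← this]
    have h2 : ∫ x in (0:ℝ)..1, (t * x) ^ k * e (t * x) =
        t ^ k * ∫ x in (0:ℝ)..1, x ^ k * e (t * x) := by
      rw [← intervalIntegral.integral_const_mul]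
      congr 1; ext x; ring
    rw [h2]
    field_simp
  have hcont : ContinuousOn (fun s => s ^ k * e s) (Ioo (-ε) ε) :=
    (by fun_prop : ContinuousOn (fun s : ℝ => s ^ k) _).mul he
  have hpos : 0 < ε := by
    rcases lt_trichotomy t 0 with h | h | h
    · linarith [ht.1]
    · exact absurd h ht0
    · linarith [ht.2]
  have hsub : uIcc 0 t ⊆ Ioo (-ε) ε := by
    intro s hs
    rw [mem_uIcc] at hs
    rcases hs with hs | hs
    · exact ⟨by linarith, by linarith [ht.2]⟩
    · exact ⟨by linarith [ht.1], by linarith⟩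
  have hd1 : HasDerivAt (fun u => ∫ s in (0:ℝ)..u, s ^ k * e s) (t ^ k * e t) t :=
    intervalIntegral.integral_hasDerivAt_right
      ((hcont.mono hsub).intervalIntegrable)
      (hcont.stronglyMeasurableAtFilter isOpen_Ioo t ht) (hcont.continuousAt (isOpen_Ioo.mem_nhds ht))
  have hd2 := (hd1.div (hasDerivAt_pow k t) (pow_ne_zero k ht0)).const_add h₀
  have hev : h =ᶠ[𝓝 t] fun t => h₀ + (∫ s in (0:ℝ)..t, s ^ k * e s) / t ^ k := by
    filter_upwards [isOpen_Ioo.mem_nhds ht, isOpen_ne.mem_nhds ht0] with u hu hu0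
    exact hkey u hu hu0
  refine (hd2.congr_of_eventuallyEq hev).congr_deriv ?_
  rw [hkey t ht ht0]
  have := pow_ne_zero k ht0
  rcases k with _ | k
  · simp
  · simp only [Nat.add_sub_cancel]
    field_simp
    push_cast
    ring

end WeightedIntegral

section Planar

theorem integral_triple {g₁ g₂ g₃ : ℝ → ℝ} (h₁ : ContinuousOn g₁ (Icc 0 1))
    (h₂ : ContinuousOn g₂ (Icc 0 1)) (h₃ : ContinuousOn g₃ (Icc 0 1)) :
    ∫ τ in (0:ℝ)..1, (g₁ τ, g₂ τ, g₃ τ) =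
      (∫ τ in (0:ℝ)..1, g₁ τ, ∫ τ in (0:ℝ)..1, g₂ τ, ∫ τ in (0:ℝ)..1, g₃ τ) := by
  have hi : IntervalIntegrable (fun τ => (g₁ τ, g₂ τ, g₃ τ)) MeasureTheory.volume 0 1 :=
    (h₁.prodMk (h₂.prodMk h₃)).intervalIntegrable_of_Icc zero_le_one
  refine Prod.ext ?_ (Prod.ext ?_ ?_)
  · exact ((ContinuousLinearMap.fst ℝ ℝ (ℝ × ℝ)).intervalIntegral_comp_comm hi).symm
  · exact ((ContinuousLinearMap.fst ℝ ℝ ℝ ∘L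
      ContinuousLinearMap.snd ℝ ℝ (ℝ × ℝ)).intervalIntegral_comp_comm hi).symm
  · exact ((ContinuousLinearMap.snd ℝ ℝ ℝ ∘L
      ContinuousLinearMap.snd ℝ ℝ (ℝ × ℝ)).intervalIntegral_comp_comm hi).symm

/-- The weight `diag(τ ^ k, 1, 1)`. -/
def planarWeight (k : ℕ) (τ : ℝ) : (ℝ × ℝ × ℝ) →L[ℝ] (ℝ × ℝ × ℝ) :=
  τ ^ k • (ContinuousLinearMap.inl ℝ ℝ (ℝ × ℝ) ∘L ContinuousLinearMap.fst ℝ ℝ (ℝ × ℝ)) +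
    ContinuousLinearMap.inr ℝ ℝ (ℝ × ℝ) ∘L ContinuousLinearMap.snd ℝ ℝ (ℝ × ℝ)

theorem planarWeight_apply (k : ℕ) (τ : ℝ) (x : ℝ × ℝ × ℝ) :
    planarWeight k τ x = (τ ^ k * x.1, x.2) := by
  simp [planarWeight]

theorem continuous_planarWeight (k : ℕ) : Continuous (planarWeight k) := by
  unfold planarWeight
  fun_prop

/-- Singular planar systems `t x' = -k (x - x₀) + t e₁`, `y' = e₂` with a parameter. -/
theorem exists_analyticAt_planar (k : ℕ) {e₁ e₂ : ℝ × ℝ × ℝ × ℝ → ℝ} {x₀ y₀ η₀ : ℝ}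
    (h₁ : AnalyticAt ℝ e₁ (0, x₀, y₀, η₀)) (h₂ : AnalyticAt ℝ e₂ (0, x₀, y₀, η₀)) :
    ∃ X Y : ℝ × ℝ × ℝ × ℝ → ℝ, AnalyticAt ℝ X (0, x₀, y₀, η₀) ∧ AnalyticAt ℝ Y (0, x₀, y₀, η₀) ∧
      X (0, x₀, y₀, η₀) = x₀ ∧ Y (0, x₀, y₀, η₀) = y₀ ∧
      ∃ ε > 0, ∀ x y η, |x - x₀| < ε → |y - y₀| < ε → |η - η₀| < ε →
        (X (0, x, y, η) = x ∧ Y (0, x, y, η) = y ∧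
          ∀ t, |t| < ε → t ≠ 0 →
          HasDerivAt (fun t => X (t, x, y, η)) (-k * (X (t, x, y, η) - x) / t +
            e₁ (t, X (t, x, y, η), Y (t, x, y, η), η)) t ∧
          HasDerivAt (fun t => Y (t, x, y, η)) (e₂ (t, X (t, x, y, η), Y (t, x, y, η), η)) t) ∧
        ∀ (u v : ℝ → ℝ) (t : ℝ), |t| < ε → ContinuousOn u (uIcc 0 t) → ContinuousOn v (uIcc 0 t) →
          u 0 = x → v 0 = y → (∀ s ∈ uIcc 0 t, |u s - x₀| < ε ∧ |v s - y₀| < ε) →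
          (∀ s ∈ uIcc 0 t, s ≠ 0 → s ≠ t → (∃ d, HasDerivAt u d s ∧
            s * d = -k * (u s - x) + s * e₁ (s, u s, v s, η)) ∧
            HasDerivAt v (e₂ (s, u s, v s, η)) s) →
          u t = X (t, x, y, η) ∧ v t = Y (t, x, y, η) := by
  set f : ℝ × ℝ × ℝ × ℝ → ℝ × ℝ × ℝ := fun z => (e₁ z, e₂ z, 0) with hf
  have hfan : AnalyticAt ℝ f (0, (x₀, y₀, η₀)) := h₁.prod (h₂.prod analyticAt_const)
  obtain ⟨U, hU, hU0, ε₁, hε₁, hex, huq⟩ :=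
    exists_analyticAt_briotBouquet (planarWeight k) (continuous_planarWeight k) hfan
  have hUt : Tendsto (fun z : ℝ × ℝ × ℝ × ℝ => (z.1, U z)) (𝓝 (0, x₀, y₀, η₀)) (𝓝 (0, x₀, y₀, η₀)) := by
    have : ContinuousAt (fun z : ℝ × ℝ × ℝ × ℝ => (z.1, U z)) (0, x₀, y₀, η₀) :=
      continuousAt_fst.prodMk hU.continuousAt
    rw [ContinuousAt, hU0] at this
    exact this
  have hcontev : ∀ᶠ z in 𝓝 ((0:ℝ), x₀, y₀, η₀), ContinuousAt e₁ z ∧ ContinuousAt e₂ z := by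
    filter_upwards [h₁.eventually_analyticAt, h₂.eventually_analyticAt] with z h1 h2
    exact ⟨h1.continuousAt, h2.continuousAt⟩
  have hev : ∀ᶠ z in 𝓝 ((0:ℝ), x₀, y₀, η₀), (ContinuousAt e₁ z ∧ ContinuousAt e₂ z) ∧
      (ContinuousAt e₁ (z.1, U z) ∧ ContinuousAt e₂ (z.1, U z)) ∧ ContinuousAt U z :=
    hcontev.and ((hUt.eventually hcontev).and (by
      filter_upwards [hU.eventually_analyticAt] with z h using h.continuousAt))
  obtain ⟨ε₂, hε₂, hball⟩ := Metric.eventually_nhds_iff.1 hev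
  have hball' : ∀ t x y η, |t| < ε₂ → |x - x₀| < ε₂ → |y - y₀| < ε₂ → |η - η₀| < ε₂ →
      dist (t, x, y, η) ((0:ℝ), x₀, y₀, η₀) < ε₂ := by
    intro t x y η ht hx hy hη
    simp only [Prod.dist_eq, Real.dist_eq, sub_zero]
    exact max_lt ht (max_lt hx (max_lt hy hη))
  refine ⟨fun z => (U z).1, fun z => (U z).2.1, analyticAt_fst.comp hU,
    analyticAt_fst.comp (analyticAt_snd.comp hU), by simp [hU0], by simp [hU0],
    min ε₁ ε₂ / 2, by positivity, ?_⟩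
  intro x y η hx hy hη
  have hmin : min ε₁ ε₂ / 2 < min ε₁ ε₂ := half_lt_self (lt_min hε₁ hε₂)
  have hm1 : min ε₁ ε₂ / 2 < ε₁ := hmin.trans_le (min_le_left _ _)
  have hm2 : min ε₁ ε₂ / 2 < ε₂ := hmin.trans_le (min_le_right _ _)
  have ha : ‖(x, y, η) - (x₀, y₀, η₀)‖ < ε₁ := by
    simp only [Prod.norm_def, Prod.fst_sub, Prod.snd_sub, Real.norm_eq_abs]
    exact max_lt (hx.trans hm1) (max_lt (hy.trans hm1) (hη.trans hm1))
  constructor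
  · set ε := min ε₁ ε₂ / 2 with hε
    have hcU : ∀ t ∈ Ioo (-ε) ε, ContinuousAt (fun t => U (t, x, y, η)) t := by
      intro t ht
      have := (hball (hball' t x y η ((abs_lt.2 ht).trans hm2) (hx.trans hm2) (hy.trans hm2)
        (hη.trans hm2))).2.2
      exact ContinuousAt.comp (f := fun t : ℝ => (t, x, y, η)) this (by fun_prop)
    have hceU : ∀ t ∈ Ioo (-ε) ε, ContinuousAt (fun t => e₁ (t, U (t, x, y, η))) t ∧
        ContinuousAt (fun t => e₂ (t, U (t, x, y, η))) t := by
      intro t ht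
      have := (hball (hball' t x y η ((abs_lt.2 ht).trans hm2) (hx.trans hm2) (hy.trans hm2)
        (hη.trans hm2))).2.1
      have h3 : ContinuousAt (fun t => (t, U (t, x, y, η))) t := continuousAt_id.prodMk (hcU t ht)
      exact ⟨ContinuousAt.comp (f := fun t => (t, U (t, x, y, η))) this.1 h3,
        ContinuousAt.comp (f := fun t => (t, U (t, x, y, η))) this.2 h3⟩
    have hUeq : ∀ t ∈ Ioo (-ε) ε, U (t, x, y, η) = (x, y, η) + t • ∫ τ in (0:ℝ)..1,
        (planarWeight k τ) (f (t * τ, U (t * τ, x, y, η))) := by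
      intro t ht
      obtain ⟨v, hv1, hv2⟩ := hex t (x, y, η) ((abs_lt.2 ht).trans hm1) ha
      have h1 := hv1 1
      have h2 := hv2 1
      simp only [Set.Icc.coe_one, mul_one] at h1 h2
      rw [← h1, h2]
    have hmem : ∀ t ∈ Ioo (-ε) ε, ∀ τ ∈ Icc (0:ℝ) 1, t * τ ∈ Ioo (-ε) ε := by
      intro t ht τ hτ
      rw [mem_Ioo, ← abs_lt] at ht
      rw [mem_Ioo, ← abs_lt, abs_mul, abs_of_nonneg hτ.1]
      exact lt_of_le_of_lt (mul_le_of_le_one_right (abs_nonneg _) hτ.2) ht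
    have hUeq3 : ∀ t ∈ Ioo (-ε) ε, (U (t, x, y, η)).1 = x + t * ∫ τ in (0:ℝ)..1,
          τ ^ k * e₁ (t * τ, U (t * τ, x, y, η)) ∧
        (U (t, x, y, η)).2.1 = y + t * ∫ τ in (0:ℝ)..1,
          τ ^ 0 * e₂ (t * τ, U (t * τ, x, y, η)) ∧ (U (t, x, y, η)).2.2 = η := by
      intro t ht
      have hcτ : ContinuousOn (fun τ => t * τ) (Icc (0:ℝ) 1) := by fun_prop
      have hc1 : ContinuousOn (fun τ => e₁ (t * τ, U (t * τ, x, y, η))) (Icc (0:ℝ) 1) :=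
        ContinuousOn.comp (g := fun t => e₁ (t, U (t, x, y, η))) (t := Ioo (-ε) ε)
          (fun s hs => (hceU s hs).1.continuousWithinAt) hcτ (hmem t ht)
      have hc2 : ContinuousOn (fun τ => e₂ (t * τ, U (t * τ, x, y, η))) (Icc (0:ℝ) 1) :=
        ContinuousOn.comp (g := fun t => e₂ (t, U (t, x, y, η))) (t := Ioo (-ε) ε)
          (fun s hs => (hceU s hs).2.continuousWithinAt) hcτ (hmem t ht)
      have h1 := hUeq t ht
      simp only [planarWeight_apply, hf] at h1
      rw [integral_triple (g₁ := fun τ => τ ^ k * e₁ (t * τ, U (t * τ, x, y, η)))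
        ((by fun_prop : ContinuousOn (fun τ : ℝ => τ ^ k) _).mul hc1) hc2
        continuousOn_const] at h1
      rw [h1]
      simp
    have hU0' : U (0, x, y, η) = (x, y, η) := by
      have := hUeq 0 ⟨by simp [hε, hε₁, hε₂], by positivity⟩
      simpa using this
    have hUη : ∀ t ∈ Ioo (-ε) ε, U (t, x, y, η) = ((U (t, x, y, η)).1, (U (t, x, y, η)).2.1, η) :=
      fun t ht => Prod.ext rfl (Prod.ext rfl (hUeq3 t ht).2.2)
    refine ⟨by simp [hU0'], by simp [hU0'], fun t ht ht0 => ?_⟩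
    have ht' : t ∈ Ioo (-ε) ε := abs_lt.1 ht
    constructor
    · have := hasDerivAt_of_eq_add_integral k (h := fun t => (U (t, x, y, η)).1)
        (e := fun t => e₁ (t, U (t, x, y, η))) (fun s hs => (hceU s hs).1.continuousWithinAt)
        (fun t ht => (hUeq3 t ht).1) ht' ht0
      rw [← hUη t ht']
      exact this
    · have := hasDerivAt_of_eq_add_integral 0 (h := fun t => (U (t, x, y, η)).2.1)
        (e := fun t => e₂ (t, U (t, x, y, η))) (fun s hs => (hceU s hs).2.continuousWithinAt)
        (fun t ht => (hUeq3 t ht).2.1) ht' ht0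
      rw [← hUη t ht']
      simpa using this
  · intro u v t ht hu hv hux hvy hbd hode
    have hmaps : ∀ τ ∈ Icc (0:ℝ) 1, t * τ ∈ uIcc 0 t := by
      intro τ hτ
      rcases le_total 0 t with h0 | h0
      · rw [uIcc_of_le h0]
        exact ⟨mul_nonneg h0 hτ.1, mul_le_of_le_one_right h0 hτ.2⟩
      · rw [uIcc_of_ge h0]
        exact ⟨by nlinarith [hτ.2], by nlinarith [hτ.1]⟩
    have hcτ : ContinuousOn (fun τ => t * τ) (Icc (0:ℝ) 1) := by fun_prop
    have hcu := hu.comp hcτ hmaps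
    have hcv := hv.comp hcτ hmaps
    set w : C(unitInterval, ℝ × ℝ × ℝ) := ⟨fun s => (u (t * s), v (t * s), η), by
      rw [continuousOn_iff_continuous_domRestrict] at hcu hcv
      exact hcu.prodMk (hcv.prodMk continuous_const)⟩ with hw
    have hws : ∀ s, w s = (u (t * s), v (t * s), η) := fun s => rfl
    have hwb : ‖w - ContinuousMap.const _ (x₀, y₀, η₀)‖ < ε₁ := by
      refine lt_of_le_of_lt ?_ hm1
      rw [ContinuousMap.norm_le _ (by positivity)]
      intro s
      have := hbd _ (hmaps s s.2)
      simp only [ContinuousMap.sub_apply, hws, ContinuousMap.const_apply, Prod.norm_def,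
        Prod.fst_sub, Prod.snd_sub, Real.norm_eq_abs]
      exact max_le this.1.le (max_le this.2.le hη.le)
    have hmain := huq t (x, y, η) (ht.trans hm1) ha w hwb (by
      intro s
      have hsub' : uIcc 0 (t * s) ⊆ uIcc 0 t := uIcc_subset_uIcc left_mem_uIcc (hmaps s s.2)
      have habs : ∀ r ∈ uIcc 0 t, |r| < ε₂ := by
        intro r hr
        rw [mem_uIcc] at hr
        rw [abs_lt] at ht ⊢
        rcases hr with hr | hr
        · exact ⟨by linarith, by linarith⟩
        · exact ⟨by linarith, by linarith⟩
      have hcuv : ContinuousOn (fun r => (r, u r, v r, η)) (uIcc 0 t) :=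
        continuousOn_id.prodMk (hu.prodMk (hv.prodMk continuousOn_const))
      have hce : ∀ r ∈ uIcc 0 t, ContinuousAt e₁ (r, u r, v r, η) ∧ ContinuousAt e₂ (r, u r, v r, η) :=
        fun r hr => (hball (hball' r _ _ _ (habs r hr) ((hbd r hr).1.trans hm2)
          ((hbd r hr).2.trans hm2) (hη.trans hm2))).1
      have hce1 : ContinuousOn (fun r => e₁ (r, u r, v r, η)) (uIcc 0 t) := fun r hr =>
        ContinuousAt.comp_continuousWithinAt (f := fun r => (r, u r, v r, η)) (hce r hr).1 (hcuv r hr)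
      have hce2 : ContinuousOn (fun r => e₂ (r, u r, v r, η)) (uIcc 0 t) := fun r hr =>
        ContinuousAt.comp_continuousWithinAt (f := fun r => (r, u r, v r, η)) (hce r hr).2 (hcuv r hr)
      have hnt : ∀ r ∈ uIcc 0 (t * s), r ≠ 0 → r ≠ t * s → r ≠ t := by
        rintro r hr hr0 hrs rfl
        have hs := s.2
        rw [mem_uIcc] at hr
        rcases hr with hr | hr
        · exact hrs (le_antisymm hr.2 (mul_le_of_le_one_right hr.1 hs.2))
        · exact hrs (le_antisymm (by nlinarith [hs.2]) hr.1)
      have E1 := eq_add_integral_of_singular_ode k (h := u) (e := fun r => e₁ (r, u r, v r, η))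
        (hu.mono hsub') (hce1.mono hsub') (fun r hr hr0 hr1 => by
          have := (hode r (hsub' hr) hr0 (hnt r hr hr0 hr1)).1
          rw [← hux] at this
          exact this)
      have E2 := eq_add_integral_of_singular_ode 0 (h := v) (e := fun r => e₂ (r, u r, v r, η))
        (hv.mono hsub') (hce2.mono hsub') (fun r hr hr0 hr1 =>
          ⟨_, (hode r (hsub' hr) hr0 (hnt r hr hr0 hr1)).2, by simp⟩)
      have hcomp : ∀ g : ℝ → ℝ, ContinuousOn g (uIcc 0 t) →
          ContinuousOn (fun τ => g (t * s * τ)) (Icc (0:ℝ) 1) := by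
        intro g hg
        refine hg.comp (by fun_prop) ?_
        intro τ hτ
        rw [mul_assoc]
        exact hmaps _ ⟨mul_nonneg s.2.1 hτ.1, mul_le_one₀ s.2.2 hτ.1 hτ.2⟩
      have hintegr : ∫ τ in (0:ℝ)..1, planarWeight k τ (f (t * s * τ, IccExtend zero_le_one w (s * τ))) =
          ∫ τ in (0:ℝ)..1, (τ ^ k * e₁ (t * s * τ, u (t * s * τ), v (t * s * τ), η),
            e₂ (t * s * τ, u (t * s * τ), v (t * s * τ), η), (0:ℝ)) := by
        refine intervalIntegral.integral_congr fun τ hτ => ?_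
        rw [uIcc_of_le zero_le_one] at hτ
        have hm : (s : ℝ) * τ ∈ Icc (0:ℝ) 1 :=
          ⟨mul_nonneg s.2.1 hτ.1, mul_le_one₀ s.2.2 hτ.1 hτ.2⟩
        simp only [Set.IccExtend_of_mem _ _ hm, hws, planarWeight_apply, hf, ← mul_assoc]
      rw [hintegr, integral_triple
        (g₁ := fun τ => τ ^ k * e₁ (t * s * τ, u (t * s * τ), v (t * s * τ), η))
        ((by fun_prop : ContinuousOn (fun τ : ℝ => τ ^ k) _).mul (hcomp _ hce1)) (hcomp _ hce2) continuousOn_const, hws, E1, E2, hux, hvy]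
      simp)
    simp only [← hmain, hws]
    simp

end Planar

/-- `1 - 2 α sin² F`. -/
def qf (α F : ℝ) : ℝ := 1 - 2 * α * sin F ^ 2

/-- The radical `√(q² + 4 α y N²)`. -/
def Rf (α y F N : ℝ) : ℝ := √(qf α F ^ 2 + 4 * α * y * N ^ 2)

/-- The metric function as a function of the dynamical variables. -/
def Af (α y F N : ℝ) : ℝ := (Rf α y F N + qf α F) / 2

section Algebra

variable {α y F N : ℝ}

theorem qf_ge (h0 : 0 ≤ α) : 1 - 2 * α ≤ qf α F := by
  unfold qf
  nlinarith [sin_sq_le_one F]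

theorem qf_pos (h0 : 0 ≤ α) (h1 : α < 1 / 2) : 0 < qf α F := by
  have := qf_ge (F := F) h0
  linarith

theorem radicand_pos (h0 : 0 ≤ α) (h1 : α < 1 / 2) (hy : 0 ≤ y) :
    0 < qf α F ^ 2 + 4 * α * y * N ^ 2 := by
  have := qf_pos (F := F) h0 h1
  positivity

theorem Rf_sq (h0 : 0 ≤ α) (h1 : α < 1 / 2) (hy : 0 ≤ y) :
    Rf α y F N ^ 2 = qf α F ^ 2 + 4 * α * y * N ^ 2 :=
  Real.sq_sqrt (radicand_pos h0 h1 hy).le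

theorem Rf_pos (h0 : 0 ≤ α) (h1 : α < 1 / 2) (hy : 0 ≤ y) : 0 < Rf α y F N :=
  Real.sqrt_pos.2 (radicand_pos h0 h1 hy)

theorem qf_le_Rf (h0 : 0 ≤ α) (hy : 0 ≤ y) : qf α F ≤ Rf α y F N := by
  refine Real.le_sqrt_of_sq_le ?_
  have : 0 ≤ 4 * α * y * N ^ 2 := by positivity
  linarith

theorem Rf_ge (h0 : 0 ≤ α) (hy : 0 ≤ y) : 1 - 2 * α ≤ Rf α y F N :=
  (qf_ge h0).trans (qf_le_Rf h0 hy)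

theorem Af_pos (h0 : 0 ≤ α) (h1 : α < 1 / 2) (hy : 0 ≤ y) : 0 < Af α y F N := by
  have := qf_pos (F := F) h0 h1
  have := Rf_pos (F := F) (N := N) h0 h1 hy
  unfold Af; linarith

theorem Af_le_Rf (h0 : 0 ≤ α) (hy : 0 ≤ y) : Af α y F N ≤ Rf α y F N := by
  have := qf_le_Rf (F := F) (N := N) h0 hy
  unfold Af; linarith

theorem qf_le_Af (h0 : 0 ≤ α) (hy : 0 ≤ y) : qf α F ≤ Af α y F N := by
  have := qf_le_Rf (F := F) (N := N) h0 hy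
  unfold Af; linarith

theorem Rf_eq : Rf α y F N = 2 * Af α y F N - qf α F := by unfold Af; ring

theorem Af_sq (h0 : 0 ≤ α) (h1 : α < 1 / 2) (hy : 0 ≤ y) :
    Af α y F N ^ 2 = qf α F * Af α y F N + α * y * N ^ 2 := by
  have := Rf_sq (F := F) (N := N) h0 h1 hy
  rw [Rf_eq] at this
  linarith

end Algebra

@[fun_prop]
theorem AnalyticAt.fst_comp {V G H : Type*} [NormedAddCommGroup V] [NormedSpace ℝ V]
    [NormedAddCommGroup G] [NormedSpace ℝ G] [NormedAddCommGroup H] [NormedSpace ℝ H]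
    {f : V → G × H} {x : V} (hf : AnalyticAt ℝ f x) : AnalyticAt ℝ (fun x => (f x).1) x :=
  analyticAt_fst.comp hf

@[fun_prop]
theorem AnalyticAt.snd_comp {V G H : Type*} [NormedAddCommGroup V] [NormedSpace ℝ V]
    [NormedAddCommGroup G] [NormedSpace ℝ G] [NormedAddCommGroup H] [NormedSpace ℝ H]
    {f : V → G × H} {x : V} (hf : AnalyticAt ℝ f x) : AnalyticAt ℝ (fun x => (f x).2) x :=
  analyticAt_snd.comp hf

theorem analyticAt_Rf {α : ℝ} {z : ℝ × ℝ × ℝ} (h : qf α z.2.1 ^ 2 + 4 * α * z.1 * z.2.2 ^ 2 ≠ 0) :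
    AnalyticAt ℝ (fun z : ℝ × ℝ × ℝ => Rf α z.1 z.2.1 z.2.2) z := by
  unfold Rf
  have h1 : AnalyticAt ℝ Real.sqrt (qf α z.2.1 ^ 2 + 4 * α * z.1 * z.2.2 ^ 2) :=
    (Real.contDiffAt_sqrt h).analyticAt
  refine h1.comp_of_eq (f := fun z : ℝ × ℝ × ℝ => qf α z.2.1 ^ 2 + 4 * α * z.1 * z.2.2 ^ 2) ?_ rfl
  unfold qf
  have : AnalyticAt ℝ (fun z : ℝ × ℝ × ℝ => sin z.2.1) z :=
    Real.analyticAt_sin.comp_of_eq (f := fun z : ℝ × ℝ × ℝ => z.2.1) (by fun_prop) rfl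
  fun_prop

/-- Right-hand side of the equation for `F`. -/
def vF (α η ξ F P : ℝ) : ℝ := P / (ξ ^ 2 * Rf α (1 - η * ξ ^ 2) F (P / ξ))

/-- Right-hand side of the equation for `P`. -/
def vP (α η ξ F P : ℝ) : ℝ :=
  sin (2 * F) * Af α (1 - η * ξ ^ 2) F (P / ξ) / (Rf α (1 - η * ξ ^ 2) F (P / ξ) * (1 - η * ξ ^ 2))

/-- Solutions of the reduced first order system on `(0, b)`, regular at the centre. -/
structure IsSol (α η c b : ℝ) (F P : ℝ → ℝ) : Prop where
  hF : ∀ ξ ∈ Ioo 0 b, HasDerivAt F (vF α η ξ (F ξ) (P ξ)) ξ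
  hP : ∀ ξ ∈ Ioo 0 b, HasDerivAt P (vP α η ξ (F ξ) (P ξ)) ξ
  f0 : Tendsto (fun ξ => F ξ / ξ) (𝓝[>] 0) (𝓝 c)
  n0 : Tendsto (fun ξ => P ξ / ξ ^ 2) (𝓝[>] 0) (𝓝 c)

section Centre

theorem analyticAt_sinc : AnalyticAt ℝ sinc 0 := by
  obtain ⟨p, hp⟩ := Real.analyticAt_sin (x := 0)
  rw [Real.sinc_eq_dslope]
  exact hp.has_fpower_series_dslope_fslope.analyticAt

/-- The quotient `(sinc x - 1) / x`. -/
def sincQuot : ℝ → ℝ := dslope sinc 0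

theorem analyticAt_sincQuot : AnalyticAt ℝ sincQuot 0 := by
  obtain ⟨p, hp⟩ := analyticAt_sinc
  exact hp.has_fpower_series_dslope_fslope.analyticAt

theorem mul_sinc (x : ℝ) : x * sinc x = sin x := by
  rcases eq_or_ne x 0 with rfl | h
  · simp
  · rw [Real.sinc_of_ne_zero h]; field_simp

theorem mul_sincQuot (x : ℝ) : x * sincQuot x = sinc x - 1 := by
  have := sub_smul_dslope sinc 0 x
  simpa [sincQuot] using this

/-- Radical in desingularised variables at the centre. -/
def cR (α ξ f n η : ℝ) : ℝ := Rf α (1 - η * ξ ^ 2) (ξ * f) (ξ * n)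

/-- `A / R` in desingularised variables at the centre. -/
def cB (α ξ f n η : ℝ) : ℝ := (cR α ξ f n η + qf α (ξ * f)) / (2 * cR α ξ f n η)

/-- Remainder in the equation for `f`. -/
def ce₁ (α ξ f n η : ℝ) : ℝ :=
  ξ * n * (4 * α * (f * sinc (ξ * f)) ^ 2 - 4 * α ^ 2 * ξ ^ 2 * (f * sinc (ξ * f)) ^ 4
    - 4 * α * (1 - η * ξ ^ 2) * n ^ 2) / (cR α ξ f n η * (1 + cR α ξ f n η))

/-- Remainder in the equation for `n`. -/
def ce₂ (α ξ f n η : ℝ) : ℝ :=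
  2 * f * (2 * f * sincQuot (2 * (ξ * f))) * cB α ξ f n η / (1 - η * ξ ^ 2) +
    2 * f * (η * ξ * cB α ξ f n η / (1 - η * ξ ^ 2) -
      4 * α * (1 - η * ξ ^ 2) * ξ * n ^ 2 / (2 * cR α ξ f n η * (qf α (ξ * f) + cR α ξ f n η)))

theorem mul_ce₁ {α ξ f n η : ℝ} (h0 : 0 ≤ α) (h1 : α < 1 / 2) (hy : 0 < 1 - η * ξ ^ 2) :
    ξ * ce₁ α ξ f n η = n / cR α ξ f n η - n := by
  have hR : 0 < cR α ξ f n η := Rf_pos h0 h1 hy.le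
  have hR2 : cR α ξ f n η ^ 2 = _ := Rf_sq (F := ξ * f) (N := ξ * n) h0 h1 hy.le
  have hs := mul_sinc (ξ * f)
  unfold qf at hR2
  rw [← hs] at hR2
  unfold ce₁
  have : 1 + cR α ξ f n η ≠ 0 := by positivity
  field_simp
  linear_combination n * hR2

theorem mul_ce₂ {α ξ f n η : ℝ} (h0 : 0 ≤ α) (h1 : α < 1 / 2) (hξ : ξ ≠ 0) (hy : 0 < 1 - η * ξ ^ 2) :
    ξ * ce₂ α ξ f n η = sin (2 * (ξ * f)) * cB α ξ f n η / (ξ * (1 - η * ξ ^ 2)) - 2 * f := by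
  have hR : 0 < cR α ξ f n η := Rf_pos h0 h1 hy.le
  have hR2 : cR α ξ f n η ^ 2 = _ := Rf_sq (F := ξ * f) (N := ξ * n) h0 h1 hy.le
  have hq := qf_pos (F := ξ * f) h0 h1
  have hs := mul_sinc (2 * (ξ * f))
  have hs2 := mul_sincQuot (2 * (ξ * f))
  have hs3 : sin (2 * (ξ * f)) = 2 * (ξ * f) * (1 + 2 * (ξ * f) * sincQuot (2 * (ξ * f))) := by
    rw [← hs]; rw [hs2]; ring
  have e1 : 4 * α * (1 - η * ξ ^ 2) * ξ * n ^ 2 / (2 * cR α ξ f n η * (qf α (ξ * f) + cR α ξ f n η)) * ξ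
      = 1 - cB α ξ f n η := by
    unfold cB
    have : qf α (ξ * f) + cR α ξ f n η ≠ 0 := by positivity
    field_simp
    linear_combination -hR2
  unfold ce₂
  rw [hs3]
  have e2 : ξ * (η * ξ * cB α ξ f n η / (1 - η * ξ ^ 2)) = cB α ξ f n η / (1 - η * ξ ^ 2) - cB α ξ f n η := by
    have : 1 - ξ ^ 2 * η ≠ 0 := by rw [mul_comm]; exact hy.ne'
    field_simp; ring
  have e3 : 2 * (ξ * f) * (1 + 2 * (ξ * f) * sincQuot (2 * (ξ * f))) * cB α ξ f n η / (ξ * (1 - η * ξ ^ 2))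
      = 2 * f * cB α ξ f n η / (1 - η * ξ ^ 2) +
        ξ * (2 * f * (2 * f * sincQuot (2 * (ξ * f))) * cB α ξ f n η / (1 - η * ξ ^ 2)) := by
    field_simp
  rw [e3]
  linear_combination (2 * f) * e2 - (2 * f) * e1

theorem analyticAt_ce {α c η : ℝ} :
    AnalyticAt ℝ (fun z : ℝ × ℝ × ℝ × ℝ =>
      ce₁ α z.1 (z.2.2.1 + z.2.1 / 3) (z.2.2.1 - 2 * z.2.1 / 3) z.2.2.2) (0, 0, c, η) ∧
    AnalyticAt ℝ (fun z : ℝ × ℝ × ℝ × ℝ =>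
      ce₂ α z.1 (z.2.2.1 + z.2.1 / 3) (z.2.2.1 - 2 * z.2.1 / 3) z.2.2.2) (0, 0, c, η) := by
  have hR : AnalyticAt ℝ (fun z : ℝ × ℝ × ℝ × ℝ =>
      cR α z.1 (z.2.2.1 + z.2.1 / 3) (z.2.2.1 - 2 * z.2.1 / 3) z.2.2.2) (0, 0, c, η) := by
    unfold cR
    refine AnalyticAt.comp_of_eq (g := fun z : ℝ × ℝ × ℝ => Rf α z.1 z.2.1 z.2.2)
      (f := fun z : ℝ × ℝ × ℝ × ℝ => (1 - z.2.2.2 * z.1 ^ 2, z.1 * (z.2.2.1 + z.2.1 / 3),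
        z.1 * (z.2.2.1 - 2 * z.2.1 / 3))) (y := (1, 0, 0)) (analyticAt_Rf ?_) ?_ ?_
    · simp [qf]
    · fun_prop
    · simp
  have hR0 : cR α 0 (c + 0 / 3) (c - 2 * 0 / 3) η = 1 := by
    simp [cR, Rf, qf]
  have hf : AnalyticAt ℝ (fun z : ℝ × ℝ × ℝ × ℝ => z.1 * (z.2.2.1 + z.2.1 / 3)) (0, 0, c, η) := by
    fun_prop
  have hf2 : AnalyticAt ℝ (fun z : ℝ × ℝ × ℝ × ℝ => 2 * (z.1 * (z.2.2.1 + z.2.1 / 3))) (0, 0, c, η) := by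
    fun_prop
  have hs : AnalyticAt ℝ (fun z : ℝ × ℝ × ℝ × ℝ => sin (z.1 * (z.2.2.1 + z.2.1 / 3))) (0, 0, c, η) :=
    Real.analyticAt_sin.comp_of_eq hf rfl
  have hsinc : AnalyticAt ℝ (fun z : ℝ × ℝ × ℝ × ℝ => sinc (z.1 * (z.2.2.1 + z.2.1 / 3))) (0, 0, c, η) :=
    analyticAt_sinc.comp_of_eq hf (by simp)
  have hsq : AnalyticAt ℝ (fun z : ℝ × ℝ × ℝ × ℝ => sincQuot (2 * (z.1 * (z.2.2.1 + z.2.1 / 3)))) (0, 0, c, η) :=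
    analyticAt_sincQuot.comp_of_eq hf2 (by simp)
  have hq : AnalyticAt ℝ (fun z : ℝ × ℝ × ℝ × ℝ => qf α (z.1 * (z.2.2.1 + z.2.1 / 3))) (0, 0, c, η) := by
    unfold qf
    fun_prop
  have hB : AnalyticAt ℝ (fun z : ℝ × ℝ × ℝ × ℝ =>
      cB α z.1 (z.2.2.1 + z.2.1 / 3) (z.2.2.1 - 2 * z.2.1 / 3) z.2.2.2) (0, 0, c, η) := by
    unfold cB
    refine (hR.add hq).div (by fun_prop) ?_
    simp only [hR0]
    norm_num
  constructor
  · unfold ce₁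
    refine AnalyticAt.div (by fun_prop) (by fun_prop) ?_
    simp only [hR0]
    norm_num
  · unfold ce₂
    refine AnalyticAt.add ?_ (AnalyticAt.mul (by fun_prop) (AnalyticAt.sub ?_ ?_))
    · refine AnalyticAt.div (by fun_prop) (by fun_prop) ?_
      simp
    · refine AnalyticAt.div (by fun_prop) (by fun_prop) ?_
      simp
    · refine AnalyticAt.div (by fun_prop) (by fun_prop) ?_
      simp only [hR0]
      simp [qf]

end Centre

section LocalCentre

variable {α : ℝ}

theorem one_sub_mul_sq_pos {η ξ δ η₀ : ℝ} (hη : |η - η₀| < δ) (hξ : |ξ| < δ)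
    (hδ : δ ≤ 1 / (|η₀| + 2)) : 0 < 1 - η * ξ ^ 2 := by
  have h0 : 0 < δ := (abs_nonneg _).trans_lt hξ
  have h1 : δ * (|η₀| + 2) ≤ 1 := by
    rwa [le_div_iff₀ (by positivity)] at hδ
  have h2 : δ ≤ 1 := by nlinarith [abs_nonneg η₀]
  have h3 : η ≤ |η₀| + 1 := by
    have := abs_lt.1 hη
    have := le_abs_self η₀
    linarith
  have h4 : ξ ^ 2 < δ ^ 2 := by
    rw [← sq_abs]
    exact pow_lt_pow_left₀ hξ (abs_nonneg _) two_ne_zero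
  have h5 : η * ξ ^ 2 ≤ (|η₀| + 1) * ξ ^ 2 := by gcongr
  have h6 : (|η₀| + 1) * ξ ^ 2 ≤ (|η₀| + 1) * δ ^ 2 := by gcongr
  nlinarith [abs_nonneg η₀]

theorem vF_centre {η ξ f n : ℝ} (hξ : ξ ≠ 0) :
    vF α η ξ (ξ * f) (ξ ^ 2 * n) = n / cR α ξ f n η := by
  unfold vF cR
  have : ξ ^ 2 * n / ξ = ξ * n := by field_simp
  rw [this, mul_div_mul_left _ _ (pow_ne_zero 2 hξ)]

theorem vP_centre {η ξ f n : ℝ} (hξ : ξ ≠ 0) (h : cR α ξ f n η ≠ 0) :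
    vP α η ξ (ξ * f) (ξ ^ 2 * n) = sin (2 * (ξ * f)) * cB α ξ f n η / (1 - η * ξ ^ 2) := by
  unfold vP cB Af
  have : ξ ^ 2 * n / ξ = ξ * n := by field_simp
  rw [this]
  change sin (2 * (ξ * f)) * ((cR α ξ f n η + _) / 2) / (cR α ξ f n η * (1 - η * ξ ^ 2)) = _
  rcases eq_or_ne (1 - η * ξ ^ 2) 0 with h2 | h2
  · simp [h2]
  · field_simp

theorem exists_local_sol (h0 : 0 ≤ α) (h1 : α < 1 / 2) (c₀ η₀ : ℝ) :
    ∃ Φ Ψ : ℝ × ℝ × ℝ → ℝ, AnalyticAt ℝ Φ (0, c₀, η₀) ∧ AnalyticAt ℝ Ψ (0, c₀, η₀) ∧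
      Φ (0, c₀, η₀) = c₀ ∧ Ψ (0, c₀, η₀) = c₀ ∧ ∃ δ > 0, δ ≤ 1 / (|η₀| + 2) ∧
      ∀ c η, |c - c₀| < δ → |η - η₀| < δ →
        IsSol α η c δ (fun ξ => ξ * Φ (ξ, c, η)) (fun ξ => ξ ^ 2 * Ψ (ξ, c, η)) ∧
        ∀ b F P, 0 < b → IsSol α η c b F P →
          ∀ᶠ ξ in 𝓝[>] 0, F ξ = ξ * Φ (ξ, c, η) ∧ P ξ = ξ ^ 2 * Ψ (ξ, c, η) := by
  set e₁ : ℝ × ℝ × ℝ × ℝ → ℝ := fun z =>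
    ce₁ α z.1 (z.2.2.1 + z.2.1 / 3) (z.2.2.1 - 2 * z.2.1 / 3) z.2.2.2 with he₁
  set e₂ : ℝ × ℝ × ℝ × ℝ → ℝ := fun z =>
    ce₂ α z.1 (z.2.2.1 + z.2.1 / 3) (z.2.2.1 - 2 * z.2.1 / 3) z.2.2.2 with he₂
  obtain ⟨a1, a2⟩ : AnalyticAt ℝ e₁ (0, 0, c₀, η₀) ∧ AnalyticAt ℝ e₂ (0, 0, c₀, η₀) :=
    analyticAt_ce
  obtain ⟨X, Y, hX, hY, hX0, hY0, ε, hε, hmain⟩ :=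
    exists_analyticAt_planar 3 (e₁ := fun z => e₁ z - e₂ z) (e₂ := fun z => (2 * e₁ z + e₂ z) / 3)
      (x₀ := 0) (y₀ := c₀) (η₀ := η₀) (by fun_prop) (by fun_prop)
  have hcont : ∀ᶠ z in 𝓝 ((0:ℝ), (0:ℝ), c₀, η₀), ContinuousAt X z ∧ ContinuousAt Y z := by
    filter_upwards [hX.eventually_analyticAt, hY.eventually_analyticAt] with z h1 h2
    exact ⟨h1.continuousAt, h2.continuousAt⟩
  obtain ⟨ε₂, hε₂, hball⟩ := Metric.eventually_nhds_iff.1 hcont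
  set Φ : ℝ × ℝ × ℝ → ℝ := fun z => Y (z.1, 0, z.2.1, z.2.2) + X (z.1, 0, z.2.1, z.2.2) / 3 with hΦ
  set Ψ : ℝ × ℝ × ℝ → ℝ := fun z => Y (z.1, 0, z.2.1, z.2.2) - 2 * X (z.1, 0, z.2.1, z.2.2) / 3
    with hΨ
  have hX' : AnalyticAt ℝ (fun z : ℝ × ℝ × ℝ => X (z.1, 0, z.2.1, z.2.2)) (0, c₀, η₀) :=
    hX.comp_of_eq (f := fun z : ℝ × ℝ × ℝ => (z.1, (0:ℝ), z.2.1, z.2.2)) (by fun_prop) rfl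
  have hY' : AnalyticAt ℝ (fun z : ℝ × ℝ × ℝ => Y (z.1, 0, z.2.1, z.2.2)) (0, c₀, η₀) :=
    hY.comp_of_eq (f := fun z : ℝ × ℝ × ℝ => (z.1, (0:ℝ), z.2.1, z.2.2)) (by fun_prop) rfl
  set δ := min (min ε ε₂) (1 / (|η₀| + 2)) with hδ
  have hδε : δ ≤ ε := (min_le_left _ _).trans (min_le_left _ _)
  have hδε₂ : δ ≤ ε₂ := (min_le_left _ _).trans (min_le_right _ _)
  have hδ3 : δ ≤ 1 / (|η₀| + 2) := min_le_right _ _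
  have hδ0 : 0 < δ := lt_min (lt_min hε hε₂) (by positivity)
  refine ⟨Φ, Ψ, by fun_prop, by fun_prop, by simp [hΦ, hX0, hY0], by simp [hΨ, hX0, hY0], δ,
    hδ0, hδ3, ?_⟩
  intro c η hc hη
  obtain ⟨⟨hXi, hYi, hode⟩, huniq⟩ := hmain 0 c η (by simpa using hε) (hc.trans_le hδε) (hη.trans_le hδε)
  have hcR : ∀ ξ f n, |ξ| < δ → 0 < cR α ξ f n η := fun ξ f n hξ =>
    Rf_pos h0 h1 (one_sub_mul_sq_pos hη hξ hδ3).le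
  have hcont0 : ContinuousAt (fun ξ => X (ξ, 0, c, η)) 0 ∧ ContinuousAt (fun ξ => Y (ξ, 0, c, η)) 0 := by
    have := hball (y := (0, 0, c, η)) (by
      simp only [Prod.dist_eq, Real.dist_eq, sub_zero, abs_zero]
      exact max_lt hε₂ (max_lt hε₂ (max_lt (hc.trans_le hδε₂) (hη.trans_le hδε₂))))
    exact ⟨ContinuousAt.comp (f := fun ξ : ℝ => (ξ, (0:ℝ), c, η)) this.1 (by fun_prop),
      ContinuousAt.comp (f := fun ξ : ℝ => (ξ, (0:ℝ), c, η)) this.2 (by fun_prop)⟩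
  constructor
  · have key : ∀ ξ ∈ Ioo 0 δ,
        HasDerivAt (fun ξ => ξ * Φ (ξ, c, η)) (vF α η ξ (ξ * Φ (ξ, c, η)) (ξ ^ 2 * Ψ (ξ, c, η))) ξ ∧
        HasDerivAt (fun ξ => ξ ^ 2 * Ψ (ξ, c, η)) (vP α η ξ (ξ * Φ (ξ, c, η)) (ξ ^ 2 * Ψ (ξ, c, η))) ξ := by
      intro ξ hξ
      have hξa : |ξ| < δ := by rw [abs_of_pos hξ.1]; exact hξ.2
      have hξ0 := hξ.1.ne'
      have hy := one_sub_mul_sq_pos hη hξa hδ3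
      obtain ⟨d1, d2⟩ := hode ξ (hξa.trans_le hδε) hξ0
      have m1 := mul_ce₁ (f := Φ (ξ, c, η)) (n := Ψ (ξ, c, η)) h0 h1 hy
      have m2 := mul_ce₂ (f := Φ (ξ, c, η)) (n := Ψ (ξ, c, η)) h0 h1 hξ0 hy
      rw [vF_centre hξ0, vP_centre hξ0 (hcR _ _ _ hξa).ne']
      have hE1 : e₁ (ξ, X (ξ, 0, c, η), Y (ξ, 0, c, η), η) = ce₁ α ξ (Φ (ξ, c, η)) (Ψ (ξ, c, η)) η := rfl
      have hE2 : e₂ (ξ, X (ξ, 0, c, η), Y (ξ, 0, c, η), η) = ce₂ α ξ (Φ (ξ, c, η)) (Ψ (ξ, c, η)) η := rfl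
      rw [hE1, hE2] at d1 d2
      constructor
      · have := (hasDerivAt_id' ξ).mul (d2.add (d1.div_const 3))
        refine this.congr_deriv ?_
        simp only [Pi.add_apply]
        have e : Ψ (ξ, c, η) / cR α ξ (Φ (ξ, c, η)) (Ψ (ξ, c, η)) η =
            ξ * ce₁ α ξ (Φ (ξ, c, η)) (Ψ (ξ, c, η)) η + Ψ (ξ, c, η) := by linarith
        rw [e]
        simp only [hΦ, hΨ]
        push_cast
        field_simp
        ring
      · have := (hasDerivAt_pow 2 ξ).mul (d2.sub ((d1.const_mul 2).div_const 3))
        refine this.congr_deriv ?_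
        simp only [Pi.sub_apply]
        have e : sin (2 * (ξ * Φ (ξ, c, η))) * cB α ξ (Φ (ξ, c, η)) (Ψ (ξ, c, η)) η / (1 - η * ξ ^ 2) =
            ξ * (ξ * ce₂ α ξ (Φ (ξ, c, η)) (Ψ (ξ, c, η)) η + 2 * Φ (ξ, c, η)) := by
          rw [m2]
          field_simp
          ring
        rw [e]
        simp only [hΦ, hΨ]
        push_cast
        field_simp
        ring
    have hlim : ∀ g : ℝ → ℝ, ContinuousAt g 0 → Tendsto g (𝓝[>] 0) (𝓝 (g 0)) := fun g hg =>
      hg.tendsto.mono_left nhdsWithin_le_nhds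
    refine ⟨fun ξ hξ => (key ξ hξ).1, fun ξ hξ => (key ξ hξ).2, ?_, ?_⟩
    · have h3 := hlim (fun ξ => Φ (ξ, c, η)) (hcont0.2.add (hcont0.1.div_const 3))
      simp only [hΦ, hXi, hYi] at h3
      rw [zero_div, add_zero] at h3
      refine h3.congr' ?_
      filter_upwards [self_mem_nhdsWithin] with ξ hξ
      have : ξ ≠ 0 := ne_of_gt hξ
      simp only [hΦ]
      field_simp
    · have h3 := hlim (fun ξ => Ψ (ξ, c, η)) (hcont0.2.sub ((hcont0.1.const_mul 2).div_const 3))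
      simp only [hΨ, hXi, hYi] at h3
      rw [mul_zero, zero_div, sub_zero] at h3
      refine h3.congr' ?_
      filter_upwards [self_mem_nhdsWithin] with ξ hξ
      have : ξ ≠ 0 := ne_of_gt hξ
      simp only [hΨ]
      field_simp
  · intro b F P hb hS
    set u : ℝ → ℝ := fun ξ => if ξ = 0 then 0 else F ξ / ξ - P ξ / ξ ^ 2 with hu
    set v : ℝ → ℝ := fun ξ => if ξ = 0 then c else (2 * (F ξ / ξ) + P ξ / ξ ^ 2) / 3 with hv
    have hu1 : ∀ ξ, ξ ≠ 0 → u ξ = F ξ / ξ - P ξ / ξ ^ 2 := fun ξ h => by simp [hu, h]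
    have hv1 : ∀ ξ, ξ ≠ 0 → v ξ = (2 * (F ξ / ξ) + P ξ / ξ ^ 2) / 3 := fun ξ h => by simp [hv, h]
    have hu0 : u 0 = 0 := by simp [hu]
    have hv0 : v 0 = c := by simp [hv]
    have hut : Tendsto u (𝓝[>] 0) (𝓝 0) := by
      have := hS.f0.sub hS.n0
      rw [sub_self] at this
      refine this.congr' ?_
      filter_upwards [self_mem_nhdsWithin] with ξ hξ
      rw [hu1 ξ (ne_of_gt hξ)]
    have hvt : Tendsto v (𝓝[>] 0) (𝓝 c) := by
      have := ((hS.f0.const_mul 2).add hS.n0).div_const 3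
      rw [show (2 * c + c) / 3 = c by ring] at this
      refine this.congr' ?_
      filter_upwards [self_mem_nhdsWithin] with ξ hξ
      rw [hv1 ξ (ne_of_gt hξ)]
    have hder : ∀ ξ ∈ Ioo 0 (min b δ), (HasDerivAt u ((-3 * u ξ) / ξ + (e₁ (ξ, u ξ, v ξ, η) - e₂ (ξ, u ξ, v ξ, η))) ξ ∧
        HasDerivAt v ((2 * e₁ (ξ, u ξ, v ξ, η) + e₂ (ξ, u ξ, v ξ, η)) / 3) ξ) := by
      intro ξ hξ
      have hξ0 : ξ ≠ 0 := hξ.1.ne'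
      have hξb : ξ ∈ Ioo 0 b := ⟨hξ.1, hξ.2.trans_le (min_le_left _ _)⟩
      have hξa : |ξ| < δ := by rw [abs_of_pos hξ.1]; exact hξ.2.trans_le (min_le_right _ _)
      have hy := one_sub_mul_sq_pos hη hξa hδ3
      set f := F ξ / ξ with hf
      set n := P ξ / ξ ^ 2 with hn
      have hFf : F ξ = ξ * f := by rw [hf]; field_simp
      have hPn : P ξ = ξ ^ 2 * n := by rw [hn]; field_simp
      have dF := hS.hF ξ hξb
      have dP := hS.hP ξ hξb
      rw [hFf, hPn, vF_centre hξ0] at dF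
      rw [hFf, hPn, vP_centre hξ0 (hcR _ _ _ hξa).ne'] at dP
      have m1 := mul_ce₁ (f := f) (n := n) h0 h1 hy
      have m2 := mul_ce₂ (f := f) (n := n) h0 h1 hξ0 hy
      have e : sin (2 * (ξ * f)) * cB α ξ f n η / (1 - η * ξ ^ 2) =
            ξ * (ξ * ce₂ α ξ f n η + 2 * f) := by
        rw [m2]
        field_simp
        ring
      have e' : n / cR α ξ f n η = ξ * ce₁ α ξ f n η + n := by linarith
      rw [e'] at dF
      rw [e] at dP
      have hE : u ξ = f - n ∧ v ξ = (2 * f + n) / 3 := ⟨hu1 ξ hξ0, hv1 ξ hξ0⟩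
      have hE1 : e₁ (ξ, u ξ, v ξ, η) = ce₁ α ξ f n η := by
        simp only [he₁, hE.1, hE.2]; congr 1 <;> ring
      have hE2 : e₂ (ξ, u ξ, v ξ, η) = ce₂ α ξ f n η := by
        simp only [he₂, hE.1, hE.2]; congr 1 <;> ring
      rw [hE1, hE2]
      have df := dF.div (hasDerivAt_id' ξ) hξ0
      have dn := dP.div (hasDerivAt_pow 2 ξ) (pow_ne_zero 2 hξ0)
      have hnear : ∀ᶠ s in 𝓝 ξ, s ≠ 0 := isOpen_ne.mem_nhds hξ0
      constructor
      · refine ((df.sub dn).congr_of_eventuallyEq (f₁ := u) ?_).congr_deriv ?_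
        · filter_upwards [hnear] with s hs
          rw [hu1 s hs]; rfl
        · rw [hE.1, hFf, hPn]
          push_cast
          field_simp
          ring
      · refine ((((df.const_mul 2).add dn).div_const 3).congr_of_eventuallyEq (f₁ := v) ?_).congr_deriv ?_
        · filter_upwards [hnear] with s hs
          rw [hv1 s hs]; rfl
        · rw [hFf, hPn]
          push_cast
          field_simp
          ring
    -- a small interval on which `u`, `v` stay in the box
    have hboxev : ∀ᶠ s in 𝓝[>] (0:ℝ), |u s - 0| < ε ∧ |v s - c₀| < ε := by
      have hc' : |c - c₀| < ε := hc.trans_le hδε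
      have k1 : Tendsto (fun s => |u s - 0|) (𝓝[>] 0) (𝓝 |0 - 0|) := (hut.sub_const 0).abs
      have k2 : Tendsto (fun s => |v s - c₀|) (𝓝[>] 0) (𝓝 |c - c₀|) := (hvt.sub_const c₀).abs
      rw [sub_self, abs_zero] at k1
      exact (k1.eventually (gt_mem_nhds hε)).and (k2.eventually (gt_mem_nhds hc'))
    obtain ⟨r, hr, hrbox⟩ := (mem_nhdsGT_iff_exists_Ioo_subset).1 hboxev
    have hr0 : (0:ℝ) < r := hr
    have hmem : Ioo 0 (min r (min b δ)) ∈ 𝓝[>] (0:ℝ) :=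
      Ioo_mem_nhdsGT (lt_min hr0 (lt_min hb hδ0))
    filter_upwards [hmem] with t ht
    have ht0 : 0 < t := ht.1
    have htr : t < r := ht.2.trans_le (min_le_left _ _)
    have htm : t < min b δ := ht.2.trans_le (min_le_right _ _)
    have hcon : ∀ g : ℝ → ℝ, Tendsto g (𝓝[>] 0) (𝓝 (g 0)) → (∀ ξ ∈ Ioo 0 (min b δ), ContinuousAt g ξ) →
        ContinuousOn g (uIcc 0 t) := by
      intro g hg hg2
      rw [uIcc_of_le ht0.le]
      intro s hs
      rcases hs.1.eq_or_lt with h | h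
      · rw [← h]
        have hh : ContinuousWithinAt g (Ioi 0) 0 := hg
        exact (continuousWithinAt_Ioi_iff_Ici.1 hh).mono Icc_subset_Ici_self
      · exact (hg2 s ⟨h, hs.2.trans_lt htm⟩).continuousWithinAt
    obtain ⟨r1, r2⟩ := huniq u v t (by
        rw [abs_of_pos ht0]; exact (htm.trans_le (min_le_right _ _)).trans_le hδε)
      (hcon u (by rw [hu0]; exact hut) fun ξ hξ => (hder ξ hξ).1.continuousAt)
      (hcon v (by rw [hv0]; exact hvt) fun ξ hξ => (hder ξ hξ).2.continuousAt) hu0 hv0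
      (by
        intro s hs
        rw [uIcc_of_le ht0.le] at hs
        rcases hs.1.eq_or_lt with h | h
        · rw [← h, hu0, hv0]
          exact ⟨by simpa using hε, hc.trans_le hδε⟩
        · exact hrbox ⟨h, hs.2.trans_lt htr⟩)
      (by
        intro s hs hs0 hst
        rw [uIcc_of_le ht0.le] at hs
        have hs' : s ∈ Ioo 0 (min b δ) := ⟨lt_of_le_of_ne hs.1 hs0.symm, hs.2.trans_lt htm⟩
        obtain ⟨d1, d2⟩ := hder s hs'
        refine ⟨⟨_, d1, ?_⟩, d2⟩
        push_cast
        field_simp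
        ring)
    rw [hu1 t ht0.ne'] at r1
    rw [hv1 t ht0.ne'] at r2
    have ht0' := ht0.ne'
    have s1 : F t / t = Φ (t, c, η) := by simp only [hΦ]; linarith
    have s2 : P t / t ^ 2 = Ψ (t, c, η) := by simp only [hΨ]; linarith
    rw [← s1, ← s2]
    constructor <;> field_simp

end LocalCentre

theorem analyticAt_vF_vP {α : ℝ} (h0 : 0 ≤ α) (h1 : α < 1 / 2) {z : ℝ × ℝ × ℝ × ℝ}
    (hz : z.1 ≠ 0) (hy : 0 < 1 - z.2.2.2 * z.1 ^ 2) :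
    AnalyticAt ℝ (fun z : ℝ × ℝ × ℝ × ℝ => vF α z.2.2.2 z.1 z.2.1 z.2.2.1) z ∧
    AnalyticAt ℝ (fun z : ℝ × ℝ × ℝ × ℝ => vP α z.2.2.2 z.1 z.2.1 z.2.2.1) z := by
  have hq : AnalyticAt ℝ (fun z : ℝ × ℝ × ℝ × ℝ => z.2.2.1 / z.1) z := by
    refine AnalyticAt.div (by fun_prop) (by fun_prop) hz
  have hR : AnalyticAt ℝ (fun z : ℝ × ℝ × ℝ × ℝ =>
      Rf α (1 - z.2.2.2 * z.1 ^ 2) z.2.1 (z.2.2.1 / z.1)) z :=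
    AnalyticAt.comp_of_eq (g := fun z : ℝ × ℝ × ℝ => Rf α z.1 z.2.1 z.2.2)
      (f := fun z : ℝ × ℝ × ℝ × ℝ => (1 - z.2.2.2 * z.1 ^ 2, z.2.1, z.2.2.1 / z.1))
      (analyticAt_Rf (radicand_pos h0 h1 hy.le).ne') (by fun_prop) rfl
  have hR0 := Rf_pos (F := z.2.1) (N := z.2.2.1 / z.1) h0 h1 hy.le
  have hs : AnalyticAt ℝ (fun z : ℝ × ℝ × ℝ × ℝ => sin (z.2.1)) z :=
    Real.analyticAt_sin.comp_of_eq (f := fun z : ℝ × ℝ × ℝ × ℝ => z.2.1) (by fun_prop) rfl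
  have hs2 : AnalyticAt ℝ (fun z : ℝ × ℝ × ℝ × ℝ => sin (2 * z.2.1)) z :=
    Real.analyticAt_sin.comp_of_eq (f := fun z : ℝ × ℝ × ℝ × ℝ => 2 * z.2.1) (by fun_prop) rfl
  constructor
  · unfold vF
    exact AnalyticAt.div (by fun_prop) (by fun_prop) (by positivity)
  · unfold vP Af qf
    exact AnalyticAt.div (by fun_prop) (by fun_prop) (by positivity)

/-- The vector field with the parameter as an additional state variable. -/
def vField (α ξ : ℝ) (w : ℝ × ℝ × ℝ) : ℝ × ℝ × ℝ :=
  (vF α w.2.2 ξ w.1 w.2.1, vP α w.2.2 ξ w.1 w.2.1, 0)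

theorem exists_lipschitz_of_contDiffAt {E G : Type*} [NormedAddCommGroup E] [NormedSpace ℝ E]
    [NormedAddCommGroup G] [NormedSpace ℝ G] {f : E → G} {s : Set E} (hs : IsCompact s)
    (hf : ∀ x ∈ s, ContDiffAt ℝ 1 f x) : ∃ K, LipschitzOnWith K f s := by
  refine LocallyLipschitzOn.exists_lipschitzOnWith_of_compact hs ?_
  intro x hx
  obtain ⟨K, t, ht, hK⟩ := (hf x hx).exists_lipschitzOnWith
  exact ⟨K, t, mem_nhdsWithin_of_mem_nhds ht, hK⟩

theorem exists_lipschitz_vField {α : ℝ} (h0 : 0 ≤ α) (h1 : α < 1 / 2) {a b η₁ : ℝ} (ha : 0 < a)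
    (hη : η₁ * b ^ 2 < 1) (s : Set (ℝ × ℝ)) (hs : IsCompact s) :
    ∃ K, ∀ ξ ∈ Icc a b, LipschitzOnWith K (vField α ξ) {w | (w.1, w.2.1) ∈ s ∧ w.2.2 ∈ Icc 0 η₁} := by
  set S : Set (ℝ × ℝ × ℝ × ℝ) := (fun p : (ℝ × ℝ) × (ℝ × ℝ) => (p.1.1, p.2.1, p.2.2, p.1.2)) ''
    ((Icc a b ×ˢ Icc 0 η₁) ×ˢ s) with hSdef
  have hS : IsCompact S := ((isCompact_Icc.prod isCompact_Icc).prod hs).image (by fun_prop)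
  have hC : ∀ z ∈ S, ContDiffAt ℝ 1 (fun z : ℝ × ℝ × ℝ × ℝ => vField α z.1 z.2) z := by
    rintro z ⟨⟨⟨ξ, η⟩, x, y⟩, ⟨⟨h1', h2'⟩, -⟩, rfl⟩
    have hξ : 0 < ξ := ha.trans_le h1'.1
    have hy : 0 < 1 - η * ξ ^ 2 := by
      have : η * ξ ^ 2 ≤ η₁ * b ^ 2 := by
        have := h2'.1; have := h2'.2; have := h1'.2
        have : 0 ≤ η₁ := h2'.1.trans h2'.2
        dsimp only at *
        gcongr
      linarith
    obtain ⟨A1, A2⟩ := analyticAt_vF_vP h0 h1 (z := (ξ, x, y, η)) hξ.ne' hy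
    exact (A1.contDiffAt).prodMk ((A2.contDiffAt).prodMk contDiffAt_const)
  obtain ⟨K, hK⟩ := exists_lipschitz_of_contDiffAt hS hC
  refine ⟨K, fun ξ hξ => LipschitzOnWith.of_dist_le_mul fun w hw w' hw' => ?_⟩
  have := hK.dist_le_mul (ξ, w) ⟨((ξ, w.2.2), (w.1, w.2.1)), ⟨⟨hξ, hw.2⟩, hw.1⟩, rfl⟩
    (ξ, w') ⟨((ξ, w'.2.2), (w'.1, w'.2.1)), ⟨⟨hξ, hw'.2⟩, hw'.1⟩, rfl⟩
  refine this.trans (le_of_eq ?_)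
  rw [Prod.dist_eq]
  simp

/-- Continuous dependence on data and parameter, with a priori bounds. -/
theorem exists_gronwall {α : ℝ} (h0 : 0 ≤ α) (h1 : α < 1 / 2) {a b η₁ M : ℝ} (ha : 0 < a)
    (hη : η₁ * b ^ 2 < 1) : ∃ C > 0, ∀ η ∈ Icc 0 η₁, ∀ η' ∈ Icc 0 η₁, ∀ F P F' P' : ℝ → ℝ,
    (∀ ξ ∈ Icc a b, HasDerivAt F (vF α η ξ (F ξ) (P ξ)) ξ ∧ HasDerivAt P (vP α η ξ (F ξ) (P ξ)) ξ) →
    (∀ ξ ∈ Icc a b, HasDerivAt F' (vF α η' ξ (F' ξ) (P' ξ)) ξ ∧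
      HasDerivAt P' (vP α η' ξ (F' ξ) (P' ξ)) ξ) →
    (∀ ξ ∈ Icc a b, |F ξ| ≤ M ∧ |P ξ| ≤ M) → (∀ ξ ∈ Icc a b, |F' ξ| ≤ M ∧ |P' ξ| ≤ M) →
    ∀ ξ ∈ Icc a b, |F ξ - F' ξ| ≤ max |F a - F' a| (max |P a - P' a| |η - η'|) * C ∧
      |P ξ - P' ξ| ≤ max |F a - F' a| (max |P a - P' a| |η - η'|) * C := by
  obtain ⟨K, hK⟩ := exists_lipschitz_vField h0 h1 ha hη (Icc (-M) M ×ˢ Icc (-M) M)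
    (isCompact_Icc.prod isCompact_Icc)
  refine ⟨rexp (K * (b - a)), exp_pos _, ?_⟩
  intro η hηm η' hηm' F P F' P' hd hd' hM hM' ξ hξ
  have key := dist_le_of_trajectories_ODE_of_mem (v := vField α) (K := K)
    (s := fun _ => {w | (w.1, w.2.1) ∈ Icc (-M) M ×ˢ Icc (-M) M ∧ w.2.2 ∈ Icc 0 η₁})
    (f := fun ξ => (F ξ, P ξ, η)) (g := fun ξ => (F' ξ, P' ξ, η')) (a := a) (b := b)
    (δ := dist (F a, P a, η) (F' a, P' a, η'))
    (fun t ht => hK t (Ico_subset_Icc_self ht))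
    (fun t ht => ((hd t ht).1.continuousAt.prodMk ((hd t ht).2.continuousAt.prodMk
      continuousAt_const)).continuousWithinAt)
    (fun t ht => ((hd t (Ico_subset_Icc_self ht)).1.prodMk
      ((hd t (Ico_subset_Icc_self ht)).2.prodMk (hasDerivAt_const _ _))).hasDerivWithinAt)
    (fun t ht => ⟨⟨abs_le.1 (hM t (Ico_subset_Icc_self ht)).1, abs_le.1 (hM t (Ico_subset_Icc_self ht)).2⟩, hηm⟩)
    (fun t ht => ((hd' t ht).1.continuousAt.prodMk ((hd' t ht).2.continuousAt.prodMk
      continuousAt_const)).continuousWithinAt)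
    (fun t ht => ((hd' t (Ico_subset_Icc_self ht)).1.prodMk
      ((hd' t (Ico_subset_Icc_self ht)).2.prodMk (hasDerivAt_const _ _))).hasDerivWithinAt)
    (fun t ht => ⟨⟨abs_le.1 (hM' t (Ico_subset_Icc_self ht)).1, abs_le.1 (hM' t (Ico_subset_Icc_self ht)).2⟩, hηm'⟩)
    le_rfl ξ hξ
  simp only [Prod.dist_eq, Real.dist_eq] at key
  have h2 : max |F a - F' a| (max |P a - P' a| |η - η'|) * rexp (K * (ξ - a)) ≤
      max |F a - F' a| (max |P a - P' a| |η - η'|) * rexp (K * (b - a)) := by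
    have := hξ.2
    gcongr
  exact ⟨(le_max_left _ _).trans (key.trans h2),
    ((le_max_left _ _).trans (le_max_right _ _)).trans (key.trans h2)⟩

theorem abs_vP_le {α η ξ F P y₀ : ℝ} (h0 : 0 ≤ α) (h1 : α < 1 / 2) (hy₀ : 0 < y₀)
    (hy : y₀ ≤ 1 - η * ξ ^ 2) : |vP α η ξ F P| ≤ 1 / y₀ := by
  have hy' : 0 < 1 - η * ξ ^ 2 := hy₀.trans_le hy
  have hR := Rf_pos (F := F) (N := P / ξ) h0 h1 hy'.le
  have hA := Af_pos (F := F) (N := P / ξ) h0 h1 hy'.le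
  have hAR := Af_le_Rf (F := F) (N := P / ξ) h0 hy'.le
  unfold vP
  rw [abs_div, abs_mul, abs_of_pos hA, abs_of_pos (mul_pos hR hy'), div_le_div_iff₀ (by positivity) hy₀]
  calc _ ≤ 1 * Rf α (1 - η * ξ ^ 2) F (P / ξ) * (1 - η * ξ ^ 2) := by
        gcongr
        exact abs_sin_le_one _
    _ = _ := by ring

theorem abs_vF_le {α η ξ F P a : ℝ} (h0 : 0 ≤ α) (h1 : α < 1 / 2) (ha : 0 < a) (haξ : a ≤ ξ)
    (hy : 0 ≤ 1 - η * ξ ^ 2) : |vF α η ξ F P| ≤ |P| / (a ^ 2 * (1 - 2 * α)) := by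
  have hR := Rf_ge (F := F) (N := P / ξ) h0 hy
  unfold vF
  have h2 : 0 < 1 - 2 * α := by linarith
  have hξ : 0 < ξ := ha.trans_le haξ
  have hR0 := Rf_pos (F := F) (N := P / ξ) h0 h1 hy
  rw [abs_div, abs_of_pos (mul_pos (pow_pos hξ 2) hR0)]
  gcongr

theorem abs_le_of_deriv_bound {f f' : ℝ → ℝ} {a b C : ℝ} (hf : ∀ x ∈ Icc a b, HasDerivAt f (f' x) x)
    (hC : ∀ x ∈ Icc a b, |f' x| ≤ C) {x : ℝ} (hx : x ∈ Icc a b) : |f x| ≤ |f a| + C * (b - a) := by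
  have hab : a ≤ b := hx.1.trans hx.2
  have hC0 : 0 ≤ C := (abs_nonneg _).trans (hC a ⟨le_rfl, hab⟩)
  have := Convex.norm_image_sub_le_of_norm_hasDerivWithin_le (f := f) (f' := f') (s := Icc a b) (C := C)
    (fun x hx => (hf x hx).hasDerivWithinAt) hC (convex_Icc a b) ⟨le_rfl, hab⟩ hx
  rw [Real.norm_eq_abs, Real.norm_eq_abs, abs_of_nonneg (sub_nonneg.2 hx.1)] at this
  have h2 : C * (x - a) ≤ C * (b - a) := by have := hx.2; gcongr
  have h3 := abs_sub_abs_le_abs_sub (f x) (f a)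
  linarith

theorem exists_apriori {α : ℝ} (h0 : 0 ≤ α) (h1 : α < 1 / 2) {a b η₁ : ℝ} (ha : 0 < a)
    (hη : η₁ * b ^ 2 < 1) (m : ℝ) : ∃ M, ∀ η ∈ Icc 0 η₁, ∀ F P : ℝ → ℝ,
    (∀ ξ ∈ Icc a b, HasDerivAt F (vF α η ξ (F ξ) (P ξ)) ξ ∧ HasDerivAt P (vP α η ξ (F ξ) (P ξ)) ξ) →
    |F a| ≤ m → |P a| ≤ m → ∀ ξ ∈ Icc a b, |F ξ| ≤ M ∧ |P ξ| ≤ M := by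
  set y₀ := 1 - η₁ * b ^ 2
  have hy₀ : 0 < y₀ := sub_pos.2 hη
  set M₁ := m + 1 / y₀ * (b - a) with hM₁
  set M₂ := m + M₁ / (a ^ 2 * (1 - 2 * α)) * (b - a) with hM₂
  have h2 : 0 < 1 - 2 * α := by linarith
  refine ⟨max M₁ M₂, fun η hη' F P hd hF hP => ?_⟩
  have hy : ∀ ξ ∈ Icc a b, y₀ ≤ 1 - η * ξ ^ 2 := by
    intro ξ hξ
    have : η * ξ ^ 2 ≤ η₁ * b ^ 2 := by
      have := hη'.1; have := hη'.2; have := hξ.2; have := ha.trans_le hξ.1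
      have : 0 ≤ η₁ := hη'.1.trans hη'.2
      gcongr
    simp only [y₀]; linarith
  have hPb : ∀ ξ ∈ Icc a b, |P ξ| ≤ M₁ := by
    intro ξ hξ
    have := abs_le_of_deriv_bound (fun x hx => (hd x hx).2)
      (fun x hx => abs_vP_le h0 h1 hy₀ (hy x hx)) hξ
    linarith
  intro ξ hξ
  refine ⟨le_max_of_le_right ?_, le_max_of_le_left (hPb ξ hξ)⟩
  have := abs_le_of_deriv_bound (C := M₁ / (a ^ 2 * (1 - 2 * α))) (fun x hx => (hd x hx).1)
      (fun x hx => (abs_vF_le h0 h1 ha hx.1 (hy₀.le.trans (hy x hx))).trans (by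
        have := hPb x hx
        gcongr)) hξ
  linarith

section Stability

variable {α η c b : ℝ} {F P F' P' : ℝ → ℝ}

theorem mul_sq_lt_of_le {ξ ξ₀ : ℝ} (hη : 0 ≤ η) (hξ : 0 < ξ) (h : ξ ≤ ξ₀) (h2 : η * ξ₀ ^ 2 < 1) :
    η * ξ ^ 2 < 1 := by
  refine lt_of_le_of_lt ?_ h2
  gcongr

theorem IsSol.mono {b' : ℝ} (h : IsSol α η c b F P) (hb : b' ≤ b) : IsSol α η c b' F P :=
  ⟨fun ξ hξ => h.hF ξ ⟨hξ.1, hξ.2.trans_le hb⟩, fun ξ hξ => h.hP ξ ⟨hξ.1, hξ.2.trans_le hb⟩, h.f0, h.n0⟩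

theorem IsSol.eq (h0 : 0 ≤ α) (h1 : α < 1 / 2) {b' : ℝ} (h : IsSol α η c b F P)
    (h' : IsSol α η c b' F' P') (hη : 0 ≤ η) {ξ : ℝ} (hξ : 0 < ξ) (hb : ξ < b) (hb' : ξ < b')
    (hy : η * ξ ^ 2 < 1) : F ξ = F' ξ ∧ P ξ = P' ξ := by
  obtain ⟨Φ, Ψ, -, -, -, -, δ, hδ, -, H⟩ := exists_local_sol h0 h1 c η
  have E := (H c η (by simpa using hδ) (by simpa using hδ)).2
  have hlt : ∀ᶠ s in 𝓝[>] (0:ℝ), s < ξ := by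
    filter_upwards [Ioo_mem_nhdsGT hξ] with s hs using hs.2
  obtain ⟨a, ⟨⟨⟨ea, ea'⟩, haξ⟩, ha⟩⟩ := ((((E b F P (hξ.trans hb) h).and
    (E b' F' P' (hξ.trans hb') h')).and hlt).and self_mem_nhdsWithin).exists
  have ha0 : 0 < a := ha
  obtain ⟨M, hM⟩ := exists_apriori h0 h1 ha0 hy (max |F a| |P a|)
  obtain ⟨C, hC, G⟩ := exists_gronwall h0 h1 (M := M) ha0 hy
  have d : ∀ x ∈ Icc a ξ, HasDerivAt F (vF α η x (F x) (P x)) x ∧ HasDerivAt P (vP α η x (F x) (P x)) x :=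
    fun x hx => ⟨h.hF x ⟨ha0.trans_le hx.1, hx.2.trans_lt hb⟩, h.hP x ⟨ha0.trans_le hx.1, hx.2.trans_lt hb⟩⟩
  have d' : ∀ x ∈ Icc a ξ, HasDerivAt F' (vF α η x (F' x) (P' x)) x ∧
      HasDerivAt P' (vP α η x (F' x) (P' x)) x :=
    fun x hx => ⟨h'.hF x ⟨ha0.trans_le hx.1, hx.2.trans_lt hb'⟩,
      h'.hP x ⟨ha0.trans_le hx.1, hx.2.trans_lt hb'⟩⟩
  have eF : F a = F' a := by rw [ea.1, ea'.1]
  have eP : P a = P' a := by rw [ea.2, ea'.2]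
  have := G η ⟨hη, le_rfl⟩ η ⟨hη, le_rfl⟩ F P F' P' d d'
    (hM η ⟨hη, le_rfl⟩ F P d (le_max_left _ _) (le_max_right _ _))
    (hM η ⟨hη, le_rfl⟩ F' P' d' (by rw [← eF]; exact le_max_left _ _)
      (by rw [← eP]; exact le_max_right _ _)) ξ ⟨haξ.le, le_rfl⟩
  simp only [eF, eP, sub_self, abs_zero, max_self, zero_mul] at this
  exact ⟨sub_eq_zero.1 (abs_nonpos_iff.1 this.1), sub_eq_zero.1 (abs_nonpos_iff.1 this.2)⟩

/-- Analytic representation near the centre of all solutions with data close to given ones. -/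
theorem exists_local_rep (h0 : 0 ≤ α) (h1 : α < 1 / 2) (c₀ η₀ : ℝ) : ∃ Φ Ψ : ℝ × ℝ × ℝ → ℝ,
    AnalyticAt ℝ Φ (0, c₀, η₀) ∧ AnalyticAt ℝ Ψ (0, c₀, η₀) ∧ Φ (0, c₀, η₀) = c₀ ∧ Ψ (0, c₀, η₀) = c₀ ∧
    ∃ δ > 0, ∀ c η, |c - c₀| < δ → |η - η₀| < δ → 0 ≤ η →
      IsSol α η c δ (fun ξ => ξ * Φ (ξ, c, η)) (fun ξ => ξ ^ 2 * Ψ (ξ, c, η)) ∧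
      η * δ ^ 2 ≤ 1 ∧
      ∀ b F P, IsSol α η c b F P → ∀ ξ, 0 < ξ → ξ < b → ξ < δ →
        F ξ = ξ * Φ (ξ, c, η) ∧ P ξ = ξ ^ 2 * Ψ (ξ, c, η) := by
  obtain ⟨Φ, Ψ, hΦ, hΨ, hΦ0, hΨ0, δ, hδ, hδ3, H⟩ := exists_local_sol h0 h1 c₀ η₀
  refine ⟨Φ, Ψ, hΦ, hΨ, hΦ0, hΨ0, δ, hδ, fun c η hc hη hη0 => ⟨(H c η hc hη).1, ?_, ?_⟩⟩
  · have h2 : 0 < |η₀| + 2 := by positivity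
    have h3 : δ ≤ 1 := hδ3.trans (by rw [div_le_one h2]; linarith [abs_nonneg η₀])
    have h4 : δ * (|η₀| + 2) ≤ 1 := by rwa [le_div_iff₀ h2] at hδ3
    have h5 : η ≤ |η₀| + 1 := by
      have := (abs_lt.1 hη).2
      linarith [le_abs_self η₀]
    nlinarith
  · intro b F P hS ξ hξ hb hξδ
    refine hS.eq h0 h1 (H c η hc hη).1 hη0 hξ hb hξδ ?_
    have := one_sub_mul_sq_pos hη (by rwa [abs_of_pos hξ]) hδ3
    linarith

set_option maxHeartbeats 400000 in
/-- Continuous dependence of solutions on the parameters, uniformly up to the centre. -/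
theorem IsSol.stable (h0 : 0 ≤ α) (h1 : α < 1 / 2) {c₀ η₀ b₀ ξ₀ : ℝ} {F₀ P₀ : ℝ → ℝ}
    (h : IsSol α η₀ c₀ b₀ F₀ P₀) (hη₀ : 0 ≤ η₀) (hξ₀ : 0 < ξ₀) (hb₀ : ξ₀ < b₀) (hy : η₀ * ξ₀ ^ 2 < 1)
    {ε : ℝ} (hε : 0 < ε) : ∃ δ > 0, ∀ c η b F P, |c - c₀| < δ → |η - η₀| < δ → 0 ≤ η → ξ₀ < b →
      IsSol α η c b F P → ∀ ξ ∈ Ioc 0 ξ₀, |F ξ - F₀ ξ| < ε ∧ |P ξ - P₀ ξ| < ε := by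
  obtain ⟨Φ, Ψ, hΦ, hΨ, hΦ0, hΨ0, δ₁, hδ₁, H⟩ := exists_local_rep h0 h1 c₀ η₀
  have ev : ∀ᶠ z in 𝓝 ((0:ℝ), c₀, η₀), (ContinuousAt Φ z ∧ ContinuousAt Ψ z) ∧ |Φ z - c₀| < 1 ∧ |Ψ z - c₀| < 1 := by
    refine ((hΦ.eventually_analyticAt.mono fun z hz => hz.continuousAt).and
      (hΨ.eventually_analyticAt.mono fun z hz => hz.continuousAt)).and (Eventually.and ?_ ?_)
    · have : Tendsto (fun z => |Φ z - c₀|) (𝓝 (0, c₀, η₀)) (𝓝 |Φ (0, c₀, η₀) - c₀|) :=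
        (hΦ.continuousAt.sub continuousAt_const).abs
      rw [hΦ0, sub_self, abs_zero] at this
      exact this.eventually (gt_mem_nhds one_pos)
    · have : Tendsto (fun z => |Ψ z - c₀|) (𝓝 (0, c₀, η₀)) (𝓝 |Ψ (0, c₀, η₀) - c₀|) :=
        (hΨ.continuousAt.sub continuousAt_const).abs
      rw [hΨ0, sub_self, abs_zero] at this
      exact this.eventually (gt_mem_nhds one_pos)
  obtain ⟨δ₂, hδ₂, ev⟩ := Metric.eventually_nhds_iff.1 ev
  replace ev : ∀ ξ c η, |ξ| < δ₂ → |c - c₀| < δ₂ → |η - η₀| < δ₂ →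
      (ContinuousAt Φ (ξ, c, η) ∧ ContinuousAt Ψ (ξ, c, η)) ∧ |Φ (ξ, c, η) - c₀| < 1 ∧ |Ψ (ξ, c, η) - c₀| < 1 := by
    intro ξ c η e1 e2 e3
    apply ev
    simp only [Prod.dist_eq, Real.dist_eq, sub_zero, max_lt_iff]
    exact ⟨e1, e2, e3⟩
  obtain ⟨a, ha0, ha1⟩ := exists_between (show 0 < min (min δ₁ δ₂) (min (min ξ₀ 1) (ε / 4)) by positivity)
  simp only [lt_min_iff] at ha1
  obtain ⟨⟨haδ₁, haδ₂⟩, ⟨haξ, ha1⟩, haε⟩ := ha1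
  set η₁ := η₀ + (1 - η₀ * ξ₀ ^ 2) / (2 * ξ₀ ^ 2) with hη₁
  have hη₁0 : 0 < η₁ - η₀ := by
    rw [hη₁]; have : 0 < 1 - η₀ * ξ₀ ^ 2 := by linarith
    simp only [add_sub_cancel_left]; positivity
  have hη₁y : η₁ * ξ₀ ^ 2 < 1 := by
    have : η₁ * ξ₀ ^ 2 = (1 + η₀ * ξ₀ ^ 2) / 2 := by rw [hη₁]; field_simp; ring
    linarith
  obtain ⟨M, hM⟩ := exists_apriori h0 h1 ha0 hη₁y (|F₀ a| + |P₀ a| + 1)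
  obtain ⟨C, hC, G⟩ := exists_gronwall h0 h1 (M := M) ha0 hη₁y
  have e₀ := (H c₀ η₀ (by simpa using hδ₁) (by simpa using hδ₁) hη₀).2.2 b₀ F₀ P₀ h
  set κ := min 1 (ε / (2 * C)) with hκ
  have hκ0 : 0 < κ := by positivity
  have evd : ∀ᶠ p in 𝓝 (c₀, η₀), |a * Φ (a, p.1, p.2) - F₀ a| < κ ∧ |a ^ 2 * Ψ (a, p.1, p.2) - P₀ a| < κ := by
    obtain ⟨⟨k1, k2⟩, -⟩ := ev a c₀ η₀ (by rwa [abs_of_pos ha0]) (by simpa using hδ₂) (by simpa using hδ₂)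
    have hm : ContinuousAt (fun p : ℝ × ℝ => (a, p.1, p.2)) (c₀, η₀) := by fun_prop
    have k1' : ContinuousAt (fun p : ℝ × ℝ => Φ (a, p.1, p.2)) (c₀, η₀) :=
      ContinuousAt.comp (f := fun p : ℝ × ℝ => (a, p.1, p.2)) (x := (c₀, η₀)) k1 hm
    have k2' : ContinuousAt (fun p : ℝ × ℝ => Ψ (a, p.1, p.2)) (c₀, η₀) :=
      ContinuousAt.comp (f := fun p : ℝ × ℝ => (a, p.1, p.2)) (x := (c₀, η₀)) k2 hm
    obtain ⟨r1, r2⟩ := e₀ a ha0 (haξ.trans hb₀) haδ₁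
    refine Eventually.and ?_ ?_
    · have : Tendsto (fun p : ℝ × ℝ => |a * Φ (a, p.1, p.2) - F₀ a|) (𝓝 (c₀, η₀)) (𝓝 |a * Φ (a, c₀, η₀) - F₀ a|) :=
        ((k1'.const_mul a).sub continuousAt_const).abs
      rw [r1, sub_self, abs_zero] at this
      rw [r1]
      exact this.eventually (gt_mem_nhds hκ0)
    · have : Tendsto (fun p : ℝ × ℝ => |a ^ 2 * Ψ (a, p.1, p.2) - P₀ a|) (𝓝 (c₀, η₀)) (𝓝 |a ^ 2 * Ψ (a, c₀, η₀) - P₀ a|) :=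
        ((k2'.const_mul (a ^ 2)).sub continuousAt_const).abs
      rw [r2, sub_self, abs_zero] at this
      rw [r2]
      exact this.eventually (gt_mem_nhds hκ0)
  obtain ⟨δ₃, hδ₃, evd⟩ := Metric.eventually_nhds_iff.1 evd
  refine ⟨min (min δ₁ δ₂) (min (min δ₃ κ) (η₁ - η₀)), by positivity, ?_⟩
  intro c η b F P hc hη hη0 hb hS
  simp only [lt_min_iff] at hc hη
  have e := (H c η hc.1.1 hη.1.1 hη0).2.2 b F P hS
  intro ξ hξ
  rcases le_or_gt ξ a with hle | hgt
  · obtain ⟨q1, q2⟩ := e ξ hξ.1 (hξ.2.trans_lt hb) (hle.trans_lt haδ₁)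
    obtain ⟨r1, r2⟩ := e₀ ξ hξ.1 (hξ.2.trans_lt hb₀) (hle.trans_lt haδ₁)
    have habs : |ξ| < δ₂ := by rw [abs_of_pos hξ.1]; exact hle.trans_lt haδ₂
    have b1 := (ev ξ c η habs hc.1.2 hη.1.2).2
    have b2 := (ev ξ c₀ η₀ habs (by simpa using hδ₂) (by simpa using hδ₂)).2
    have hξ1 : ξ ^ 2 ≤ ξ := by have := hξ.1; nlinarith
    have two : ∀ x y : ℝ, |x - c₀| < 1 → |y - c₀| < 1 → |x - y| ≤ 2 := by
      intro x y hx hy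
      have := abs_sub_le x c₀ y
      rw [abs_sub_comm c₀ y] at this
      linarith
    rw [q1, q2, r1, r2, ← mul_sub, ← mul_sub, abs_mul, abs_mul, abs_of_pos hξ.1, abs_of_pos (pow_pos hξ.1 2)]
    have t1 := two _ _ b1.1 b2.1
    have t2 := two _ _ b1.2 b2.2
    have u1 := mul_le_mul_of_nonneg_left t1 hξ.1.le
    have u2 := mul_le_mul_of_nonneg_left t2 (pow_pos hξ.1 2).le
    constructor <;> linarith
  · have hηI : η ∈ Icc 0 η₁ := ⟨hη0, by linarith [(abs_lt.1 hη.2.2).2]⟩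
    have hη₀I : η₀ ∈ Icc 0 η₁ := ⟨hη₀, by linarith⟩
    have d : ∀ x ∈ Icc a ξ₀, HasDerivAt F (vF α η x (F x) (P x)) x ∧ HasDerivAt P (vP α η x (F x) (P x)) x :=
      fun x hx => ⟨hS.hF x ⟨ha0.trans_le hx.1, hx.2.trans_lt hb⟩, hS.hP x ⟨ha0.trans_le hx.1, hx.2.trans_lt hb⟩⟩
    have d₀ : ∀ x ∈ Icc a ξ₀, HasDerivAt F₀ (vF α η₀ x (F₀ x) (P₀ x)) x ∧ HasDerivAt P₀ (vP α η₀ x (F₀ x) (P₀ x)) x :=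
      fun x hx => ⟨h.hF x ⟨ha0.trans_le hx.1, hx.2.trans_lt hb₀⟩, h.hP x ⟨ha0.trans_le hx.1, hx.2.trans_lt hb₀⟩⟩
    obtain ⟨q1, q2⟩ := e a ha0 (haξ.trans hb) haδ₁
    have hcl := @evd (c, η) (by
      simp only [Prod.dist_eq, Real.dist_eq, max_lt_iff]; exact ⟨hc.2.1.1, hη.2.1.1⟩)
    dsimp only at hcl
    rw [← q1, ← q2] at hcl
    have hκ1 : κ ≤ 1 := min_le_left _ _
    have g1 : |F a| ≤ |F₀ a| + |P₀ a| + 1 := by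
      have := abs_sub_abs_le_abs_sub (F a) (F₀ a)
      linarith [abs_nonneg (P₀ a), hcl.1]
    have g2 : |P a| ≤ |F₀ a| + |P₀ a| + 1 := by
      have := abs_sub_abs_le_abs_sub (P a) (P₀ a)
      linarith [abs_nonneg (F₀ a), hcl.2]
    have := G η hηI η₀ hη₀I F P F₀ P₀ d d₀ (hM η hηI F P d g1 g2)
      (hM η₀ hη₀I F₀ P₀ d₀ (by linarith [abs_nonneg (P₀ a)]) (by linarith [abs_nonneg (F₀ a)])) ξ ⟨hgt.le, hξ.2⟩
    have hmax : max |F a - F₀ a| (max |P a - P₀ a| |η - η₀|) * C < ε := by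
      have hm : max |F a - F₀ a| (max |P a - P₀ a| |η - η₀|) < κ :=
        max_lt hcl.1 (max_lt hcl.2 hη.2.1.2)
      have hk2 : κ * (2 * C) ≤ ε := by
        have : κ ≤ ε / (2 * C) := min_le_right _ _
        rwa [le_div_iff₀ (by positivity)] at this
      nlinarith
    exact ⟨this.1.trans_lt hmax, this.2.trans_lt hmax⟩

end Stability

theorem exists_picard {α η a b : ℝ} (h0 : 0 ≤ α) (h1 : α < 1 / 2) (hη : 0 ≤ η) (ha : 0 < a) (hab : a < b)
    (hy : η * b ^ 2 < 1) (x₀ y₀ : ℝ) : ∃ F P : ℝ → ℝ, F a = x₀ ∧ P a = y₀ ∧ ∀ ξ ∈ Icc a b,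
      HasDerivWithinAt F (vF α η ξ (F ξ) (P ξ)) (Icc a b) ξ ∧
      HasDerivWithinAt P (vP α η ξ (F ξ) (P ξ)) (Icc a b) ξ := by
  set T := b - a with hT
  have hT0 : 0 < T := sub_pos.2 hab
  set κ := a ^ 2 * (1 - 2 * α) with hκ
  have hκ0 : 0 < κ := mul_pos (pow_pos ha 2) (by linarith)
  set μ := κ / (2 * T) with hμ
  have hμ0 : 0 < μ := by positivity
  set y := 1 - η * b ^ 2 with hydef
  have hy0 : 0 < y := sub_pos.2 hy
  set L : ℝ := 2 * (|y₀| / κ + 1 / (y * μ)) with hL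
  have hL0 : 0 ≤ L := by positivity
  have hyle : ∀ t ∈ Icc a b, y ≤ 1 - η * t ^ 2 := by
    intro t ht
    have : η * t ^ 2 ≤ η * b ^ 2 := by
      have := ht.2; have := ha.trans_le ht.1; gcongr
    linarith
  set f : ℝ → ℝ × ℝ → ℝ × ℝ := fun t w => (vF α η t w.1 (μ * w.2), vP α η t w.1 (μ * w.2) / μ) with hf
  set w₀ : ℝ × ℝ := (x₀, y₀ / μ)
  have hC : ∀ z ∈ Icc a b ×ˢ Metric.closedBall w₀ (L * T), ContDiffAt ℝ 1 (fun z : ℝ × ℝ × ℝ => f z.1 z.2) z := by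
    rintro ⟨t, w⟩ ⟨ht, -⟩
    obtain ⟨A1, A2⟩ := analyticAt_vF_vP h0 h1 (z := (t, w.1, μ * w.2, η)) (ha.trans_le ht.1).ne'
      (hy0.trans_le (hyle t ht))
    have hin : AnalyticAt ℝ (fun z : ℝ × ℝ × ℝ => (z.1, z.2.1, μ * z.2.2, η)) (t, w) := by fun_prop
    have B1 := A1.comp_of_eq hin rfl
    have B2 := A2.comp_of_eq hin rfl
    exact B1.contDiffAt.prodMk (B2.contDiffAt.div_const μ)
  obtain ⟨K, hK⟩ := exists_lipschitz_of_contDiffAt (isCompact_Icc.prod (isCompact_closedBall _ _)) hC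
  have hPL : IsPicardLindelof f (⟨a, le_rfl, hab.le⟩ : Icc a b) w₀ ⟨L * T, by positivity⟩ 0 ⟨L, hL0⟩ K := by
    refine ⟨fun t ht => LipschitzOnWith.of_dist_le_mul fun w hw w' hw' => ?_, fun w hw t ht => ?_, ?_, ?_⟩
    · refine (hK.dist_le_mul (t, w) ⟨ht, hw⟩ (t, w') ⟨ht, hw'⟩).trans (le_of_eq ?_)
      rw [Prod.dist_eq]
      simp
    · have := (hC (t, w) ⟨ht, hw⟩).continuousAt
      exact (ContinuousAt.comp (f := fun t : ℝ => (t, w)) (x := t) this (by fun_prop)).continuousWithinAt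
    · intro t ht w hw
      have hw2 : |w.2 - y₀ / μ| ≤ L * T := by
        have := Metric.mem_closedBall.1 hw
        rw [Prod.dist_eq] at this
        exact (le_max_right _ _).trans this
      have e : |μ * w.2| ≤ |y₀| + μ * (L * T) := by
        have : μ * w.2 = μ * (w.2 - y₀ / μ) + y₀ := by field_simp; ring
        rw [this]
        refine (abs_add_le _ _).trans ?_
        rw [abs_mul, abs_of_pos hμ0]
        have := mul_le_mul_of_nonneg_left hw2 hμ0.le
        linarith
      refine max_le ?_ ?_
      · refine (abs_vF_le h0 h1 ha ht.1 (hy0.le.trans (hyle t ht))).trans ?_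
        rw [← hκ, div_le_iff₀ hκ0]
        refine e.trans ?_
        have e2 : μ * (L * T) = L / 2 * κ := by rw [hμ]; field_simp
        have e3 : |y₀| ≤ L / 2 * κ := by
          have : L / 2 * κ = |y₀| + 1 / (y * μ) * κ := by rw [hL]; field_simp
          rw [this]
          have : 0 ≤ 1 / (y * μ) * κ := by positivity
          linarith
        show _ ≤ L * κ
        linarith
      · change |vP α η t w.1 (μ * w.2) / μ| ≤ L
        have h3 := abs_vP_le (F := w.1) (P := μ * w.2) h0 h1 hy0 (hyle t ht)
        rw [abs_div, abs_of_pos hμ0]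
        calc _ ≤ 1 / y / μ := by gcongr
          _ = 1 / (y * μ) := by field_simp
          _ ≤ L := by
            have : 0 ≤ |y₀| / κ := by positivity
            have : 0 ≤ 1 / (y * μ) := by positivity
            rw [hL]; linarith
    · show L * max (b - a) (a - a) ≤ L * T - 0
      rw [sub_self, max_eq_left (by linarith), sub_zero]
  obtain ⟨w, hw0, hw⟩ := hPL.exists_eq_forall_mem_Icc_hasDerivWithinAt₀
  refine ⟨fun t => (w t).1, fun t => μ * (w t).2, ?_, ?_, fun ξ hξ => ⟨?_, ?_⟩⟩
  · show (w a).1 = x₀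
    have : w a = w₀ := hw0
    rw [this]
  · show μ * (w a).2 = y₀
    have : w a = w₀ := hw0
    rw [this]; simp only [w₀]; field_simp
  · have := (hw ξ hξ).hasFDerivWithinAt.fst.hasDerivWithinAt
    simpa [hf] using this
  · have := (hw ξ hξ).hasFDerivWithinAt.snd.hasDerivWithinAt.const_mul μ
    have e : μ * (vP α η ξ (w ξ).1 (μ * (w ξ).2) / μ) = vP α η ξ (w ξ).1 (μ * (w ξ).2) := by field_simp
    simpa [hf, e] using this

theorem exists_isSol_of_lt {α η : ℝ} (h0 : 0 ≤ α) (h1 : α < 1 / 2) (hη : 0 ≤ η) (c : ℝ) {b : ℝ}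
    (hy : η * b ^ 2 < 1) : ∃ F P, IsSol α η c b F P := by
  obtain ⟨Φ, Ψ, -, -, -, -, δ, hδ, -, H⟩ := exists_local_sol h0 h1 c η
  have hS := (H c η (by simpa using hδ) (by simpa using hδ)).1
  set F₁ := fun ξ => ξ * Φ (ξ, c, η)
  set P₁ := fun ξ => ξ ^ 2 * Ψ (ξ, c, η)
  rcases le_or_gt b δ with hle | hlt
  · exact ⟨_, _, hS.mono hle⟩
  set a := δ / 2
  have ha : 0 < a := by positivity
  have haδ : a < δ := by simp only [a]; linarith
  obtain ⟨F₂, P₂, eF, eP, h2⟩ := exists_picard h0 h1 hη ha (haδ.trans hlt) hy (F₁ a) (P₁ a)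
  have key : ∀ {f₁ f₂ : ℝ → ℝ} {v : ℝ → ℝ}, f₂ a = f₁ a → (∀ ξ ∈ Ioo 0 δ, ξ ≤ a → HasDerivAt f₁ (v ξ) ξ) →
      (∀ ξ ∈ Icc a b, HasDerivWithinAt f₂ (v ξ) (Icc a b) ξ) → ∀ ξ ∈ Ioo 0 b,
      HasDerivAt (fun s => if s ≤ a then f₁ s else f₂ s) (v ξ) ξ := by
    intro f₁ f₂ v ha' hl hr ξ hξ
    rcases lt_trichotomy ξ a with h | h | h
    · refine (hl ξ ⟨hξ.1, h.trans haδ⟩ h.le).congr_of_eventuallyEq ?_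
      filter_upwards [gt_mem_nhds h] with s hs
      rw [if_pos (le_of_lt hs)]
    · subst h
      rw [← hasDerivWithinAt_univ, ← Iic_union_Ici (a := a)]
      refine HasDerivWithinAt.union ?_ ?_
      · refine (hl a ⟨ha, haδ⟩ le_rfl).hasDerivWithinAt.congr (fun s hs => if_pos hs) (if_pos le_rfl)
      · have : HasDerivWithinAt f₂ (v a) (Ici a) a :=
          (hr a ⟨le_rfl, hξ.2.le⟩).mono_of_mem_nhdsWithin (Icc_mem_nhdsGE hξ.2)
        refine this.congr (fun s hs => ?_) ?_
        · rcases eq_or_lt_of_le (show a ≤ s from hs) with h | h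
          · rw [← h, if_pos le_rfl, ha']
          · rw [if_neg (not_le.2 h)]
        · rw [if_pos le_rfl, ha']
    · refine ((hr ξ ⟨h.le, hξ.2.le⟩).hasDerivAt (Icc_mem_nhds h hξ.2)).congr_of_eventuallyEq ?_
      filter_upwards [lt_mem_nhds h] with s hs
      rw [if_neg (not_le.2 hs)]
  set F := fun s => if s ≤ a then F₁ s else F₂ s with hF
  set P := fun s => if s ≤ a then P₁ s else P₂ s with hP
  have v1 : ∀ ξ, ξ ≤ a → F ξ = F₁ ξ ∧ P ξ = P₁ ξ := fun ξ h => ⟨if_pos h, if_pos h⟩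
  have v2 : ∀ ξ, a ≤ ξ → F ξ = F₂ ξ ∧ P ξ = P₂ ξ := by
    intro ξ h
    rcases eq_or_lt_of_le h with h | h
    · rw [← h, eF, eP]; exact v1 _ le_rfl
    · exact ⟨if_neg (not_le.2 h), if_neg (not_le.2 h)⟩
  have near : ∀ᶠ s in 𝓝[>] (0:ℝ), F s = F₁ s ∧ P s = P₁ s := by
    filter_upwards [Ioo_mem_nhdsGT ha] with s hs using v1 s hs.2.le
  refine ⟨F, P, ?_, ?_, ?_, ?_⟩
  · refine key (v := fun ξ => vF α η ξ (F ξ) (P ξ)) eF (fun ξ hξ hξa => ?_) (fun ξ hξ => ?_)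
    · rw [(v1 ξ hξa).1, (v1 ξ hξa).2]; exact hS.hF ξ hξ
    · rw [(v2 ξ hξ.1).1, (v2 ξ hξ.1).2]; exact (h2 ξ hξ).1
  · refine key (v := fun ξ => vP α η ξ (F ξ) (P ξ)) eP (fun ξ hξ hξa => ?_) (fun ξ hξ => ?_)
    · rw [(v1 ξ hξa).1, (v1 ξ hξa).2]; exact hS.hP ξ hξ
    · rw [(v2 ξ hξ.1).1, (v2 ξ hξ.1).2]; exact (h2 ξ hξ).2
  · refine hS.f0.congr' (near.mono fun s hs => ?_)
    show _ = _ / s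
    rw [hs.1]
  · refine hS.n0.congr' (near.mono fun s hs => ?_)
    show _ = _ / s ^ 2
    rw [hs.2]

theorem exists_isSol_glue {α η : ℝ} (h0 : 0 ≤ α) (h1 : α < 1 / 2) (hη : 0 ≤ η) (c : ℝ) (β : ℝ → ℝ) :
    ∃ F P, ∀ b, 0 < b → (∀ ξ, 0 < ξ → ξ < b → ξ < β ξ ∧ η * (β ξ) ^ 2 < 1) →
      IsSol α η c b F P := by
  have hex : ∀ ξ, ∃ FP : (ℝ → ℝ) × (ℝ → ℝ), 0 < β ξ → η * (β ξ) ^ 2 < 1 → IsSol α η c (β ξ) FP.1 FP.2 := by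
    intro ξ
    by_cases h : 0 < β ξ ∧ η * (β ξ) ^ 2 < 1
    · obtain ⟨F, P, hS⟩ := exists_isSol_of_lt h0 h1 hη c h.2
      exact ⟨(F, P), fun _ _ => hS⟩
    · exact ⟨(0, 0), fun h2 h3 => (h ⟨h2, h3⟩).elim⟩
  choose S hS using hex
  refine ⟨fun ξ => (S ξ).1 ξ, fun ξ => (S ξ).2 ξ, fun b hb hβ => ?_⟩
  have hS' : ∀ ξ, 0 < ξ → ξ < b → IsSol α η c (β ξ) (S ξ).1 (S ξ).2 := fun ξ h2 h3 =>
    hS ξ (h2.trans (hβ ξ h2 h3).1) (hβ ξ h2 h3).2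
  have agree : ∀ ξ s, 0 < ξ → ξ < b → 0 < s → s < b → s < β ξ → (S s).1 s = (S ξ).1 s ∧ (S s).2 s = (S ξ).2 s := by
    intro ξ s h2 h3 h4 h5 h6
    exact (hS' s h4 h5).eq h0 h1 (hS' ξ h2 h3) hη h4 (hβ s h4 h5).1 h6
      (mul_sq_lt_of_le hη h4 (hβ s h4 h5).1.le (hβ s h4 h5).2)
  have ev : ∀ ξ ∈ Ioo 0 b, ∀ᶠ s in 𝓝 ξ, (S s).1 s = (S ξ).1 s ∧ (S s).2 s = (S ξ).2 s := by
    intro ξ hξ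
    filter_upwards [Ioo_mem_nhds hξ.1 (lt_min hξ.2 (hβ ξ hξ.1 hξ.2).1)] with s hs
    exact agree ξ s hξ.1 hξ.2 hs.1 (hs.2.trans_le (min_le_left _ _)) (hs.2.trans_le (min_le_right _ _))
  have hb2 : 0 < b / 2 := by positivity
  have hb2' : b / 2 < b := by linarith
  have ev0 : ∀ᶠ s in 𝓝[>] (0:ℝ), (S s).1 s = (S (b / 2)).1 s ∧ (S s).2 s = (S (b / 2)).2 s := by
    filter_upwards [Ioo_mem_nhdsGT hb2] with s hs
    exact agree _ s hb2 hb2' hs.1 (hs.2.trans hb2') (hs.2.trans (hβ _ hb2 hb2').1)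
  refine ⟨fun ξ hξ => ?_, fun ξ hξ => ?_, ?_, ?_⟩
  · exact ((hS' ξ hξ.1 hξ.2).hF ξ ⟨hξ.1, (hβ ξ hξ.1 hξ.2).1⟩).congr_of_eventuallyEq
      ((ev ξ hξ).mono fun s hs => hs.1)
  · exact ((hS' ξ hξ.1 hξ.2).hP ξ ⟨hξ.1, (hβ ξ hξ.1 hξ.2).1⟩).congr_of_eventuallyEq
      ((ev ξ hξ).mono fun s hs => hs.2)
  · refine (hS' _ hb2 hb2').f0.congr' (ev0.mono fun s hs => ?_)
    show _ = _ / s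
    rw [hs.1]
  · refine (hS' _ hb2 hb2').n0.congr' (ev0.mono fun s hs => ?_)
    show _ = _ / s ^ 2
    rw [hs.2]

theorem exists_isSol_one {α : ℝ} (h0 : 0 ≤ α) (h1 : α < 1 / 2) (c : ℝ) : ∃ F P, IsSol α 1 c 1 F P := by
  obtain ⟨F, P, H⟩ := exists_isSol_glue h0 h1 zero_le_one c (fun ξ => (ξ + 1) / 2)
  refine ⟨F, P, H 1 one_pos (fun ξ h2 h3 => ⟨by linarith, ?_⟩)⟩
  rw [one_mul]
  nlinarith

theorem exists_isSol_global {α : ℝ} (h0 : 0 ≤ α) (h1 : α < 1 / 2) (c : ℝ) :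
    ∃ F P, ∀ b, 0 < b → IsSol α 0 c b F P := by
  obtain ⟨F, P, H⟩ := exists_isSol_glue h0 h1 le_rfl c (fun ξ => ξ + 1)
  exact ⟨F, P, fun b hb => H b hb (fun ξ h2 h3 => ⟨by linarith, by simp⟩)⟩

section Energy

variable {α η ξ : ℝ} {F P : ℝ → ℝ}

theorem vP_mul (x p : ℝ) (hy : 0 < 1 - η * ξ ^ 2) : vP α η ξ x p * (1 - η * ξ ^ 2) =
    sin (2 * x) * (Af α (1 - η * ξ ^ 2) x (p / ξ) / Rf α (1 - η * ξ ^ 2) x (p / ξ)) := by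
  unfold vP
  rw [← div_div, div_mul_cancel₀ _ hy.ne', mul_div_assoc]

theorem hasDerivAt_yN (hξ : ξ ≠ 0) (hy : 0 < 1 - η * ξ ^ 2)
    (hP : HasDerivAt P (vP α η ξ (F ξ) (P ξ)) ξ) :
    HasDerivAt (fun ξ => (1 - η * ξ ^ 2) * (P ξ / ξ) ^ 2)
      ((-2 * (P ξ / ξ) ^ 2 + 2 * (P ξ / ξ) * (sin (2 * F ξ) * (Af α (1 - η * ξ ^ 2) (F ξ) (P ξ / ξ) /
        Rf α (1 - η * ξ ^ 2) (F ξ) (P ξ / ξ)))) / ξ) ξ := by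
  have d1 : HasDerivAt (fun ξ : ℝ => 1 - η * ξ ^ 2) (-(η * (2 * ξ))) ξ := by
    simpa using ((hasDerivAt_pow 2 ξ).const_mul η).const_sub 1
  have d2 := (hP.div (hasDerivAt_id' ξ) hξ).pow 2
  refine (d1.mul d2).congr_deriv ?_
  rw [← vP_mul _ _ hy]
  simp only [Pi.div_apply, Pi.pow_apply]
  push_cast
  field_simp
  ring

theorem vF_eq (x p : ℝ) : vF α η ξ x p = (p / ξ) / (ξ * Rf α (1 - η * ξ ^ 2) x (p / ξ)) := by
  unfold vF
  rw [div_div, ← mul_assoc, ← sq]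

theorem hasDerivAt_Af (h0 : 0 ≤ α) (h1 : α < 1 / 2) (hξ : ξ ≠ 0) (hy : 0 < 1 - η * ξ ^ 2)
    (hF : HasDerivAt F (vF α η ξ (F ξ) (P ξ)) ξ)
    (hP : HasDerivAt P (vP α η ξ (F ξ) (P ξ)) ξ) :
    HasDerivAt (fun ξ => Af α (1 - η * ξ ^ 2) (F ξ) (P ξ / ξ))
      (-(2 * α * (P ξ / ξ) ^ 2) / (ξ * Rf α (1 - η * ξ ^ 2) (F ξ) (P ξ / ξ))) ξ := by
  have du := hasDerivAt_yN hξ hy hP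
  have dq : HasDerivAt (fun ξ => qf α (F ξ))
      (-(2 * α) * (sin (2 * F ξ) * vF α η ξ (F ξ) (P ξ))) ξ := by
    unfold qf
    refine (((hF.sin.pow 2).const_mul (2 * α)).const_sub 1).congr_deriv ?_
    rw [sin_two_mul]
    push_cast
    ring
  have hrad := radicand_pos (F := F ξ) (N := P ξ / ξ) h0 h1 hy.le
  have hR := Rf_pos (F := F ξ) (N := P ξ / ξ) h0 h1 hy.le
  have hRA := Rf_eq (α := α) (y := 1 - η * ξ ^ 2) (F := F ξ) (N := P ξ / ξ)
  have dR := ((dq.pow 2).add (du.const_mul (4 * α))).sqrt (by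
    simp only [Pi.add_apply, Pi.pow_apply]
    rw [← mul_assoc]; exact hrad.ne')
  have dA := (dR.add dq).div_const 2
  have eA : (fun ξ => Af α (1 - η * ξ ^ 2) (F ξ) (P ξ / ξ)) = fun ξ =>
      (√(qf α (F ξ) ^ 2 + 4 * α * ((1 - η * ξ ^ 2) * (P ξ / ξ) ^ 2)) + qf α (F ξ)) / 2 := by
    funext s
    unfold Af Rf
    rw [← mul_assoc]
  rw [eA]
  refine dA.congr_deriv ?_
  simp only [Pi.add_apply, Pi.pow_apply]
  have eR : √(qf α (F ξ) ^ 2 + 4 * α * ((1 - η * ξ ^ 2) * (P ξ / ξ) ^ 2)) =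
      Rf α (1 - η * ξ ^ 2) (F ξ) (P ξ / ξ) := by
    unfold Rf; rw [← mul_assoc]
  rw [eR, vF_eq]
  have hq : qf α (F ξ) = 2 * Af α (1 - η * ξ ^ 2) (F ξ) (P ξ / ξ) - Rf α (1 - η * ξ ^ 2) (F ξ) (P ξ / ξ) := by
    linarith
  rw [hq]
  generalize Af α (1 - η * ξ ^ 2) (F ξ) (P ξ / ξ) = A at *
  generalize Rf α (1 - η * ξ ^ 2) (F ξ) (P ξ / ξ) = R at *
  have := hR.ne'
  push_cast
  field_simp
  ring

/-- The monotone quantity. -/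
def energy (α η : ℝ) (F P : ℝ → ℝ) (ξ : ℝ) : ℝ :=
  2 * sin (F ξ) ^ 2 - (1 - η * ξ ^ 2) * (P ξ / ξ) ^ 2 / Af α (1 - η * ξ ^ 2) (F ξ) (P ξ / ξ)

theorem Af_eq_energy (h0 : 0 ≤ α) (h1 : α < 1 / 2) (hy : 0 < 1 - η * ξ ^ 2) :
    Af α (1 - η * ξ ^ 2) (F ξ) (P ξ / ξ) = 1 - α * energy α η F P ξ := by
  have hA := Af_pos (F := F ξ) (N := P ξ / ξ) h0 h1 hy.le
  have hA2 := Af_sq (F := F ξ) (N := P ξ / ξ) h0 h1 hy.le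
  unfold energy
  unfold qf at hA2
  field_simp
  linear_combination hA2

theorem hasDerivAt_energy (h0 : 0 ≤ α) (h1 : α < 1 / 2) (hξ : ξ ≠ 0) (hy : 0 < 1 - η * ξ ^ 2)
    (hF : HasDerivAt F (vF α η ξ (F ξ) (P ξ)) ξ)
    (hP : HasDerivAt P (vP α η ξ (F ξ) (P ξ)) ξ) :
    HasDerivAt (energy α η F P)
      (2 * (P ξ / ξ) ^ 2 / (ξ * Rf α (1 - η * ξ ^ 2) (F ξ) (P ξ / ξ))) ξ := by
  have du := hasDerivAt_yN hξ hy hP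
  have dA := hasDerivAt_Af h0 h1 hξ hy hF hP
  have hA := Af_pos (F := F ξ) (N := P ξ / ξ) h0 h1 hy.le
  have hR := Rf_pos (F := F ξ) (N := P ξ / ξ) h0 h1 hy.le
  have hA2 := Af_sq (F := F ξ) (N := P ξ / ξ) h0 h1 hy.le
  have hRA := Rf_eq (α := α) (y := 1 - η * ξ ^ 2) (F := F ξ) (N := P ξ / ξ)
  refine (((hF.sin.pow 2).const_mul 2).sub (du.div dA hA.ne')).congr_deriv ?_
  rw [vF_eq, sin_two_mul]
  push_cast
  have hq : qf α (F ξ) = 2 * Af α (1 - η * ξ ^ 2) (F ξ) (P ξ / ξ) - Rf α (1 - η * ξ ^ 2) (F ξ) (P ξ / ξ) := by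
    linarith
  rw [hq] at hA2
  generalize Af α (1 - η * ξ ^ 2) (F ξ) (P ξ / ξ) = A at *
  generalize Rf α (1 - η * ξ ^ 2) (F ξ) (P ξ / ξ) = R at *
  generalize 1 - η * ξ ^ 2 = y at *
  generalize P ξ / ξ = N at *
  field_simp
  linear_combination N ^ 2 * hA2

variable {c b : ℝ}

theorem IsSol.tendsto_F (h : IsSol α η c b F P) : Tendsto F (𝓝[>] 0) (𝓝 0) := by
  have hid : Tendsto (fun ξ : ℝ => ξ) (𝓝[>] 0) (𝓝 0) := tendsto_id.mono_left nhdsWithin_le_nhds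
  have := h.f0.mul hid
  rw [mul_zero] at this
  refine this.congr' ?_
  filter_upwards [self_mem_nhdsWithin] with s hs
  rw [div_mul_cancel₀ _ (ne_of_gt hs)]

theorem IsSol.tendsto_energy (h : IsSol α η c b F P) :
    Tendsto (fun ξ => energy α η F P ξ / ξ ^ 2) (𝓝[>] 0) (𝓝 (c ^ 2)) := by
  have hid : Tendsto (fun ξ : ℝ => ξ) (𝓝[>] 0) (𝓝 0) := tendsto_id.mono_left nhdsWithin_le_nhds
  have hF := h.tendsto_F
  have hN : Tendsto (fun ξ => P ξ / ξ) (𝓝[>] 0) (𝓝 0) := by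
    have := h.n0.mul hid
    rw [mul_zero] at this
    refine this.congr' ?_
    filter_upwards [self_mem_nhdsWithin] with s hs
    have : s ≠ 0 := ne_of_gt hs
    field_simp
  have hy : Tendsto (fun ξ : ℝ => 1 - η * ξ ^ 2) (𝓝[>] 0) (𝓝 1) := by
    have := ((hid.pow 2).const_mul η).const_sub 1
    simpa using this
  have hq : Tendsto (fun ξ => qf α (F ξ)) (𝓝[>] 0) (𝓝 1) := by
    have : Continuous (qf α) := by unfold qf; fun_prop
    have := (this.tendsto 0).comp hF
    have e0 : qf α 0 = 1 := by simp [qf]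
    rwa [e0] at this
  have hR : Tendsto (fun ξ => Rf α (1 - η * ξ ^ 2) (F ξ) (P ξ / ξ)) (𝓝[>] 0) (𝓝 1) := by
    have := ((hq.pow 2).add ((hy.const_mul (4 * α)).mul (hN.pow 2))).sqrt
    simpa [Rf] using this
  have hA : Tendsto (fun ξ => Af α (1 - η * ξ ^ 2) (F ξ) (P ξ / ξ)) (𝓝[>] 0) (𝓝 1) := by
    have := (hR.add hq).div_const 2
    norm_num at this
    exact this
  have hs : Tendsto (fun ξ => sinc (F ξ) * (F ξ / ξ)) (𝓝[>] 0) (𝓝 c) := by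
    have := ((Real.continuous_sinc.tendsto 0).comp hF).mul h.f0
    simpa using this
  have := ((hs.pow 2).const_mul 2).sub ((hy.mul (h.n0.pow 2)).div hA one_ne_zero)
  have e : 2 * c ^ 2 - 1 * c ^ 2 / 1 = c ^ 2 := by ring
  rw [e] at this
  refine this.congr' ?_
  filter_upwards [self_mem_nhdsWithin] with s hs
  have : s ≠ 0 := ne_of_gt hs
  unfold energy
  rw [← mul_sinc]
  simp only [Pi.div_apply]
  field_simp

theorem IsSol.energy_monotoneOn (h0 : 0 ≤ α) (h1 : α < 1 / 2) (h : IsSol α η c b F P) (hη : 0 ≤ η)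
    (hy : η * b ^ 2 ≤ 1) : MonotoneOn (energy α η F P) (Ioo 0 b) := by
  have hd : ∀ ξ ∈ Ioo 0 b, 0 < 1 - η * ξ ^ 2 ∧ HasDerivAt (energy α η F P)
      (2 * (P ξ / ξ) ^ 2 / (ξ * Rf α (1 - η * ξ ^ 2) (F ξ) (P ξ / ξ))) ξ := by
    intro ξ hξ
    have hy' : 0 < 1 - η * ξ ^ 2 := by
      rcases hη.eq_or_lt with rfl | hη
      · simp
      · have : η * ξ ^ 2 < η * b ^ 2 := by
          have := hξ.1; have := hξ.2; gcongr
        linarith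
    exact ⟨hy', hasDerivAt_energy h0 h1 hξ.1.ne' hy' (h.hF ξ hξ) (h.hP ξ hξ)⟩
  refine monotoneOn_of_deriv_nonneg (convex_Ioo 0 b)
    (fun ξ hξ => (hd ξ hξ).2.continuousAt.continuousWithinAt) ?_ ?_
  · rw [interior_Ioo]
    exact fun ξ hξ => (hd ξ hξ).2.differentiableAt.differentiableWithinAt
  · rw [interior_Ioo]
    intro ξ hξ
    rw [(hd ξ hξ).2.deriv]
    have := hξ.1
    have := Rf_pos (F := F ξ) (N := P ξ / ξ) h0 h1 (hd ξ hξ).1.le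
    positivity

theorem IsSol.energy_pos (h0 : 0 ≤ α) (h1 : α < 1 / 2) (h : IsSol α η c b F P) (hη : 0 ≤ η)
    (hy : η * b ^ 2 ≤ 1) (hc : c ≠ 0) (hξ : ξ ∈ Ioo 0 b) : 0 < energy α η F P ξ := by
  have e1 := h.tendsto_energy.eventually (lt_mem_nhds (show 0 < c ^ 2 by positivity))
  obtain ⟨s, hs, hs2⟩ := (e1.and (Ioo_mem_nhdsGT hξ.1)).exists
  have : 0 < energy α η F P s := by
    have h2 := pow_pos hs2.1 2
    exact (div_pos_iff_of_pos_right h2).1 hs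
  exact this.trans_le (h.energy_monotoneOn h0 h1 hη hy ⟨hs2.1, hs2.2.trans hξ.2⟩ hξ hs2.2.le)

end Energy

section Bounds

variable {α η c b ξ : ℝ} {F P : ℝ → ℝ}

theorem one_sub_pos_of_lt (hη : 0 ≤ η) (hy : η * b ^ 2 ≤ 1) (hξ : ξ ∈ Ioo 0 b) : 0 < 1 - η * ξ ^ 2 := by
  rcases hη.eq_or_lt with rfl | hη
  · simp
  · have : η * ξ ^ 2 < η * b ^ 2 := by
      have := hξ.1; have := hξ.2; gcongr
    linarith

theorem IsSol.energy_nonneg (h0 : 0 ≤ α) (h1 : α < 1 / 2) (h : IsSol α η c b F P) (hη : 0 ≤ η)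
    (hy : η * b ^ 2 ≤ 1) (hξ : ξ ∈ Ioo 0 b) : 0 ≤ energy α η F P ξ := by
  have hid : Tendsto (fun ξ : ℝ => ξ) (𝓝[>] 0) (𝓝 0) := tendsto_id.mono_left nhdsWithin_le_nhds
  have ht : Tendsto (energy α η F P) (𝓝[>] 0) (𝓝 0) := by
    have := h.tendsto_energy.mul (hid.pow 2)
    rw [zero_pow two_ne_zero, mul_zero] at this
    refine this.congr' ?_
    filter_upwards [self_mem_nhdsWithin] with s hs
    rw [div_mul_cancel₀ _ (pow_ne_zero 2 (ne_of_gt hs))]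
  refine le_of_tendsto ht ?_
  filter_upwards [Ioo_mem_nhdsGT hξ.1] with s hs
  exact h.energy_monotoneOn h0 h1 hη hy ⟨hs.1, hs.2.trans hξ.2⟩ hξ hs.2.le

theorem IsSol.Af_le_one (h0 : 0 ≤ α) (h1 : α < 1 / 2) (h : IsSol α η c b F P) (hη : 0 ≤ η)
    (hy : η * b ^ 2 ≤ 1) (hξ : ξ ∈ Ioo 0 b) : Af α (1 - η * ξ ^ 2) (F ξ) (P ξ / ξ) ≤ 1 := by
  rw [Af_eq_energy h0 h1 (one_sub_pos_of_lt hη hy hξ)]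
  have := mul_nonneg h0 (h.energy_nonneg h0 h1 hη hy hξ)
  linarith

theorem IsSol.yN_le (h0 : 0 ≤ α) (h1 : α < 1 / 2) (h : IsSol α η c b F P) (hη : 0 ≤ η)
    (hy : η * b ^ 2 ≤ 1) (hξ : ξ ∈ Ioo 0 b) : (1 - η * ξ ^ 2) * (P ξ / ξ) ^ 2 ≤ 2 * sin (F ξ) ^ 2 := by
  have hy' := one_sub_pos_of_lt hη hy hξ
  have hA := Af_pos (F := F ξ) (N := P ξ / ξ) h0 h1 hy'.le
  have hA1 := h.Af_le_one h0 h1 hη hy hξ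
  have he := h.energy_nonneg h0 h1 hη hy hξ
  unfold energy at he
  have : (1 - η * ξ ^ 2) * (P ξ / ξ) ^ 2 / Af α (1 - η * ξ ^ 2) (F ξ) (P ξ / ξ) ≤ 2 * sin (F ξ) ^ 2 := by linarith
  rw [div_le_iff₀ hA] at this
  refine this.trans ?_
  nlinarith [sq_nonneg (sin (F ξ))]

theorem vF_eq_zero (h0 : 0 ≤ α) (h1 : α < 1 / 2) {x p : ℝ} (hξ : ξ ≠ 0) (hy : 0 ≤ 1 - η * ξ ^ 2)
    (h : vF α η ξ x p = 0) : p = 0 := by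
  unfold vF at h
  have := Rf_pos (F := x) (N := p / ξ) h0 h1 hy
  rcases div_eq_zero_iff.1 h with h | h
  · exact h
  · exact absurd h (by positivity)

/-- Zeros of `F - π / 2` are simple. -/
theorem IsSol.P_ne_zero (h0 : 0 ≤ α) (h1 : α < 1 / 2) (h : IsSol α η c b F P) (hη : 0 ≤ η)
    (hy : η * b ^ 2 ≤ 1) (hξ : ξ ∈ Ioo 0 b) (hF : F ξ = π / 2) : P ξ ≠ 0 := by
  intro hP
  have hconst : ∀ a ∈ Ioo 0 ξ, F a = π / 2 := by
    intro a ha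
    have hsub : Icc a ξ ⊆ Ioo 0 b := fun t ht => ⟨ha.1.trans_le ht.1, ht.2.trans_lt hξ.2⟩
    have hy' : η * ξ ^ 2 < 1 := by linarith [one_sub_pos_of_lt hη hy hξ]
    have hcF : ContinuousOn F (Icc a ξ) := fun t ht => (h.hF t (hsub ht)).continuousAt.continuousWithinAt
    have hcP : ContinuousOn P (Icc a ξ) := fun t ht => (h.hP t (hsub ht)).continuousAt.continuousWithinAt
    obtain ⟨K, hK⟩ := exists_lipschitz_vField h0 h1 ha.1 hy' (insert (π / 2, 0) ((fun t => (F t, P t)) '' Icc a ξ))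
      ((isCompact_Icc.image_of_continuousOn (hcF.prodMk hcP)).insert _)
    have := ODE_solution_unique_of_mem_Icc_left (v := vField α) (K := K) (a := a) (b := ξ)
      (s := fun _ => {w | (w.1, w.2.1) ∈ (insert (π / 2, 0) ((fun t => (F t, P t)) '' Icc a ξ)) ∧ w.2.2 ∈ Icc 0 η})
      (f := fun t => (F t, P t, η)) (g := fun _ => (π / 2, 0, η))
      (fun t ht => hK t (Ioc_subset_Icc_self ht))
      (hcF.prodMk (hcP.prodMk continuousOn_const))
      (fun t ht => ((h.hF t (hsub (Ioc_subset_Icc_self ht))).prodMk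
        ((h.hP t (hsub (Ioc_subset_Icc_self ht))).prodMk (hasDerivAt_const _ _))).hasDerivWithinAt)
      (fun t ht => ⟨mem_insert_of_mem _ ⟨t, Ioc_subset_Icc_self ht, rfl⟩, hη, le_rfl⟩)
      continuousOn_const
      (fun t ht => by
        have : vField α t (π / 2, 0, η) = 0 := by
          have e : 2 * (π / 2) = π := by ring
          simp [vField, vF, vP, e]
        rw [this]
        exact hasDerivWithinAt_const _ _ _)
      (fun t ht => ⟨mem_insert _ _, hη, le_rfl⟩)
      (by simp [hF, hP])
    exact congrArg Prod.fst (this ⟨le_rfl, ha.2.le⟩)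
  have ht : Tendsto F (𝓝[>] 0) (𝓝 (π / 2)) := by
    refine tendsto_const_nhds.congr' ?_
    filter_upwards [Ioo_mem_nhdsGT hξ.1] with a ha
    exact (hconst a ha).symm
  have := tendsto_nhds_unique ht h.tendsto_F
  have := pi_pos
  linarith

theorem IsSol.abs_vF_le_sqrt (h0 : 0 ≤ α) (h1 : α < 1 / 2) (h : IsSol α 1 c 1 F P) (hξ : ξ ∈ Ioo 0 1)
    (h2 : 1 / 2 ≤ ξ) : |vF α 1 ξ (F ξ) (P ξ)| ≤ 4 / (1 - 2 * α) / √(1 - ξ) := by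
  have hy' : 0 < 1 - 1 * ξ ^ 2 := one_sub_pos_of_lt zero_le_one (by norm_num) hξ
  have hN := h.yN_le h0 h1 zero_le_one (by norm_num) hξ
  have hR := Rf_ge (F := F ξ) (N := P ξ / ξ) h0 hy'.le
  have hκ : 0 < 1 - 2 * α := by linarith
  have hs : 0 < √(1 - ξ) := Real.sqrt_pos.2 (by linarith [hξ.2])
  have hs2 : √(1 - ξ) ^ 2 = 1 - ξ := Real.sq_sqrt (by linarith [hξ.2])
  rw [vF_eq, abs_div, abs_of_pos (mul_pos hξ.1 (hκ.trans_le hR))]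
  have hN2 : |P ξ / ξ| * √(1 - ξ) ≤ 2 := by
    refine (abs_le_of_sq_le_sq' (a := |P ξ / ξ| * √(1 - ξ)) (b := 2) ?_ zero_le_two).2
    rw [mul_pow, sq_abs, hs2]
    have h3 := sin_sq_le_one (F ξ)
    have h4 : (P ξ / ξ) ^ 2 * (1 - ξ) ≤ (1 - 1 * ξ ^ 2) * (P ξ / ξ) ^ 2 := by
      have h5 : 1 - ξ ≤ 1 - 1 * ξ ^ 2 := by nlinarith [hξ.1, hξ.2]
      nlinarith [mul_le_mul_of_nonneg_right h5 (sq_nonneg (P ξ / ξ))]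
    linarith
  have hd : (1 - 2 * α) / 2 ≤ ξ * Rf α (1 - 1 * ξ ^ 2) (F ξ) (P ξ / ξ) := by nlinarith
  rw [div_div, div_le_div_iff₀ (mul_pos hξ.1 (hκ.trans_le hR)) (by positivity)]
  calc _ = |P ξ / ξ| * √(1 - ξ) * (1 - 2 * α) := by ring
    _ ≤ 2 * (1 - 2 * α) := by gcongr
    _ ≤ _ := by linarith

theorem abs_sub_le_of_deriv_le_inv_sqrt {f f' : ℝ → ℝ} {C ξ ξ' : ℝ} (hC : 0 ≤ C) (h3 : ξ ≤ ξ') (h4 : ξ' < 1)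
    (hf : ∀ x ∈ Icc ξ ξ', HasDerivAt f (f' x) x ∧ |f' x| ≤ C / √(1 - x)) :
    |f ξ' - f ξ| ≤ 2 * C * √(1 - ξ) := by
  have dH : ∀ x ∈ Icc ξ ξ', HasDerivAt (fun x => 2 * C * √(1 - x)) (-(C / √(1 - x))) x := by
    intro x hx
    have hx1 : 0 < 1 - x := by linarith [hx.2]
    refine ((((hasDerivAt_id' x).const_sub 1).sqrt hx1.ne').const_mul (2 * C)).congr_deriv ?_
    have := (Real.sqrt_pos.2 hx1).ne'
    field_simp
  have anti : ∀ f f' : ℝ → ℝ, (∀ x ∈ Icc ξ ξ', HasDerivAt f (f' x) x) → (∀ x ∈ Icc ξ ξ', f' x ≤ 0) → f ξ' ≤ f ξ := by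
    intro f f' hf hf'
    refine antitoneOn_of_deriv_nonpos (convex_Icc ξ ξ')
      (fun x hx => (hf x hx).continuousAt.continuousWithinAt) ?_ ?_ ⟨le_rfl, h3⟩ ⟨h3, le_rfl⟩ h3
    · exact fun x hx => (hf x (interior_subset hx)).differentiableAt.differentiableWithinAt
    · intro x hx
      rw [(hf x (interior_subset hx)).deriv]
      exact hf' x (interior_subset hx)
  have a1 := anti _ _ (fun x hx => (dH x hx).add (hf x hx).1) (fun x hx => by
    have := (abs_le.1 (hf x hx).2).2; linarith)
  have a2 := anti _ _ (fun x hx => (dH x hx).sub (hf x hx).1) (fun x hx => by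
    have := (abs_le.1 (hf x hx).2).1; linarith)
  simp only [Pi.add_apply, Pi.sub_apply] at a1 a2
  have : 0 ≤ 2 * C * √(1 - ξ') := by positivity
  rw [abs_le]
  constructor <;> linarith

theorem tendsto_sqrt_one_sub : Tendsto (fun ξ : ℝ => √(1 - ξ)) (𝓝[<] 1) (𝓝 0) := by
  have : ContinuousAt (fun ξ : ℝ => √(1 - ξ)) 1 := by fun_prop
  have := this.tendsto.mono_left (nhdsWithin_le_nhds (s := Iio 1))
  simpa using this

theorem exists_tendsto_of_deriv_le_inv_sqrt {f f' : ℝ → ℝ} {C : ℝ} (hC : 0 ≤ C)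
    (hf : ∀ x ∈ Ioo (1 / 2) 1, HasDerivAt f (f' x) x ∧ |f' x| ≤ C / √(1 - x)) :
    ∃ L, Tendsto f (𝓝[<] 1) (𝓝 L) := by
  rw [← cauchy_map_iff_exists_tendsto, Metric.cauchy_iff]
  refine ⟨inferInstance, fun ε hε => ?_⟩
  have ht : Tendsto (fun ξ : ℝ => 2 * C * √(1 - ξ)) (𝓝[<] 1) (𝓝 0) := by
    simpa using tendsto_sqrt_one_sub.const_mul (2 * C)
  obtain ⟨s, hs, hs2⟩ := ((ht.eventually (gt_mem_nhds hε)).and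
    (Ioo_mem_nhdsLT (show (1 / 2 : ℝ) < 1 by norm_num))).exists
  refine ⟨f '' Ioo s 1, image_mem_map (Ioo_mem_nhdsLT hs2.2), ?_⟩
  have key : ∀ x y, s < x → x ≤ y → y < 1 → |f y - f x| < ε := by
    intro x y h3 h4 h5
    refine (abs_sub_le_of_deriv_le_inv_sqrt hC h4 h5 fun t ht =>
      hf t ⟨hs2.1.trans (h3.trans_le ht.1), ht.2.trans_lt h5⟩).trans_lt (lt_of_le_of_lt ?_ hs)
    gcongr
  rintro _ ⟨x, hx, rfl⟩ _ ⟨y, hy, rfl⟩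
  rcases le_total x y with hxy | hxy
  · rw [dist_comm]; exact key x y hx.1 hxy hy.2
  · exact key y x hy.1 hxy hx.2

/-- Uniform Hölder bound at the horizon. -/
theorem IsSol.abs_sub_le (h0 : 0 ≤ α) (h1 : α < 1 / 2) (h : IsSol α 1 c 1 F P) {ξ' : ℝ}
    (h2 : 1 / 2 ≤ ξ) (h3 : ξ ≤ ξ') (h4 : ξ' < 1) : |F ξ' - F ξ| ≤ 8 / (1 - 2 * α) * √(1 - ξ) := by
  have hκ : 0 < 1 - 2 * α := by linarith
  refine (abs_sub_le_of_deriv_le_inv_sqrt (f' := fun x => vF α 1 x (F x) (P x)) (C := 4 / (1 - 2 * α))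
    (by positivity) h3 h4 fun x hx => ?_).trans_eq (by ring)
  have hx' : x ∈ Ioo (0:ℝ) 1 := ⟨by linarith [hx.1], by linarith [hx.2]⟩
  exact ⟨h.hF x hx', h.abs_vF_le_sqrt h0 h1 hx' (h2.trans hx.1)⟩

theorem abs_vP_le_sub (h0 : 0 ≤ α) (h1 : α < 1 / 2) (hξ : ξ ∈ Ioo 0 1) (x p : ℝ) :
    |vP α 1 ξ x p| ≤ 2 * |x - π / 2| / (1 - ξ) := by
  have hy' : 0 < 1 - 1 * ξ ^ 2 := one_sub_pos_of_lt zero_le_one (by norm_num) hξ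
  have hR := Rf_pos (F := x) (N := p / ξ) h0 h1 hy'.le
  have hA := Af_pos (F := x) (N := p / ξ) h0 h1 hy'.le
  have hAR := Af_le_Rf (F := x) (N := p / ξ) h0 hy'.le
  have hs : |sin (2 * x)| ≤ 2 * |x - π / 2| := by
    have : sin (2 * x) = - sin (2 * (x - π / 2)) := by
      rw [show 2 * (x - π / 2) = 2 * x - π by ring, sin_sub_pi]; ring
    rw [this, abs_neg]
    refine (Real.abs_sin_le_abs).trans ?_
    rw [abs_mul, abs_two]
  have hξ1 : 0 < 1 - ξ := by linarith [hξ.2]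
  have h5 : 1 - ξ ≤ 1 - 1 * ξ ^ 2 := by nlinarith [hξ.1, hξ.2]
  unfold vP
  rw [abs_div, abs_mul, abs_of_pos hA, abs_of_pos (mul_pos hR hy'),
    div_le_div_iff₀ (by positivity) hξ1]
  calc |sin (2 * x)| * Af α (1 - 1 * ξ ^ 2) x (p / ξ) * (1 - ξ)
      ≤ 2 * |x - π / 2| * Rf α (1 - 1 * ξ ^ 2) x (p / ξ) * (1 - 1 * ξ ^ 2) := by gcongr
    _ = _ := by ring

/-- Two consecutive zeros of `F - π / 2` cannot both lie close to the horizon. -/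
theorem IsSol.not_two_zeros (h0 : 0 ≤ α) (h1 : α < 1 / 2) (h : IsSol α 1 c 1 F P) {z w : ℝ}
    (hz : 1 - (1 - 2 * α) / 16 < z) (hzw : z < w) (hw : w < 1) (hFz : F z = π / 2) (hFw : F w = π / 2) :
    False := by
  have hκ : 0 < 1 - 2 * α := by linarith
  have hz2 : 1 / 2 ≤ z := by linarith
  have hsub : Icc z w ⊆ Ioo 0 1 := fun t ht => ⟨by linarith [ht.1], ht.2.trans_lt hw⟩
  set K := 4 / (1 - 2 * α) with hK
  have hK0 : 0 < K := by positivity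
  have hcP : ContinuousOn (fun t => |P t|) (Icc z w) := fun t ht =>
    (h.hP t (hsub ht)).continuousAt.abs.continuousWithinAt
  obtain ⟨x₀, hx₀, hmax⟩ := isCompact_Icc.exists_isMaxOn (nonempty_Icc.2 hzw.le) hcP
  set m := |P x₀| with hm
  have hm0 : 0 ≤ m := abs_nonneg _
  have hPm : ∀ t ∈ Icc z w, |P t| ≤ m := fun t ht => hmax ht
  have hy' : ∀ t ∈ Icc z w, 0 < 1 - 1 * t ^ 2 := fun t ht =>
    one_sub_pos_of_lt zero_le_one (by norm_num) (hsub ht)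
  have hvF : ∀ t ∈ Icc z w, ‖vF α 1 t (F t) (P t)‖ ≤ K * m := by
    intro t ht
    refine (abs_vF_le h0 h1 (show (0:ℝ) < 1 / 2 by norm_num) (hz2.trans ht.1) (hy' t ht).le).trans ?_
    calc |P t| / ((1 / 2) ^ 2 * (1 - 2 * α)) ≤ m / ((1 / 2) ^ 2 * (1 - 2 * α)) := by
          gcongr; exact hPm t ht
      _ = K * m := by rw [hK]; field_simp; ring
  have hG : ∀ s ∈ Icc z w, |F s - π / 2| ≤ K * m * (w - s) := by
    intro s hs
    have := Convex.norm_image_sub_le_of_norm_hasDerivWithin_le (s := Icc z w)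
      (fun t ht => (h.hF t (hsub ht)).hasDerivWithinAt) hvF (convex_Icc z w) ⟨hzw.le, le_rfl⟩ hs
    rwa [hFw, Real.norm_eq_abs, Real.norm_eq_abs, abs_sub_comm s, abs_of_nonneg (sub_nonneg.2 hs.2)] at this
  have hvP : ∀ s ∈ Icc z w, ‖vP α 1 s (F s) (P s)‖ ≤ 2 * (K * m) := by
    intro s hs
    refine (abs_vP_le_sub h0 h1 (hsub hs) _ _).trans ?_
    have h3 : 0 < 1 - s := by linarith [hs.2]
    rw [div_le_iff₀ h3]
    have := hG s hs
    have : K * m * (w - s) ≤ K * m * (1 - s) := by gcongr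
    linarith
  obtain ⟨x, hx, hx0⟩ := exists_hasDerivAt_eq_zero (f := F) hzw
    (fun t ht => (h.hF t (hsub ht)).continuousAt.continuousWithinAt) (hFz.trans hFw.symm)
    (fun t ht => h.hF t (hsub (Ioo_subset_Icc_self ht)))
  have hx' := Ioo_subset_Icc_self hx
  have hPx := vF_eq_zero h0 h1 (hsub hx').1.ne' (hy' x hx').le hx0
  have := Convex.norm_image_sub_le_of_norm_hasDerivWithin_le (s := Icc z w)
      (fun t ht => (h.hP t (hsub ht)).hasDerivWithinAt) hvP (convex_Icc z w) hx' hx₀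
  rw [hPx, sub_zero, Real.norm_eq_abs, Real.norm_eq_abs] at this
  have hd : |x₀ - x| ≤ (1 - 2 * α) / 16 := by
    rw [abs_le]; constructor <;> linarith [hx₀.1, hx₀.2, hx'.1, hx'.2]
  have h3 : m ≤ 2 * (K * m) * ((1 - 2 * α) / 16) := this.trans (by gcongr)
  have h4 : 2 * (K * m) * ((1 - 2 * α) / 16) = m / 2 := by rw [hK]; field_simp; ring
  have hm00 : m = 0 := by linarith
  have hPz : P z = 0 := abs_nonpos_iff.1 (hm00 ▸ hPm z ⟨le_rfl, hzw.le⟩)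
  exact h.P_ne_zero h0 h1 zero_le_one (by norm_num) (hsub ⟨le_rfl, hzw.le⟩) hFz hPz

end Bounds

section Persistence

variable {α η₀ c₀ b₀ : ℝ} {F₀ P₀ : ℝ → ℝ}

theorem IsSol.zero_persists (h0 : 0 ≤ α) (h1 : α < 1 / 2) (h : IsSol α η₀ c₀ b₀ F₀ P₀) (hη₀ : 0 ≤ η₀)
    (hy : η₀ * b₀ ^ 2 ≤ 1) {z₀ d : ℝ} (hz : z₀ ∈ Ioo 0 b₀) (hFz : F₀ z₀ = π / 2) (hd : 0 < d) :
    ∃ δ > 0, ∀ c η b F P, |c - c₀| < δ → |η - η₀| < δ → 0 ≤ η → b₀ ≤ b → IsSol α η c b F P →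
      ∃ z ∈ Ioo 0 b₀, |z - z₀| < d ∧ F z = π / 2 := by
  have hP := h.P_ne_zero h0 h1 hη₀ hy hz hFz
  have hy0 := one_sub_pos_of_lt hη₀ hy hz
  set D := vF α η₀ z₀ (F₀ z₀) (P₀ z₀) with hDdef
  have hD : D ≠ 0 := fun hD => hP (vF_eq_zero h0 h1 hz.1.ne' hy0.le hD)
  have hs : ∀ᶠ t in 𝓝[≠] z₀, 0 < D * (F₀ t - π / 2) * (t - z₀) := by
    have h2 := (hasDerivAt_iff_tendsto_slope.1 (h.hF z₀ hz)).const_mul D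
    have h3 : 0 < D * D := mul_self_pos.2 hD
    filter_upwards [h2.eventually (lt_mem_nhds h3), self_mem_nhdsWithin] with t ht hne
    have hne : t - z₀ ≠ 0 := sub_ne_zero.2 hne
    rw [slope_def_field, hFz] at ht
    have : D * (F₀ t - π / 2) * (t - z₀) = D * ((F₀ t - π / 2) / (t - z₀)) * (t - z₀) ^ 2 := by field_simp
    rw [this]
    positivity
  rw [eventually_nhdsWithin_iff, Metric.eventually_nhds_iff] at hs
  obtain ⟨e, he, H⟩ := hs
  have hm : 0 < min (min e d) (min z₀ (b₀ - z₀)) :=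
    lt_min (lt_min he hd) (lt_min hz.1 (by linarith [hz.2]))
  obtain ⟨e', he', hlt⟩ := exists_between hm
  simp only [lt_min_iff] at hlt
  obtain ⟨⟨he1, he2⟩, he3, he4⟩ := hlt
  have Hl : D * (F₀ (z₀ - e') - π / 2) < 0 := by
    have := H (y := z₀ - e') (by rw [Real.dist_eq]; simpa [abs_of_pos he'] using he1)
      (by simpa using he'.ne')
    nlinarith
  have Hr : 0 < D * (F₀ (z₀ + e') - π / 2) := by
    have := H (y := z₀ + e') (by rw [Real.dist_eq]; simpa [abs_of_pos he'] using he1)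
      (by simpa using he'.ne')
    nlinarith
  have hD' : 0 < |D| := abs_pos.2 hD
  have hε : 0 < min (-(D * (F₀ (z₀ - e') - π / 2)) / |D|) (D * (F₀ (z₀ + e') - π / 2) / |D|) := by
    have := neg_pos.2 Hl
    refine lt_min ?_ ?_ <;> positivity
  have hr : 0 < z₀ + e' := by linarith [hz.1]
  obtain ⟨δ, hδ, S⟩ := h.stable h0 h1 hη₀ hr (by linarith)
    (by linarith [one_sub_pos_of_lt hη₀ hy ⟨hr, by linarith⟩]) hε
  refine ⟨δ, hδ, fun c η b F P hc hη hη0 hb hS => ?_⟩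
  have S' := S c η b F P hc hη hη0 (by linarith) hS
  have hl := (S' (z₀ - e') ⟨by linarith, by linarith⟩).1.trans_le (min_le_left _ _)
  have hr := (S' (z₀ + e') ⟨by linarith, by linarith⟩).1.trans_le (min_le_right _ _)
  rw [lt_div_iff₀ hD', ← abs_mul, abs_lt] at hl hr
  have hcont : ContinuousOn (fun t => D * (F t - π / 2)) (Icc (z₀ - e') (z₀ + e')) := fun t ht =>
    (((hS.hF t ⟨by linarith [ht.1], by linarith [ht.2]⟩).continuousAt.sub continuousAt_const).const_mul
      D).continuousWithinAt
  obtain ⟨z, hz1, hz2⟩ := intermediate_value_Ioo (by linarith) hcont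
    (show (0:ℝ) ∈ Ioo _ _ from ⟨by linarith, by linarith⟩)
  refine ⟨z, ⟨by linarith [hz1.1], by linarith [hz1.2]⟩, ?_, ?_⟩
  · rw [abs_lt]; constructor <;> linarith [hz1.1, hz1.2]
  · have := (mul_eq_zero.1 hz2).resolve_left hD
    linarith

theorem IsSol.zeros_persist (h0 : 0 ≤ α) (h1 : α < 1 / 2) (h : IsSol α η₀ c₀ b₀ F₀ P₀) (hη₀ : 0 ≤ η₀)
    (hy : η₀ * b₀ ^ 2 ≤ 1) {k : ℕ} {z₀ : Fin k → ℝ} (hm : StrictMono z₀) (hz : ∀ i, z₀ i ∈ Ioo 0 b₀)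
    (hFz : ∀ i, F₀ (z₀ i) = π / 2) :
    ∃ δ > 0, ∀ c η b F P, |c - c₀| < δ → |η - η₀| < δ → 0 ≤ η → b₀ ≤ b → IsSol α η c b F P →
      ∃ z : Fin k → ℝ, StrictMono z ∧ ∀ i, z i ∈ Ioo 0 b₀ ∧ F (z i) = π / 2 := by
  have hd : ∀ᶠ d in 𝓝[>] (0:ℝ), ∀ i j, i < j → 2 * d < z₀ j - z₀ i := by
    refine eventually_all.2 fun i => eventually_all.2 fun j => ?_
    by_cases hij : i < j
    · have : 0 < (z₀ j - z₀ i) / 2 := by linarith [hm hij]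
      filter_upwards [Ioo_mem_nhdsGT this] with d hd _
      linarith [hd.2]
    · exact Eventually.of_forall fun d hd => absurd hd hij
  obtain ⟨d, hd, hd0⟩ := (hd.and self_mem_nhdsWithin).exists
  choose δ hδ H using fun i => h.zero_persists h0 h1 hη₀ hy (hz i) (hFz i) hd0
  have hδ' : ∀ᶠ e in 𝓝[>] (0:ℝ), ∀ i, e < δ i := by
    refine eventually_all.2 fun i => ?_
    filter_upwards [Ioo_mem_nhdsGT (hδ i)] with e he using he.2
  obtain ⟨e, he, he0⟩ := (hδ'.and self_mem_nhdsWithin).exists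
  refine ⟨e, he0, fun c η b F P hc hη hη0 hb hS => ?_⟩
  choose z hzm hzd hzF using fun i => H i c η b F P (hc.trans (he i)) (hη.trans (he i)) hη0 hb hS
  refine ⟨z, fun i j hij => ?_, fun i => ⟨hzm i, hzF i⟩⟩
  have := hd i j hij
  have h2 := abs_lt.1 (hzd i)
  have h3 := abs_lt.1 (hzd j)
  linarith [h2.1, h2.2, h3.1, h3.2]

end Persistence

section Oscillation

theorem false_of_log_growth {M c K : ℝ} {q q' : ℝ → ℝ} (hM : 0 < M) (hc : 0 < c)
    (hq : ∀ ξ > M, HasDerivAt q (q' ξ) ξ) (hq' : ∀ ξ > M, c ≤ ξ * q' ξ) (hK : ∀ ξ > M, |q ξ| ≤ K) :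
    False := by
  have hmono : MonotoneOn (fun ξ => q ξ - c * log ξ) (Ioi M) := by
    have hd : ∀ ξ ∈ Ioi M, HasDerivAt (fun ξ => q ξ - c * log ξ) (q' ξ - c * ξ⁻¹) ξ := fun ξ hξ =>
      (hq ξ hξ).sub ((Real.hasDerivAt_log (hM.trans hξ).ne').const_mul c)
    refine monotoneOn_of_deriv_nonneg (convex_Ioi M) (fun ξ hξ => (hd ξ hξ).continuousAt.continuousWithinAt)
      (fun ξ hξ => ?_) (fun ξ hξ => ?_)
    · rw [interior_Ioi] at hξ
      exact (hd ξ hξ).differentiableAt.differentiableWithinAt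
    · rw [interior_Ioi] at hξ
      rw [(hd ξ hξ).deriv]
      have h1 : 0 < ξ := hM.trans hξ
      have h2 := hq' ξ hξ
      have : c * ξ⁻¹ ≤ q' ξ := by
        rw [← div_eq_mul_inv, div_le_iff₀ h1]; linarith
      linarith
  have ht : Tendsto (fun ξ => c * log ξ) atTop atTop := tendsto_log_atTop.const_mul_atTop hc
  obtain ⟨ξ, h2, h3⟩ := ((ht.eventually_gt_atTop (2 * K + c * log (M + 1))).and
    (eventually_ge_atTop (M + 1))).exists
  have h4 := hmono (show M < M + 1 by linarith) (show M < ξ by linarith) h3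
  have h5 := abs_le.1 (hK (M + 1) (by linarith))
  have h6 := abs_le.1 (hK ξ (by linarith))
  simp only at h4
  linarith [h5.1, h6.2]

/-- The scale invariant system has no solution staying below `π / 2` and away from `0`. -/
theorem false_of_lt_pi_div_two {α M δ : ℝ} {F N : ℝ → ℝ} (h0 : 0 ≤ α) (h1 : α < 1 / 2) (hM : 0 < M)
    (hδ : 0 < δ) (hF : ∀ ξ > M, HasDerivAt F (N ξ / (ξ * Rf α 1 (F ξ) (N ξ))) ξ)
    (hN : ∀ ξ > M, HasDerivAt N
      ((sin (2 * F ξ) * Af α 1 (F ξ) (N ξ) / Rf α 1 (F ξ) (N ξ) - N ξ) / ξ) ξ)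
    (hF0 : ∀ ξ > M, 0 < F ξ) (hF1 : ∀ ξ > M, F ξ < π / 2) (hs : ∀ ξ > M, δ ≤ sin (F ξ))
    (hA : ∀ ξ > M, Af α 1 (F ξ) (N ξ) ≤ 1) (hN2 : ∀ ξ > M, |N ξ| ≤ 2) : False := by
  have hκ : 0 < 1 - 2 * α := by linarith
  have hpos : ∀ ξ, ξ > M → 0 < ξ := fun ξ hξ => hM.trans hξ
  have hR0 : ∀ ξ, 0 < Rf α 1 (F ξ) (N ξ) := fun ξ => Rf_pos h0 h1 zero_le_one
  have hRA : ∀ ξ, Rf α 1 (F ξ) (N ξ) ≤ 2 * Af α 1 (F ξ) (N ξ) := fun ξ => by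
    have := qf_pos (F := F ξ) h0 h1
    rw [Rf_eq]; linarith
  have hR2 : ∀ ξ > M, Rf α 1 (F ξ) (N ξ) ≤ 2 := fun ξ hξ => by linarith [hRA ξ, hA ξ hξ]
  have hRκ : ∀ ξ, 1 - 2 * α ≤ Rf α 1 (F ξ) (N ξ) := fun ξ => Rf_ge h0 zero_le_one
  have hAR : ∀ ξ, 1 / 2 ≤ Af α 1 (F ξ) (N ξ) / Rf α 1 (F ξ) (N ξ) := fun ξ => by
    rw [le_div_iff₀ (hR0 ξ)]; linarith [hRA ξ]
  have hsin : ∀ ξ > M, ∀ x, x ≤ cos (F ξ) → 0 ≤ x →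
      δ * x ≤ sin (2 * F ξ) * Af α 1 (F ξ) (N ξ) / Rf α 1 (F ξ) (N ξ) := by
    intro ξ hξ x hx hx0
    have h2 : 2 * (δ * x) ≤ sin (2 * F ξ) := by
      rw [sin_two_mul]
      have := mul_le_mul (hs ξ hξ) hx hx0 (hδ.le.trans (hs ξ hξ))
      linarith
    rw [mul_div_assoc]
    have := mul_le_mul h2 (hAR ξ) (by norm_num) ((by positivity : 0 ≤ 2 * (δ * x)).trans h2)
    linarith
  have hP : MonotoneOn (fun ξ => ξ * N ξ) (Ioi M) := by
    have hd : ∀ ξ ∈ Ioi M, HasDerivAt (fun ξ => ξ * N ξ)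
        (sin (2 * F ξ) * Af α 1 (F ξ) (N ξ) / Rf α 1 (F ξ) (N ξ)) ξ := fun ξ hξ => by
      refine ((hasDerivAt_id ξ).mul (hN ξ hξ)).congr_deriv ?_
      have := (hpos ξ hξ).ne'
      simp only [id]
      rw [mul_div_cancel₀ _ this]; ring
    refine monotoneOn_of_deriv_nonneg (convex_Ioi M) (fun ξ hξ => (hd ξ hξ).continuousAt.continuousWithinAt)
      (fun ξ hξ => ?_) (fun ξ hξ => ?_)
    · rw [interior_Ioi] at hξ
      exact (hd ξ hξ).differentiableAt.differentiableWithinAt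
    · rw [interior_Ioi] at hξ
      rw [(hd ξ hξ).deriv]
      have := hsin ξ hξ 0 (cos_nonneg_of_mem_Icc ⟨by linarith [hF0 ξ hξ, pi_pos], (hF1 ξ hξ).le⟩) le_rfl
      linarith
  have hFcont : ∀ {a}, M < a → ContinuousOn F (Ici a) := fun ha ξ hξ =>
    (hF ξ (ha.trans_le hξ)).continuousAt.continuousWithinAt
  have hQ : ∀ k, ∀ ξ > M, HasDerivAt (fun ξ => N ξ + k * F ξ)
      ((sin (2 * F ξ) * Af α 1 (F ξ) (N ξ) / Rf α 1 (F ξ) (N ξ) + N ξ * (k / Rf α 1 (F ξ) (N ξ) - 1)) / ξ) ξ := by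
    intro k ξ hξ
    refine ((hN ξ hξ).add ((hF ξ hξ).const_mul k)).congr_deriv ?_
    have := (hpos ξ hξ).ne'
    have := (hR0 ξ).ne'
    field_simp
    ring
  have hQb : ∀ k, 0 ≤ k → k ≤ 2 → ∀ ξ > M, |N ξ + k * F ξ| ≤ 6 := by
    intro k hk hk2 ξ hξ
    have h2 := abs_le.1 (hN2 ξ hξ)
    have h3 : F ξ ≤ 2 := by linarith [hF1 ξ hξ, pi_lt_d2]
    have h4 := hF0 ξ hξ
    have h5 : k * F ξ ≤ 2 * 2 := mul_le_mul hk2 h3 h4.le (by norm_num)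
    have h6 : 0 ≤ k * F ξ := mul_nonneg hk h4.le
    rw [abs_le]; constructor <;> linarith [h2.1, h2.2]
  -- the momentum becomes positive
  obtain ⟨M₁, hM₁, hNM₁⟩ : ∃ M₁ > M, 0 < N M₁ := by
    by_contra! hcon
    have hanti : AntitoneOn F (Ici (M + 1)) := by
      refine antitoneOn_of_deriv_nonpos (convex_Ici _) (hFcont (by linarith)) (fun ξ hξ => ?_) (fun ξ hξ => ?_)
      · rw [interior_Ici] at hξ
        exact (hF ξ (by linarith [mem_Ioi.1 hξ])).differentiableAt.differentiableWithinAt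
      · rw [interior_Ici] at hξ
        have hξ' : ξ > M := by linarith [mem_Ioi.1 hξ]
        rw [(hF ξ hξ').deriv]
        exact div_nonpos_of_nonpos_of_nonneg (hcon ξ hξ') (mul_pos (hpos ξ hξ') (hR0 ξ)).le
    have hM1 : M < M + 1 := by linarith
    have hcos : 0 < cos (F (M + 1)) := cos_pos_of_mem_Ioo ⟨by linarith [hF0 _ hM1, pi_pos], hF1 _ hM1⟩
    refine false_of_log_growth (M := M + 1) (c := δ * cos (F (M + 1))) (K := 6) (by linarith) (by positivity)
      (fun ξ hξ => hQ (1 - 2 * α) ξ (by linarith)) (fun ξ hξ => ?_)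
      (fun ξ hξ => hQb _ hκ.le (by linarith) ξ (by linarith))
    have hξ' : ξ > M := by linarith
    rw [mul_div_cancel₀ _ (hpos ξ hξ').ne']
    have h2 := hsin ξ hξ' (cos (F (M + 1))) (cos_le_cos_of_nonneg_of_le_pi (hF0 ξ hξ').le
      (by linarith [hF1 _ hM1, pi_pos]) (hanti (show M + 1 ≤ M + 1 from le_rfl) (show M + 1 ≤ ξ from hξ.le) hξ.le)) hcos.le
    have h3 : (1 - 2 * α) / Rf α 1 (F ξ) (N ξ) - 1 ≤ 0 := by
      rw [sub_nonpos, div_le_one (hR0 ξ)]; exact hRκ ξ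
    nlinarith [mul_nonneg_of_nonpos_of_nonpos (hcon ξ hξ') h3]
  have hNpos : ∀ ξ ≥ M₁, 0 < N ξ := fun ξ hξ => by
    have hξ' : M < ξ := hM₁.trans_le hξ
    have := hP hM₁ hξ' hξ
    simp only at this
    exact (pos_iff_pos_of_mul_pos ((mul_pos (hpos _ hM₁) hNM₁).trans_le this)).1 (hpos _ hξ')
  have hmonoF : MonotoneOn F (Ici M₁) := by
    refine monotoneOn_of_deriv_nonneg (convex_Ici _) (hFcont hM₁) (fun ξ hξ => ?_) (fun ξ hξ => ?_)
    · rw [interior_Ici] at hξ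
      exact (hF ξ (hM₁.trans hξ)).differentiableAt.differentiableWithinAt
    · rw [interior_Ici] at hξ
      rw [(hF ξ (hM₁.trans hξ)).deriv]
      exact div_nonneg (hNpos ξ (le_of_lt hξ)).le (mul_pos (hpos ξ (hM₁.trans hξ)) (hR0 ξ)).le
  -- the profile exceeds `π / 4`
  obtain ⟨M₂, hM₂, hFM₂⟩ : ∃ M₂ > M₁, π / 4 ≤ F M₂ := by
    by_contra! hcon
    refine false_of_log_growth (M := M₁) (c := δ * (1 / 2)) (K := 6) (hM.trans hM₁) (by positivity)
      (fun ξ hξ => hQ 2 ξ (hM₁.trans hξ)) (fun ξ hξ => ?_)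
      (fun ξ hξ => hQb _ zero_le_two le_rfl ξ (hM₁.trans hξ))
    have hξ' : ξ > M := hM₁.trans hξ
    rw [mul_div_cancel₀ _ (hpos ξ hξ').ne']
    have hc : 1 / 2 ≤ cos (F ξ) := by
      rw [← cos_pi_div_three]
      exact cos_le_cos_of_nonneg_of_le_pi (hF0 ξ hξ').le (by linarith [pi_pos]) (by linarith [hcon ξ hξ, pi_pos])
    have h2 := hsin ξ hξ' (1 / 2) hc (by norm_num)
    have h3 : 0 ≤ 2 / Rf α 1 (F ξ) (N ξ) - 1 := by
      rw [sub_nonneg, one_le_div (hR0 ξ)]; exact hR2 ξ hξ'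
    nlinarith [mul_nonneg (hNpos ξ (le_of_lt hξ)).le h3]
  have hM₂' : M < M₂ := hM₁.trans hM₂
  refine false_of_log_growth (M := M₂) (c := (1 - 2 * α) / 30) (K := π) (q := fun ξ => arctan (N ξ / (π / 2 - F ξ)))
    (hM.trans hM₂') (by positivity) (fun ξ hξ => ?_) (fun ξ hξ => ?_)
    (q' := fun ξ => 1 / (1 + (N ξ / (π / 2 - F ξ)) ^ 2) *
      ((sin (2 * F ξ) / (π / 2 - F ξ) * Af α 1 (F ξ) (N ξ) - Rf α 1 (F ξ) (N ξ) * (N ξ / (π / 2 - F ξ))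
        + (N ξ / (π / 2 - F ξ)) ^ 2) / (Rf α 1 (F ξ) (N ξ) * ξ))) (fun ξ hξ => ?_)
  · have hξ' : ξ > M := hM₂'.trans hξ
    have hG : π / 2 - F ξ ≠ 0 := by linarith [hF1 ξ hξ']
    refine HasDerivAt.arctan (((hN ξ hξ').div ((hF ξ hξ').const_sub (π / 2)) hG).congr_deriv ?_)
    have := (hpos ξ hξ').ne'
    have := (hR0 ξ).ne'
    field_simp
    ring
  · have hξ' : ξ > M := hM₂'.trans hξ
    have hG : 0 < π / 2 - F ξ := by linarith [hF1 ξ hξ']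
    have hG4 : π / 2 - F ξ ≤ π / 4 := by
      linarith [hmonoF (le_of_lt hM₂) (le_of_lt (hM₂.trans hξ)) (le_of_lt hξ)]
    have hs2 : 6 / 5 ≤ sin (2 * F ξ) / (π / 2 - F ξ) := by
      rw [le_div_iff₀ hG]
      have e : sin (2 * F ξ) = sin (2 * (π / 2 - F ξ)) := by
        rw [show 2 * (π / 2 - F ξ) = π - 2 * F ξ by ring, sin_pi_sub]
      have := Real.mul_le_sin (x := 2 * (π / 2 - F ξ)) (by linarith) (by linarith)
      rw [e]
      refine le_trans ?_ this
      have h3 : 3 / 5 ≤ 2 / π := by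
        rw [le_div_iff₀ pi_pos]; linarith [pi_lt_d2]
      nlinarith
    set s := sin (2 * F ξ) / (π / 2 - F ξ)
    set r := N ξ / (π / 2 - F ξ)
    set A := Af α 1 (F ξ) (N ξ) with hAdef
    set R := Rf α 1 (F ξ) (N ξ) with hRdef
    have hAκ : 1 - 2 * α ≤ A := (qf_ge h0).trans (qf_le_Af h0 zero_le_one)
    have hA1 : A ≤ 1 := hA ξ hξ'
    have hRA' : R ≤ 2 * A := hRA ξ
    have hRp : 0 < R := hR0 ξ
    have hξ0 := hpos ξ hξ'
    have e : ξ * (1 / (1 + r ^ 2) * ((s * A - R * r + r ^ 2) / (R * ξ))) =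
        (s * A - R * r + r ^ 2) / (R * (1 + r ^ 2)) := by
      field_simp
    rw [e, le_div_iff₀ (by positivity)]
    have h2 : R ^ 2 ≤ 4 * A := by nlinarith
    have h3 : (r - R / 2) ^ 2 + (1 - 2 * α) / 5 ≤ s * A - R * r + r ^ 2 := by nlinarith
    have h4 : r ^ 2 ≤ 2 * (r - R / 2) ^ 2 + 2 := by nlinarith [sq_nonneg (r - R)]
    have h5 : R * (1 + r ^ 2) ≤ 2 * (3 + 2 * (r - R / 2) ^ 2) :=
      mul_le_mul (by linarith) (by linarith) (by positivity) (by norm_num)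
    have h6 : (1 - 2 * α) / 30 * (R * (1 + r ^ 2)) ≤ (1 - 2 * α) / 30 * (2 * (3 + 2 * (r - R / 2) ^ 2)) := by
      gcongr
    nlinarith [sq_nonneg (r - R / 2)]
  · rw [abs_le]
    constructor
    · linarith [neg_pi_div_two_lt_arctan (N ξ / (π / 2 - F ξ)), pi_pos]
    · linarith [arctan_lt_pi_div_two (N ξ / (π / 2 - F ξ)), pi_pos]

end Oscillation

section ManyZeros

variable {α η c b : ℝ} {F P : ℝ → ℝ}

theorem IsSol.mem_Ioo_pi (h0 : 0 ≤ α) (h1 : α < 1 / 2) (h : IsSol α η c b F P) (hη : 0 ≤ η)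
    (hy : η * b ^ 2 ≤ 1) (hc : 0 < c) {ξ : ℝ} (hξ : ξ ∈ Ioo 0 b) : F ξ ∈ Ioo 0 π := by
  have hsin : ∀ s ∈ Ioo 0 b, sin (F s) ≠ 0 := fun s hs h0' => by
    have he := h.energy_pos h0 h1 hη hy hc.ne' hs
    unfold energy at he
    have hy' := one_sub_pos_of_lt hη hy hs
    have hA := Af_pos (F := F s) (N := P s / s) h0 h1 hy'.le
    have : 0 ≤ (1 - η * s ^ 2) * (P s / s) ^ 2 / Af α (1 - η * s ^ 2) (F s) (P s / s) := by positivity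
    rw [h0'] at he
    linarith
  have e1 : ∀ᶠ s in 𝓝[>] 0, 0 < F s := by
    filter_upwards [h.f0.eventually (lt_mem_nhds hc), self_mem_nhdsWithin] with s hs hs0
    have : F s = F s / s * s := by rw [div_mul_cancel₀ _ (ne_of_gt hs0)]
    rw [this]
    exact mul_pos hs hs0
  obtain ⟨s, ⟨hs1, hs2⟩, hs3⟩ := ((e1.and (h.tendsto_F.eventually (gt_mem_nhds pi_pos))).and
    (Ioo_mem_nhdsGT hξ.1)).exists
  have hsub : Icc s ξ ⊆ Ioo 0 b := fun t ht => ⟨hs3.1.trans_le ht.1, ht.2.trans_lt hξ.2⟩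
  have hcont : ContinuousOn F (Icc s ξ) := fun t ht =>
    (h.hF t (hsub ht)).continuousAt.continuousWithinAt
  constructor
  · by_contra! hcon
    obtain ⟨t, ht, ht0⟩ := intermediate_value_Icc' hs3.2.le hcont ⟨hcon, hs1.le⟩
    exact hsin t (hsub ht) (by rw [ht0, sin_zero])
  · by_contra! hcon
    obtain ⟨t, ht, ht0⟩ := intermediate_value_Icc hs3.2.le hcont ⟨hs2.le, hcon⟩
    exact hsin t (hsub ht) (by rw [ht0, sin_pi])

theorem exists_zero_gt (h0 : 0 ≤ α) (h1 : α < 1 / 2) (H : ∀ b, 0 < b → IsSol α 0 1 b F P) {M : ℝ}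
    (hM : 0 < M) : ∃ z > M, F z = π / 2 := by
  by_contra! hcon
  have hb : ∀ ξ : ℝ, 0 < ξ → ξ ∈ Ioo 0 (ξ + 1) := fun ξ hξ => ⟨hξ, by linarith⟩
  have hpos : ∀ ξ, ξ > M → 0 < ξ := fun ξ hξ => hM.trans hξ
  have hF : ∀ ξ, 0 < ξ → HasDerivAt F (vF α 0 ξ (F ξ) (P ξ)) ξ := fun ξ hξ =>
    (H (ξ + 1) (by linarith)).hF ξ (hb ξ hξ)
  have hP : ∀ ξ, 0 < ξ → HasDerivAt P (vP α 0 ξ (F ξ) (P ξ)) ξ := fun ξ hξ =>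
    (H (ξ + 1) (by linarith)).hP ξ (hb ξ hξ)
  have hFπ : ∀ ξ, 0 < ξ → F ξ ∈ Ioo 0 π := fun ξ hξ =>
    (H (ξ + 1) (by linarith)).mem_Ioo_pi h0 h1 le_rfl (by simp) one_pos (hb ξ hξ)
  have hF' : ∀ ξ > M, HasDerivAt F (P ξ / ξ / (ξ * Rf α 1 (F ξ) (P ξ / ξ))) ξ := fun ξ hξ => by
    have := hF ξ (hpos ξ hξ)
    rwa [vF_eq, zero_mul, sub_zero] at this
  have hN' : ∀ ξ > M, HasDerivAt (fun ξ => P ξ / ξ)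
      ((sin (2 * F ξ) * Af α 1 (F ξ) (P ξ / ξ) / Rf α 1 (F ξ) (P ξ / ξ) - P ξ / ξ) / ξ) ξ := fun ξ hξ => by
    have hξ0 := (hpos ξ hξ).ne'
    refine ((hP ξ (hpos ξ hξ)).div (hasDerivAt_id ξ) hξ0).congr_deriv ?_
    simp only [id, vP, zero_mul, sub_zero, mul_one]
    field_simp
  have hA : ∀ ξ > M, Af α 1 (F ξ) (P ξ / ξ) ≤ 1 := fun ξ hξ => by
    have := (H (ξ + 1) (by linarith [hpos ξ hξ])).Af_le_one h0 h1 le_rfl (by simp) (hb ξ (hpos ξ hξ))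
    rwa [zero_mul, sub_zero] at this
  have hN2 : ∀ ξ > M, |P ξ / ξ| ≤ 2 := fun ξ hξ => by
    have := (H (ξ + 1) (by linarith [hpos ξ hξ])).yN_le h0 h1 le_rfl (by simp) (hb ξ (hpos ξ hξ))
    rw [zero_mul, sub_zero, one_mul] at this
    refine abs_le_of_sq_le_sq ?_ zero_le_two
    linarith [sin_sq_le_one (F ξ)]
  set e := energy α 0 F P M with he
  have he0 : 0 < e := (H (M + 1) (by linarith)).energy_pos h0 h1 le_rfl (by simp) one_ne_zero (hb M hM)
  have hs : ∀ ξ > M, √(e / 2) ≤ sin (F ξ) := fun ξ hξ => by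
    have hξ0 := hpos ξ hξ
    refine Real.sqrt_le_iff.2 ⟨(sin_pos_of_mem_Ioo (hFπ ξ hξ0)).le, ?_⟩
    have := (H (ξ + 1) (by linarith)).energy_monotoneOn h0 h1 le_rfl (by simp) (a := M)
      ⟨hM, by linarith⟩ (hb ξ hξ0) (le_of_lt hξ)
    rw [← he] at this
    unfold energy at this
    rw [zero_mul, sub_zero, one_mul] at this
    have hA0 := Af_pos (F := F ξ) (N := P ξ / ξ) h0 h1 zero_le_one
    have : 0 ≤ (P ξ / ξ) ^ 2 / Af α 1 (F ξ) (P ξ / ξ) := by positivity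
    linarith
  have hδ : 0 < √(e / 2) := Real.sqrt_pos.2 (by linarith)
  have hcont : ∀ a b, M < a → ContinuousOn F (Icc a b) := fun a b ha t ht =>
    (hF t (by linarith [ht.1])).continuousAt.continuousWithinAt
  have hM1 : M < M + 1 := by linarith
  rcases lt_or_gt_of_ne (hcon (M + 1) hM1) with hlt | hgt
  · refine false_of_lt_pi_div_two (M := M + 1) h0 h1 (by linarith) hδ (fun ξ hξ => hF' ξ (hM1.trans hξ))
      (fun ξ hξ => hN' ξ (hM1.trans hξ)) (fun ξ hξ => (hFπ ξ (hpos ξ (hM1.trans hξ))).1) (fun ξ hξ => ?_)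
      (fun ξ hξ => hs ξ (hM1.trans hξ)) (fun ξ hξ => hA ξ (hM1.trans hξ)) (fun ξ hξ => hN2 ξ (hM1.trans hξ))
    by_contra! hcon'
    obtain ⟨t, ht, ht0⟩ := intermediate_value_Icc (le_of_lt hξ) (hcont (M + 1) ξ hM1) ⟨hlt.le, hcon'⟩
    exact hcon t (hM1.trans_le ht.1) ht0
  · have hq : ∀ ξ, qf α (π - F ξ) = qf α (F ξ) := fun ξ => by simp [qf]
    have hR : ∀ ξ, Rf α 1 (π - F ξ) (-(P ξ / ξ)) = Rf α 1 (F ξ) (P ξ / ξ) := fun ξ => by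
      unfold Rf; rw [hq, neg_sq]
    have hA' : ∀ ξ, Af α 1 (π - F ξ) (-(P ξ / ξ)) = Af α 1 (F ξ) (P ξ / ξ) := fun ξ => by
      unfold Af; rw [hq, hR]
    refine false_of_lt_pi_div_two (M := M + 1) (F := fun ξ => π - F ξ) (N := fun ξ => -(P ξ / ξ)) h0 h1
      (by linarith) hδ (fun ξ hξ => ?_) (fun ξ hξ => ?_)
      (fun ξ hξ => by linarith [(hFπ ξ (hpos ξ (hM1.trans hξ))).2]) (fun ξ hξ => ?_)
      (fun ξ hξ => by simpa using hs ξ (hM1.trans hξ)) (fun ξ hξ => by simpa only [hA'] using hA ξ (hM1.trans hξ))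
      (fun ξ hξ => by simpa only [abs_neg] using hN2 ξ (hM1.trans hξ))
    · refine ((hF' ξ (hM1.trans hξ)).const_sub π).congr_deriv ?_
      rw [hR, neg_div]
    · refine (hN' ξ (hM1.trans hξ)).neg.congr_deriv ?_
      rw [hR, hA', mul_sub, show 2 * π - 2 * F ξ = -(2 * F ξ) + 2 * π by ring, sin_add_two_pi, sin_neg]
      ring
    · by_contra! hcon'
      obtain ⟨t, ht, ht0⟩ := intermediate_value_Icc' (le_of_lt hξ) (hcont (M + 1) ξ hM1)
        ⟨by linarith, hgt.le⟩
      exact hcon t (hM1.trans_le ht.1) ht0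

theorem IsSol.rescale (h : IsSol α 1 c 1 F P) (hc : 0 < c) :
    IsSol α (c⁻¹ ^ 2) 1 c (fun ξ => F (c⁻¹ * ξ)) (fun ξ => c * P (c⁻¹ * ξ)) := by
  have hmem : ∀ ξ ∈ Ioo 0 c, c⁻¹ * ξ ∈ Ioo (0:ℝ) 1 := fun ξ hξ =>
    ⟨mul_pos (inv_pos.2 hc) hξ.1, by rw [inv_mul_lt_iff₀ hc]; linarith [hξ.2]⟩
  have hid : ∀ ξ : ℝ, HasDerivAt (fun ξ => c⁻¹ * ξ) c⁻¹ ξ := fun ξ => by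
    simpa using (hasDerivAt_id ξ).const_mul c⁻¹
  have e1 : ∀ ξ, c * P (c⁻¹ * ξ) / ξ = P (c⁻¹ * ξ) / (c⁻¹ * ξ) := fun ξ => by field_simp
  have e2 : ∀ ξ : ℝ, c⁻¹ ^ 2 * ξ ^ 2 = 1 * (c⁻¹ * ξ) ^ 2 := fun ξ => by ring
  have ht : Tendsto (fun ξ => c⁻¹ * ξ) (𝓝[>] 0) (𝓝[>] 0) := by
    refine tendsto_nhdsWithin_iff.2 ⟨?_, ?_⟩
    · have := (hid 0).continuousAt.tendsto
      rw [mul_zero] at this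
      exact this.mono_left nhdsWithin_le_nhds
    · filter_upwards [self_mem_nhdsWithin] with ξ hξ using mul_pos (inv_pos.2 hc) hξ
  refine ⟨fun ξ hξ => ?_, fun ξ hξ => ?_, ?_, ?_⟩
  · refine ((h.hF _ (hmem ξ hξ)).comp ξ (hid ξ)).congr_deriv ?_
    rw [vF_eq, vF_eq, e1, e2]
    field_simp
  · refine (((h.hP _ (hmem ξ hξ)).comp ξ (hid ξ)).const_mul c).congr_deriv ?_
    unfold vP
    rw [e1, e2]
    field_simp
  · have := (h.f0.comp ht).const_mul c⁻¹
    rw [inv_mul_cancel₀ hc.ne'] at this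
    refine this.congr fun ξ => ?_
    simp only [Function.comp]
    field_simp
  · have := (h.n0.comp ht).const_mul c⁻¹
    rw [inv_mul_cancel₀ hc.ne'] at this
    refine this.congr fun ξ => ?_
    simp only [Function.comp]
    field_simp

theorem exists_many_zeros (h0 : 0 ≤ α) (h1 : α < 1 / 2) (k : ℕ) :
    ∃ c > 0, ∃ F P, IsSol α 1 c 1 F P ∧ ∃ z : Fin k → ℝ, StrictMono z ∧ ∀ i, z i ∈ Ioo 0 1 ∧ F (z i) = π / 2 := by
  obtain ⟨F₀, P₀, H⟩ := exists_isSol_global h0 h1 1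
  choose! g hg hg' using fun (M : ℝ) (hM : 0 < M) => exists_zero_gt h0 h1 H hM
  let s : ℕ → ℝ := fun i => Nat.rec (g 1) (fun _ x => g x) i
  have hs0 : ∀ i, 0 < s i ∧ F₀ (s i) = π / 2 := by
    intro i
    induction i with
    | zero => exact ⟨one_pos.trans (hg 1 one_pos), hg' 1 one_pos⟩
    | succ i ih => exact ⟨ih.1.trans (hg _ ih.1), hg' _ ih.1⟩
  have hsm : StrictMono s := strictMono_nat_of_lt_succ fun i => hg _ (hs0 i).1
  have hb : 0 < s k := (hs0 k).1
  obtain ⟨δ, hδ, K⟩ := (H (s k) hb).zeros_persist h0 h1 le_rfl (by simp) (z₀ := fun i : Fin k => s i)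
    (fun i j hij => hsm hij) (fun i => ⟨(hs0 i).1, hsm i.2⟩) (fun i => (hs0 i).2)
  have ht : Tendsto (fun c : ℝ => c⁻¹ ^ 2) atTop (𝓝 0) := by
    simpa using tendsto_inv_atTop_zero.pow 2 (α := ℝ)
  obtain ⟨c, hc1, hc2⟩ := ((ht.eventually (gt_mem_nhds hδ)).and (eventually_ge_atTop (s k))).exists
  have hc : 0 < c := hb.trans_le hc2
  obtain ⟨F, P, hFP⟩ := exists_isSol_one h0 h1 c
  obtain ⟨z, hz, hz'⟩ := K 1 (c⁻¹ ^ 2) c _ _ (by simpa using hδ)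
    (by rw [sub_zero, abs_of_nonneg (by positivity)]; exact hc1) (by positivity) hc2 (hFP.rescale hc)
  refine ⟨c, hc, F, P, hFP, fun i => c⁻¹ * z i, fun i j hij => ?_, fun i => ⟨⟨?_, ?_⟩, (hz' i).2⟩⟩
  · exact mul_lt_mul_of_pos_left (hz hij) (inv_pos.2 hc)
  · exact mul_pos (inv_pos.2 hc) (hz' i).1.1
  · rw [inv_mul_lt_iff₀ hc]; linarith [(hz' i).1.2]

end ManyZeros

section Shooting

variable {α : ℝ} {Fc Pc : ℝ → ℝ → ℝ} {c : ℝ} {cs zs : ℕ → ℝ} {z : ℝ}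

theorem tendsto_sub_of_stable (h0 : 0 ≤ α) (h1 : α < 1 / 2) (h : ∀ c, IsSol α 1 c 1 (Fc c) (Pc c))
    (hc : Tendsto cs atTop (𝓝 c)) (hz : Tendsto zs atTop (𝓝 z)) (hzs : ∀ j, zs j ∈ Ioo 0 1) (hz1 : z < 1) :
    Tendsto (fun j => Fc (cs j) (zs j) - Fc c (zs j)) atTop (𝓝 0) ∧
      Tendsto (fun j => Pc (cs j) (zs j) - Pc c (zs j)) atTop (𝓝 0) := by
  have hz0 : 0 ≤ z := ge_of_tendsto' hz fun j => (hzs j).1.le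
  have hr : (z + 1) / 2 < 1 := by linarith
  have key : ∀ ε > 0, ∀ᶠ j in atTop, |Fc (cs j) (zs j) - Fc c (zs j)| < ε ∧ |Pc (cs j) (zs j) - Pc c (zs j)| < ε := by
    intro ε hε
    obtain ⟨δ, hδ, H⟩ := (h c).stable h0 h1 zero_le_one (ξ₀ := (z + 1) / 2) (by linarith) hr (by nlinarith) hε
    have e1 : ∀ᶠ j in atTop, |cs j - c| < δ := by
      simpa [Real.dist_eq] using hc.eventually (Metric.ball_mem_nhds c hδ)
    filter_upwards [e1, hz.eventually (gt_mem_nhds (show z < (z + 1) / 2 by linarith))] with j hj1 hj2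
    exact H _ 1 1 _ _ hj1 (by simpa using hδ) zero_le_one hr (h (cs j)) _ ⟨(hzs j).1, hj2.le⟩
  constructor <;> rw [Metric.tendsto_nhds] <;> intro ε hε <;>
    filter_upwards [key ε hε] with j hj
  · simpa [Real.dist_eq] using hj.1
  · simpa [Real.dist_eq] using hj.2

theorem limit_zero (h0 : 0 ≤ α) (h1 : α < 1 / 2) (h : ∀ c, IsSol α 1 c 1 (Fc c) (Pc c))
    (hc : Tendsto cs atTop (𝓝 c)) (hz : Tendsto zs atTop (𝓝 z)) (hzs : ∀ j, zs j ∈ Ioo 0 1)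
    (hF : ∀ j, Fc (cs j) (zs j) = π / 2) (hz1 : z < 1) : 0 < z ∧ Fc c z = π / 2 := by
  have hz0 : 0 ≤ z := ge_of_tendsto' hz fun j => (hzs j).1.le
  have ht := (tendsto_sub_of_stable h0 h1 h hc hz hzs hz1).1
  simp only [hF] at ht
  have ht' : Tendsto (fun j => Fc c (zs j)) atTop (𝓝 (π / 2)) := by
    have := ht.const_sub (π / 2)
    simpa using this
  have hpos : 0 < z := by
    refine hz0.lt_of_ne fun he => ?_
    have h2 : Tendsto zs atTop (𝓝[>] 0) := tendsto_nhdsWithin_iff.2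
      ⟨he ▸ hz, Eventually.of_forall fun j => (hzs j).1⟩
    have := tendsto_nhds_unique ht' ((h c).tendsto_F.comp h2)
    linarith [pi_pos]
  exact ⟨hpos, tendsto_nhds_unique
    (((h c).hF z ⟨hpos, hz1⟩).continuousAt.tendsto.comp hz) ht'⟩

theorem limit_zero_one (h0 : 0 ≤ α) (h1 : α < 1 / 2) (h : ∀ c, IsSol α 1 c 1 (Fc c) (Pc c))
    (hc : Tendsto cs atTop (𝓝 c)) (hz : Tendsto zs atTop (𝓝 1)) (hzs : ∀ j, zs j ∈ Ioo 0 1)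
    (hF : ∀ j, Fc (cs j) (zs j) = π / 2) : Tendsto (Fc c) (𝓝[<] 1) (𝓝 (π / 2)) := by
  have key : ∀ s ∈ Ioo (1/2 : ℝ) 1, |π / 2 - Fc c s| ≤ 8 / (1 - 2 * α) * √(1 - s) := by
    intro s hs
    have h2 := (tendsto_sub_of_stable h0 h1 h hc (tendsto_const_nhds (x := s))
      (fun _ => ⟨by linarith [hs.1], hs.2⟩) hs.2).1
    have h3 : Tendsto (fun j => |π / 2 - Fc (cs j) s|) atTop (𝓝 |π / 2 - Fc c s|) := by
      have := (h2.const_sub (π / 2 - Fc c s)).abs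
      simpa using this
    refine le_of_tendsto h3 ?_
    filter_upwards [hz.eventually (lt_mem_nhds hs.2)] with j hj
    rw [← hF j]
    exact (h (cs j)).abs_sub_le h0 h1 hs.1.le hj.le (hzs j).2
  rw [tendsto_iff_norm_sub_tendsto_zero]
  have h2 : Tendsto (fun s => 8 / (1 - 2 * α) * √(1 - s)) (𝓝[<] 1) (𝓝 0) := by
    have : ContinuousAt (fun s : ℝ => 8 / (1 - 2 * α) * √(1 - s)) 1 := by fun_prop
    have := this.tendsto
    simp only [sub_self, Real.sqrt_zero, mul_zero] at this
    exact this.mono_left nhdsWithin_le_nhds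
  refine squeeze_zero' (Eventually.of_forall fun s => norm_nonneg _) ?_ h2
  filter_upwards [Ioo_mem_nhdsLT (show (1/2 : ℝ) < 1 by norm_num)] with s hs
  rw [Real.norm_eq_abs, abs_sub_comm]
  exact key s hs

theorem limit_zeros_ne (h0 : 0 ≤ α) (h1 : α < 1 / 2) (h : ∀ c, IsSol α 1 c 1 (Fc c) (Pc c)) {ws : ℕ → ℝ}
    (hc : Tendsto cs atTop (𝓝 c)) (hz : Tendsto zs atTop (𝓝 z)) (hzs : ∀ j, zs j ∈ Ioo 0 1)
    (hF : ∀ j, Fc (cs j) (zs j) = π / 2) (hw : Tendsto ws atTop (𝓝 z)) (hws : ∀ j, ws j ∈ Ioo 0 1)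
    (hFw : ∀ j, Fc (cs j) (ws j) = π / 2) (hlt : ∀ j, zs j < ws j) : False := by
  have hz1 : z ≤ 1 := le_of_tendsto' hz fun j => (hzs j).2.le
  rcases hz1.lt_or_eq with hz1 | rfl
  · obtain ⟨hpos, hFz⟩ := limit_zero h0 h1 h hc hz hzs hF hz1
    have hx : ∀ j, ∃ x ∈ Ioo (zs j) (ws j), Pc (cs j) x = 0 := by
      intro j
      have hsub : Icc (zs j) (ws j) ⊆ Ioo 0 1 := fun t ht =>
        ⟨(hzs j).1.trans_le ht.1, ht.2.trans_lt (hws j).2⟩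
      obtain ⟨x, hx, hx0⟩ := exists_hasDerivAt_eq_zero (f := Fc (cs j)) (hlt j)
        (fun t ht => ((h _).hF t (hsub ht)).continuousAt.continuousWithinAt) ((hF j).trans (hFw j).symm)
        (fun t ht => (h _).hF t (hsub (Ioo_subset_Icc_self ht)))
      have hx' := hsub (Ioo_subset_Icc_self hx)
      exact ⟨x, hx, vF_eq_zero h0 h1 hx'.1.ne'
        (one_sub_pos_of_lt zero_le_one (by norm_num) hx').le hx0⟩
    choose x hx hPx using hx
    have hxs : ∀ j, x j ∈ Ioo (0:ℝ) 1 := fun j => ⟨(hzs j).1.trans (hx j).1, (hx j).2.trans (hws j).2⟩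
    have hxt : Tendsto x atTop (𝓝 z) :=
      tendsto_of_tendsto_of_tendsto_of_le_of_le hz hw (fun j => (hx j).1.le) (fun j => (hx j).2.le)
    have ht := (tendsto_sub_of_stable h0 h1 h hc hxt hxs hz1).2
    simp only [hPx, zero_sub] at ht
    have h2 := ((h c).hP z ⟨hpos, hz1⟩).continuousAt.tendsto.comp hxt
    have h3 := tendsto_nhds_unique h2.neg ht
    exact (h c).P_ne_zero h0 h1 zero_le_one (by norm_num) ⟨hpos, hz1⟩ hFz (by linarith)
  · obtain ⟨j, hj⟩ := (hz.eventually (lt_mem_nhds (show 1 - (1 - 2 * α) / 16 < 1 by linarith))).exists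
    exact (h (cs j)).not_two_zeros h0 h1 hj (hlt j) (hws j).2 (hF j) (hFw j)

theorem isSol_zero : IsSol α 1 0 1 (fun _ => 0) (fun _ => 0) := by
  refine ⟨fun ξ _ => ?_, fun ξ _ => ?_, by simp, by simp⟩
  · simpa [vF] using hasDerivAt_const ξ (0:ℝ)
  · simpa [vP] using hasDerivAt_const ξ (0:ℝ)

/-- The shooting argument. -/
theorem exists_shooting (h0 : 0 ≤ α) (h1 : α < 1 / 2) (n : ℕ) : ∃ c > 0, ∃ F P, IsSol α 1 c 1 F P ∧
    Tendsto F (𝓝[<] 1) (𝓝 (π / 2)) ∧ {ξ ∈ Ioo (0:ℝ) 1 | F ξ = π / 2}.Finite ∧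
    {ξ ∈ Ioo (0:ℝ) 1 | F ξ = π / 2}.ncard = n := by
  choose Fc Pc h using exists_isSol_one h0 h1
  set V : Set ℝ := {c | 0 < c ∧ ∃ z : Fin (n + 1) → ℝ, StrictMono z ∧ ∀ i, z i ∈ Ioo 0 1 ∧ Fc c (z i) = π / 2}
    with hV
  have hne : V.Nonempty := by
    obtain ⟨c, hc, F, P, hFP, z, hz, hz'⟩ := exists_many_zeros h0 h1 (n + 1)
    refine ⟨c, hc, z, hz, fun i => ⟨(hz' i).1, ?_⟩⟩
    have hlt : 1 * (z i) ^ 2 < 1 := by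
      linarith [one_sub_pos_of_lt (b := 1) zero_le_one (by norm_num) (hz' i).1]
    rw [← (hz' i).2]
    exact ((h c).eq h0 h1 hFP zero_le_one (hz' i).1.1 (hz' i).1.2 (hz' i).1.2 hlt).1
  have hbdd : BddBelow V := ⟨0, fun c hc => hc.1.le⟩
  set c := sInf V with hcdef
  have hc0 : 0 ≤ c := le_csInf hne fun c hc => hc.1.le
  obtain ⟨cs, hcs, hct⟩ := mem_closure_iff_seq_limit.1 (csInf_mem_closure hne hbdd)
  choose hcs0 zs hzm hzs using hcs
  obtain ⟨ζ, hζ, φ, hφ, hzt⟩ := (isCompact_univ_pi fun _ : Fin (n + 1) => isCompact_Icc (a := (0:ℝ)) (b := 1)).tendsto_subseq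
    (x := zs) (fun j i _ => Ioo_subset_Icc_self (hzs j i).1)
  have hzt : ∀ i, Tendsto (fun j => zs (φ j) i) atTop (𝓝 (ζ i)) := fun i => (tendsto_pi_nhds.1 hzt) i
  have hct : Tendsto (fun j => cs (φ j)) atTop (𝓝 c) := hct.comp hφ.tendsto_atTop
  have hin : ∀ i, ζ i < 1 → 0 < ζ i ∧ Fc c (ζ i) = π / 2 := fun i hi =>
    limit_zero h0 h1 h hct (hzt i) (fun j => (hzs (φ j) i).1) (fun j => (hzs (φ j) i).2) hi
  have hout : ∀ i, ζ i = 1 → Tendsto (Fc c) (𝓝[<] 1) (𝓝 (π / 2)) := fun i hi =>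
    limit_zero_one h0 h1 h hct (hi ▸ hzt i) (fun j => (hzs (φ j) i).1) (fun j => (hzs (φ j) i).2)
  have hζ1 : ∀ i, ζ i ≤ 1 := fun i => (hζ i (mem_univ i)).2
  have hcpos : 0 < c := by
    refine hc0.lt_of_ne fun he => ?_
    have hzero : ∀ ξ ∈ Ioo (0:ℝ) 1, Fc c ξ = 0 := fun ξ hξ =>
      ((he ▸ h c : IsSol α 1 0 1 (Fc c) (Pc c)).eq h0 h1 isSol_zero zero_le_one hξ.1 hξ.2 hξ.2
        (by linarith [one_sub_pos_of_lt (b := 1) zero_le_one (by norm_num) hξ])).1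
    rcases (hζ1 0).lt_or_eq with hlt | heq
    · obtain ⟨h2, h3⟩ := hin 0 hlt
      rw [hzero _ ⟨h2, hlt⟩] at h3
      linarith [pi_pos]
    · have h2 : Tendsto (Fc c) (𝓝[<] 1) (𝓝 0) := by
        refine tendsto_const_nhds.congr' ?_
        filter_upwards [Ioo_mem_nhdsLT (show (0:ℝ) < 1 by norm_num)] with s hs using (hzero s hs).symm
      have := tendsto_nhds_unique (hout 0 heq) h2
      linarith [pi_pos]
  have hmono : StrictMono ζ := fun i k hik => by
    refine lt_of_le_of_ne (le_of_tendsto_of_tendsto' (hzt i) (hzt k) fun j => (hzm (φ j) hik).le) fun he => ?_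
    exact limit_zeros_ne h0 h1 h hct (hzt i) (fun j => (hzs (φ j) i).1) (fun j => (hzs (φ j) i).2)
      (he ▸ hzt k) (fun j => (hzs (φ j) k).1) (fun j => (hzs (φ j) k).2) (fun j => hzm (φ j) hik)
  have hcV : c ∉ V := by
    rintro ⟨-, z, hz, hz'⟩
    obtain ⟨δ, hδ, H⟩ := (h c).zeros_persist h0 h1 zero_le_one (by norm_num) hz (fun i => (hz' i).1)
      (fun i => (hz' i).2)
    have hm : 0 < min δ c := lt_min hδ hcpos
    have hm1 := min_le_left δ c
    have hm2 := min_le_right δ c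
    obtain ⟨w, hw, hw'⟩ := H (c - min δ c / 2) 1 1 _ _ (by rw [abs_lt]; constructor <;> linarith)
      (by simpa using hδ) zero_le_one le_rfl (h _)
    have : c ≤ c - min δ c / 2 := csInf_le hbdd ⟨by linarith, w, hw, hw'⟩
    linarith
  have hlast : ζ (Fin.last n) = 1 := by
    refine (hζ1 _).lt_or_eq.resolve_left fun hlt => hcV ⟨hcpos, ζ, hmono, fun i => ?_⟩
    have hi : ζ i < 1 := (hmono.monotone (Fin.le_last i)).trans_lt hlt
    exact ⟨⟨(hin i hi).1, hi⟩, (hin i hi).2⟩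
  have hcard : ∀ t : Finset ℝ, (t : Set ℝ) ⊆ {ξ ∈ Ioo (0:ℝ) 1 | Fc c ξ = π / 2} → t.card ≤ n := by
    intro t ht
    by_contra! hcon
    exact hcV ⟨hcpos, t.orderEmbOfCardLe hcon, (t.orderEmbOfCardLe hcon).strictMono,
      fun i => ht (t.orderEmbOfCardLe_mem hcon i)⟩
  have hfin : {ξ ∈ Ioo (0:ℝ) 1 | Fc c ξ = π / 2}.Finite := by
    by_contra hinf
    obtain ⟨t, ht, hk⟩ := Set.Infinite.exists_subset_card_eq hinf (n + 1)
    have := hcard t ht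
    omega
  refine ⟨c, hcpos, Fc c, Pc c, h c, hout _ hlast, hfin, le_antisymm ?_ ?_⟩
  · rw [Set.ncard_eq_toFinset_card _ hfin]
    exact hcard _ (by simp)
  · have hinj : Function.Injective fun i : Fin n => ζ i.castSucc := fun i j hij =>
      Fin.castSucc_injective n (hmono.injective hij)
    have hsub : range (fun i : Fin n => ζ i.castSucc) ⊆ {ξ ∈ Ioo (0:ℝ) 1 | Fc c ξ = π / 2} := by
      rintro _ ⟨i, rfl⟩
      have hi : ζ i.castSucc < 1 := hlast ▸ hmono (Fin.castSucc_lt_last i)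
      exact ⟨⟨(hin _ hi).1, hi⟩, (hin _ hi).2⟩
    have := Set.ncard_le_ncard hsub hfin
    rwa [← Set.image_univ, Set.ncard_image_of_injective _ hinj, Set.ncard_univ, Nat.card_eq_fintype_card,
      Fintype.card_fin] at this

end Shooting

section Horizon

variable {α c : ℝ} {F P : ℝ → ℝ}

theorem continuous_Rf : Continuous fun z : ℝ × ℝ × ℝ => Rf α z.1 z.2.1 z.2.2 := by
  unfold Rf qf
  fun_prop

theorem IsSol.horizon_limits (h0 : 0 ≤ α) (h1 : α < 1 / 2) (h : IsSol α 1 c 1 F P)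
    (hF : Tendsto F (𝓝[<] 1) (𝓝 (π / 2))) : ∃ p, Tendsto P (𝓝[<] 1) (𝓝 p) ∧
      Tendsto (fun ξ => (F ξ - π / 2) / (1 - ξ)) (𝓝[<] 1) (𝓝 (-(p / (1 - 2 * α)))) := by
  have hκ : 0 < 1 - 2 * α := by linarith
  set K := 8 / (1 - 2 * α) with hK
  have hK0 : 0 < K := by positivity
  have hG : ∀ ξ ∈ Ioo (1 / 2 : ℝ) 1, |F ξ - π / 2| ≤ K * √(1 - ξ) := by
    intro ξ hξ
    rw [abs_sub_comm]
    refine le_of_tendsto (hF.sub_const (F ξ)).abs ?_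
    filter_upwards [Ioo_mem_nhdsLT hξ.2] with s hs
    exact h.abs_sub_le h0 h1 hξ.1.le hs.1.le hs.2
  obtain ⟨p, hp⟩ := exists_tendsto_of_deriv_le_inv_sqrt (f := P) (f' := fun ξ => vP α 1 ξ (F ξ) (P ξ))
    (C := 2 * K) (by positivity) fun ξ hξ => by
      have hξ' : ξ ∈ Ioo (0:ℝ) 1 := ⟨by linarith [hξ.1], hξ.2⟩
      have h2 : 0 < 1 - ξ := by linarith [hξ.2]
      have h3 := Real.sqrt_pos.2 h2
      refine ⟨h.hP ξ hξ', (abs_vP_le_sub h0 h1 hξ' _ _).trans ?_⟩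
      rw [div_le_div_iff₀ h2 h3]
      have := hG ξ hξ
      calc 2 * |F ξ - π / 2| * √(1 - ξ) ≤ 2 * (K * √(1 - ξ)) * √(1 - ξ) := by gcongr
        _ = 2 * K * (√(1 - ξ) * √(1 - ξ)) := by ring
        _ = 2 * K * (1 - ξ) := by rw [Real.mul_self_sqrt h2.le]
  refine ⟨p, hp, ?_⟩
  have hid : Tendsto (fun ξ : ℝ => ξ) (𝓝[<] 1) (𝓝 1) := tendsto_id.mono_left nhdsWithin_le_nhds
  have hR0 : Rf α (1 - 1 * 1 ^ 2) (π / 2) (p / 1) = 1 - 2 * α := by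
    simp [Rf, qf, Real.sqrt_sq hκ.le]
  have hR : Tendsto (fun ξ => Rf α (1 - 1 * ξ ^ 2) (F ξ) (P ξ / ξ)) (𝓝[<] 1) (𝓝 (1 - 2 * α)) := by
    have l1 : Tendsto (fun ξ : ℝ => 1 - 1 * ξ ^ 2) (𝓝[<] 1) (𝓝 (1 - 1 * 1 ^ 2)) :=
      ((hid.pow 2).const_mul 1).const_sub 1
    have l2 : Tendsto (fun ξ : ℝ => P ξ / ξ) (𝓝[<] 1) (𝓝 (p / 1)) := hp.div hid one_ne_zero
    have l3 := ((continuous_Rf (α := α)).tendsto (1 - 1 * 1 ^ 2, π / 2, p / 1)).comp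
      (l1.prodMk_nhds (hF.prodMk_nhds l2))
    rw [hR0] at l3
    exact l3
  have hv : Tendsto (fun ξ => vF α 1 ξ (F ξ) (P ξ)) (𝓝[<] 1) (𝓝 (p / (1 - 2 * α))) := by
    have := hp.div ((hid.pow 2).mul hR) (by simpa using hκ.ne')
    rw [one_pow, one_mul] at this
    exact this
  refine HasDerivAt.lhopital_zero_nhdsLT (f' := fun ξ => vF α 1 ξ (F ξ) (P ξ)) (g' := fun _ => -1)
    ?_ ?_ ?_ ?_ ?_ ?_
  · filter_upwards [Ioo_mem_nhdsLT (zero_lt_one' ℝ)] with ξ hξ using (h.hF ξ hξ).sub_const _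
  · exact Eventually.of_forall fun ξ => by simpa using (hasDerivAt_id ξ).const_sub 1
  · exact Eventually.of_forall fun ξ => by norm_num
  · simpa using hF.sub_const (π / 2)
  · simpa using hid.const_sub 1
  · simpa [div_neg] using hv.neg

/-- Radical in desingularised variables at the horizon. -/
def horizonR (α t g p : ℝ) : ℝ := Rf α (t * (2 - t)) (π / 2 + t * g) (p / (1 - t))

/-- Right-hand side of the equation for `P` in desingularised variables at the horizon. -/
def horizonP (α t g p : ℝ) : ℝ :=
  2 * g * sinc (2 * (t * g)) * ((horizonR α t g p + qf α (π / 2 + t * g)) / 2) / (horizonR α t g p * (2 - t))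

/-- Remainder in the equation for `F` in desingularised variables at the horizon. -/
def horizonE (α t g p : ℝ) : ℝ :=
  p * ((2 * α * t * g ^ 2 * sinc (t * g) ^ 2 * (qf α (π / 2 + t * g) + (1 - 2 * α)) +
      4 * α * (2 - t) * (p / (1 - t)) ^ 2) / (horizonR α t g p + (1 - 2 * α)) - (2 - t) * horizonR α t g p) /
    ((1 - 2 * α) * (1 - t) ^ 2 * horizonR α t g p)

theorem horizonR_pos (h0 : 0 ≤ α) (h1 : α < 1 / 2) {t : ℝ} (ht0 : 0 ≤ t) (ht1 : t ≤ 2) (g p : ℝ) :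
    0 < horizonR α t g p :=
  Rf_pos h0 h1 (mul_nonneg ht0 (by linarith))

theorem mul_horizonE (h0 : 0 ≤ α) (h1 : α < 1 / 2) {t : ℝ} (ht0 : 0 ≤ t) (ht1 : t < 1) (g p : ℝ) :
    t * horizonE α t g p = p / (1 - 2 * α) - p / ((1 - t) ^ 2 * horizonR α t g p) := by
  have hR0 := horizonR_pos h0 h1 ht0 (by linarith) g p
  have hR2 : horizonR α t g p ^ 2 = _ := Rf_sq (F := π / 2 + t * g) (N := p / (1 - t)) h0 h1
    (mul_nonneg ht0 (by linarith : 0 ≤ 2 - t))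
  have hκ : 0 < 1 - 2 * α := by linarith
  have ht : 0 < 1 - t := by linarith
  have hq : qf α (π / 2 + t * g) = 1 - 2 * α + 2 * α * (t * g * sinc (t * g)) ^ 2 := by
    unfold qf
    rw [mul_sinc, add_comm, sin_add_pi_div_two, cos_sq']
    ring
  have key : t * (2 * α * t * g ^ 2 * sinc (t * g) ^ 2 * (qf α (π / 2 + t * g) + (1 - 2 * α)) +
      4 * α * (2 - t) * (p / (1 - t)) ^ 2) / (horizonR α t g p + (1 - 2 * α)) = horizonR α t g p - (1 - 2 * α) := by
    rw [div_eq_iff (by positivity)]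
    have e : (horizonR α t g p - (1 - 2 * α)) * (horizonR α t g p + (1 - 2 * α)) = horizonR α t g p ^ 2 - (1 - 2 * α) ^ 2 := by ring
    rw [e, hR2, hq]
    ring
  have e2 : t * horizonE α t g p = p * (t * (2 * α * t * g ^ 2 * sinc (t * g) ^ 2 * (qf α (π / 2 + t * g) + (1 - 2 * α)) +
      4 * α * (2 - t) * (p / (1 - t)) ^ 2) / (horizonR α t g p + (1 - 2 * α)) - t * (2 - t) * horizonR α t g p) /
    ((1 - 2 * α) * (1 - t) ^ 2 * horizonR α t g p) := by
    unfold horizonE; ring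
  rw [e2, key]
  field_simp
  ring

theorem neg_vF_horizon {t : ℝ} (g p : ℝ) :
    vF α 1 (1 - t) (π / 2 + t * g) p = p / ((1 - t) ^ 2 * horizonR α t g p) := by
  unfold vF horizonR
  rw [show 1 - 1 * (1 - t) ^ 2 = t * (2 - t) by ring]

theorem neg_vP_horizon {t : ℝ} (ht0 : t ≠ 0) (g p : ℝ) :
    vP α 1 (1 - t) (π / 2 + t * g) p = -horizonP α t g p := by
  unfold vP horizonP Af horizonR
  rw [show 1 - 1 * (1 - t) ^ 2 = t * (2 - t) by ring,
    show 2 * (π / 2 + t * g) = 2 * (t * g) + π by ring, sin_add_pi, ← mul_sinc,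
    show ∀ R A : ℝ, -(2 * (t * g) * sinc (2 * (t * g))) * A / (R * (t * (2 - t))) =
      t * (-(2 * g * sinc (2 * (t * g)) * A)) / (t * (R * (2 - t))) from fun R A => by ring,
    mul_div_mul_left _ _ ht0, neg_div]

theorem analyticAt_horizon (h1 : α < 1 / 2) (κ p₀ η₀ : ℝ) :
    AnalyticAt ℝ (fun z : ℝ × ℝ × ℝ × ℝ => horizonE α z.1 (z.2.1 - κ * z.2.2.1) z.2.2.1) (0, 0, p₀, η₀) ∧
    AnalyticAt ℝ (fun z : ℝ × ℝ × ℝ × ℝ => horizonP α z.1 (z.2.1 - κ * z.2.2.1) z.2.2.1) (0, 0, p₀, η₀) := by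
  have hκ : 0 < 1 - 2 * α := by linarith
  have hR' : AnalyticAt ℝ (fun z : ℝ × ℝ × ℝ × ℝ => horizonR α z.1 (z.2.1 - κ * z.2.2.1) z.2.2.1) (0, 0, p₀, η₀) := by
    unfold horizonR
    refine AnalyticAt.comp_of_eq (g := fun z : ℝ × ℝ × ℝ => Rf α z.1 z.2.1 z.2.2)
      (f := fun z : ℝ × ℝ × ℝ × ℝ => (z.1 * (2 - z.1), π / 2 + z.1 * (z.2.1 - κ * z.2.2.1),
        z.2.2.1 / (1 - z.1))) (y := (0, π / 2, p₀)) (analyticAt_Rf ?_) ?_ ?_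
    · simpa [qf] using hκ.ne'
    · have : AnalyticAt ℝ (fun z : ℝ × ℝ × ℝ × ℝ => z.2.2.1 / (1 - z.1)) (0, 0, p₀, η₀) :=
        AnalyticAt.div (by fun_prop) (by fun_prop) (by simp)
      fun_prop
    · simp
  have hR0 : horizonR α 0 (0 - κ * p₀) p₀ = 1 - 2 * α := by
    simp [horizonR, Rf, qf, Real.sqrt_sq hκ.le]
  have hf : AnalyticAt ℝ (fun z : ℝ × ℝ × ℝ × ℝ => z.1 * (z.2.1 - κ * z.2.2.1)) (0, 0, p₀, η₀) := by
    fun_prop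
  have hf2 : AnalyticAt ℝ (fun z : ℝ × ℝ × ℝ × ℝ => 2 * (z.1 * (z.2.1 - κ * z.2.2.1))) (0, 0, p₀, η₀) := by
    fun_prop
  have hs : AnalyticAt ℝ (fun z : ℝ × ℝ × ℝ × ℝ => sin (π / 2 + z.1 * (z.2.1 - κ * z.2.2.1))) (0, 0, p₀, η₀) :=
    Real.analyticAt_sin.comp_of_eq (analyticAt_const.add hf) rfl
  have hsinc : AnalyticAt ℝ (fun z : ℝ × ℝ × ℝ × ℝ => sinc (z.1 * (z.2.1 - κ * z.2.2.1))) (0, 0, p₀, η₀) :=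
    analyticAt_sinc.comp_of_eq hf (by simp)
  have hsinc2 : AnalyticAt ℝ (fun z : ℝ × ℝ × ℝ × ℝ => sinc (2 * (z.1 * (z.2.1 - κ * z.2.2.1)))) (0, 0, p₀, η₀) :=
    analyticAt_sinc.comp_of_eq hf2 (by simp)
  have hq : AnalyticAt ℝ (fun z : ℝ × ℝ × ℝ × ℝ => qf α (π / 2 + z.1 * (z.2.1 - κ * z.2.2.1))) (0, 0, p₀, η₀) := by
    unfold qf
    fun_prop
  have hN : AnalyticAt ℝ (fun z : ℝ × ℝ × ℝ × ℝ => z.2.2.1 / (1 - z.1)) (0, 0, p₀, η₀) :=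
    AnalyticAt.div (by fun_prop) (by fun_prop) (by simp)
  constructor
  · unfold horizonE
    refine AnalyticAt.div (AnalyticAt.mul (by fun_prop) (AnalyticAt.sub (AnalyticAt.div ?_ (by fun_prop) ?_)
      (by fun_prop))) (by fun_prop) ?_
    · fun_prop
    · simp only [hR0]
      linarith
    · simp only [hR0]
      simpa using hκ.ne'
  · unfold horizonP
    refine AnalyticAt.div (AnalyticAt.mul (by fun_prop) ((hR'.add hq).div (by fun_prop) two_ne_zero))
      (by fun_prop) ?_
    simp only [hR0]
    simpa using hκ.ne'

theorem IsSol.exists_analyticAt_horizon (h0 : 0 ≤ α) (h1 : α < 1 / 2) (h : IsSol α 1 c 1 F P)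
    (hF : Tendsto F (𝓝[<] 1) (𝓝 (π / 2))) : ∃ f p : ℝ → ℝ, AnalyticAt ℝ f 1 ∧ AnalyticAt ℝ p 1 ∧
      f 1 = π / 2 ∧ ∀ᶠ ξ in 𝓝[<] 1, F ξ = f ξ ∧ P ξ = p ξ := by
  have hκ : 0 < 1 - 2 * α := by linarith
  obtain ⟨p₀, hp, hg⟩ := h.horizon_limits h0 h1 hF
  set κ := 1 / (1 - 2 * α) with hκdef
  obtain ⟨aE, aP⟩ := analyticAt_horizon h1 κ p₀ 0
  obtain ⟨X, Y, hX, hY, hX0, hY0, ε, hε, H⟩ := exists_analyticAt_planar 1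
    (e₁ := fun z => horizonE α z.1 (z.2.1 - κ * z.2.2.1) z.2.2.1 +
      κ * horizonP α z.1 (z.2.1 - κ * z.2.2.1) z.2.2.1) (aE.add (analyticAt_const.mul aP)) aP
  obtain ⟨-, H⟩ := H 0 p₀ 0 (by simpa using hε) (by simpa using hε) (by simpa using hε)
  have hline : AnalyticAt ℝ (fun ξ : ℝ => (1 - ξ, (0:ℝ), p₀, (0:ℝ))) 1 := by fun_prop
  have hX' : AnalyticAt ℝ (fun ξ : ℝ => X (1 - ξ, 0, p₀, 0)) 1 := hX.comp_of_eq hline (by simp)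
  have hY' : AnalyticAt ℝ (fun ξ : ℝ => Y (1 - ξ, 0, p₀, 0)) 1 := hY.comp_of_eq hline (by simp)
  refine ⟨fun ξ => π / 2 + (1 - ξ) * (X (1 - ξ, 0, p₀, 0) - κ * Y (1 - ξ, 0, p₀, 0)),
    fun ξ => Y (1 - ξ, 0, p₀, 0), analyticAt_const.add
      ((by fun_prop : AnalyticAt ℝ (fun ξ : ℝ => 1 - ξ) 1).mul (hX'.sub (analyticAt_const.mul hY'))),
    hY', by simp, ?_⟩
  set u : ℝ → ℝ := fun s => if s = 0 then 0 else (F (1 - s) - π / 2) / s + κ * P (1 - s) with hu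
  set v : ℝ → ℝ := fun s => if s = 0 then p₀ else P (1 - s) with hv
  have hrefl : Tendsto (fun s : ℝ => 1 - s) (𝓝[>] 0) (𝓝[<] 1) := by
    refine tendsto_nhdsWithin_iff.2 ⟨?_, ?_⟩
    · have : Tendsto (fun s : ℝ => 1 - s) (𝓝 0) (𝓝 (1 - 0)) := tendsto_id.const_sub 1
      rw [sub_zero] at this
      exact this.mono_left nhdsWithin_le_nhds
    · filter_upwards [self_mem_nhdsWithin] with s hs
      have : 0 < s := hs
      show 1 - s < 1
      linarith
  have hut : Tendsto u (𝓝[>] 0) (𝓝 0) := by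
    have := (hg.comp hrefl).add ((hp.comp hrefl).const_mul κ)
    rw [hκdef, one_div_mul_eq_div, neg_add_cancel] at this
    refine this.congr' ?_
    filter_upwards [self_mem_nhdsWithin] with s hs
    simp [hu, ne_of_gt (show 0 < s from hs), hκdef]
  have hvt : Tendsto v (𝓝[>] 0) (𝓝 p₀) := by
    refine (hp.comp hrefl).congr' ?_
    filter_upwards [self_mem_nhdsWithin] with s hs
    simp [hv, ne_of_gt (show 0 < s from hs)]
  have hu0 : u 0 = 0 := by simp [hu]
  have hv0 : v 0 = p₀ := by simp [hv]
  have hd : ∀ s ∈ Ioo (0:ℝ) 1, (∃ d, HasDerivAt u d s ∧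
      s * d = -(1 : ℕ) * (u s - 0) + s * (horizonE α s (u s - κ * v s) (v s) + κ * horizonP α s (u s - κ * v s) (v s))) ∧
      HasDerivAt v (horizonP α s (u s - κ * v s) (v s)) s := by
    intro s hs
    have hs0 : s ≠ 0 := hs.1.ne'
    have h1s : 1 - s ∈ Ioo (0:ℝ) 1 := ⟨by linarith [hs.2], by linarith [hs.1]⟩
    have evne : ∀ᶠ t in 𝓝 s, t ≠ 0 := isOpen_ne.mem_nhds hs0
    have hr : HasDerivAt (fun t : ℝ => 1 - t) (-1) s := by simpa using (hasDerivAt_id s).const_sub 1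
    have dF := (h.hF _ h1s).comp s hr
    have dP := (h.hP _ h1s).comp s hr
    set g := (F (1 - s) - π / 2) / s with hgdef
    have hFg : F (1 - s) = π / 2 + s * g := by rw [hgdef]; field_simp; ring
    have hus : u s = g + κ * P (1 - s) := by simp [hu, hs0, hgdef]
    have hvs : v s = P (1 - s) := by simp [hv, hs0]
    have hgs : u s - κ * v s = g := by rw [hus, hvs]; ring
    rw [hgs, hvs]
    have e1 : vF α 1 (1 - s) (F (1 - s)) (P (1 - s)) = P (1 - s) / (1 - 2 * α) - s * horizonE α s g (P (1 - s)) := by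
      rw [mul_horizonE h0 h1 hs.1.le hs.2, hFg, neg_vF_horizon]; ring
    have e2 : vP α 1 (1 - s) (F (1 - s)) (P (1 - s)) = -horizonP α s g (P (1 - s)) := by
      rw [hFg, neg_vP_horizon hs0]
    rw [e1] at dF
    rw [e2] at dP
    constructor
    · refine ⟨_, (((dF.sub_const (π / 2)).div (hasDerivAt_id s) hs0).add (dP.const_mul κ)).congr_of_eventuallyEq
        (evne.mono fun t ht => ?_), ?_⟩
      · simp [hu, ht]
      · simp only [Function.comp, id]
        rw [hFg, hus, hκdef]
        push_cast
        field_simp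
        ring
    · refine (dP.congr_of_eventuallyEq (evne.mono fun t ht => ?_)).congr_deriv (by ring)
      simp [hv, ht]
  have hnear : ∀ᶠ s in 𝓝[>] (0:ℝ), |u s - 0| < ε ∧ |v s - p₀| < ε := by
    have e1 := hut.eventually (Metric.ball_mem_nhds _ hε)
    have e2 := hvt.eventually (Metric.ball_mem_nhds _ hε)
    simpa [Real.dist_eq] using e1.and e2
  obtain ⟨δ, hδ, hδH⟩ := mem_nhdsGT_iff_exists_Ioo_subset.1 hnear
  have hm : 0 < min (min δ ε) 1 := lt_min (lt_min hδ hε) one_pos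
  filter_upwards [Ioo_mem_nhdsLT (show 1 - min (min δ ε) 1 < 1 by linarith)] with ξ hξ
  have ht : 0 < 1 - ξ := by linarith [hξ.2]
  have htm : 1 - ξ < min (min δ ε) 1 := by linarith [hξ.1]
  simp only [lt_min_iff] at htm
  have hsub : ∀ s ∈ uIcc 0 (1 - ξ), 0 ≤ s ∧ s < δ ∧ s < 1 := fun s hs => by
    rw [uIcc_of_le ht.le] at hs
    exact ⟨hs.1, hs.2.trans_lt htm.1.1, hs.2.trans_lt htm.2⟩
  have hcont : ContinuousOn u (uIcc 0 (1 - ξ)) ∧ ContinuousOn v (uIcc 0 (1 - ξ)) := by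
    have c0 : ∀ {w : ℝ → ℝ}, Tendsto w (𝓝[>] 0) (𝓝 (w 0)) → (∀ s ∈ Ioo (0:ℝ) 1, ContinuousAt w s) →
        ContinuousOn w (uIcc 0 (1 - ξ)) := by
      intro w hw hw' s hs
      obtain ⟨h2, -, h3⟩ := hsub s hs
      rcases h2.eq_or_lt with rfl | h2
      · exact (continuousWithinAt_Ioi_iff_Ici.1 (show ContinuousWithinAt w (Ioi 0) 0 from hw)).mono
          fun t ht => (hsub t ht).1
      · exact (hw' s ⟨h2, h3⟩).continuousWithinAt
    refine ⟨c0 (by rwa [hu0]) fun s hs => ?_, c0 (by rwa [hv0]) fun s hs => (hd s hs).2.continuousAt⟩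
    obtain ⟨⟨d, hd', -⟩, -⟩ := hd s hs
    exact hd'.continuousAt
  obtain ⟨hu1, hv1⟩ := H u v (1 - ξ) (by rw [abs_of_pos ht]; exact htm.1.2) hcont.1 hcont.2 hu0 hv0
    (fun s hs => by
      obtain ⟨h2, h3, -⟩ := hsub s hs
      rcases h2.eq_or_lt with rfl | h2
      · rw [hu0, hv0]; simpa using hε
      · exact hδH ⟨h2, h3⟩)
    (fun s hs hs0 _ => by
      obtain ⟨h2, -, h3⟩ := hsub s hs
      exact hd s ⟨lt_of_le_of_ne h2 (Ne.symm hs0), h3⟩)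
  have hvP : v (1 - ξ) = P ξ := by simp [hv, ht.ne']
  have huF : u (1 - ξ) = (F ξ - π / 2) / (1 - ξ) + κ * P ξ := by simp [hu, ht.ne']
  refine ⟨?_, hvP ▸ hv1⟩
  rw [← hu1, ← hv1, huF, hvP]
  field_simp
  ring

end Horizon

/-- Solutions of planar analytic ordinary differential equations are analytic. -/
theorem analyticAt_of_hasDerivAt_planar {u v : ℝ → ℝ} {e₁ e₂ : ℝ × ℝ × ℝ → ℝ} {x : ℝ}
    (h₁ : AnalyticAt ℝ e₁ (x, u x, v x)) (h₂ : AnalyticAt ℝ e₂ (x, u x, v x))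
    (hu : ∀ᶠ s in 𝓝 x, HasDerivAt u (e₁ (s, u s, v s)) s)
    (hv : ∀ᶠ s in 𝓝 x, HasDerivAt v (e₂ (s, u s, v s)) s) :
    AnalyticAt ℝ u x ∧ AnalyticAt ℝ v x := by
  have hsh : AnalyticAt ℝ (fun z : ℝ × ℝ × ℝ × ℝ => (x + z.1, z.2.1, z.2.2.1)) (0, u x, v x, 0) := by
    fun_prop
  obtain ⟨X, Y, hX, hY, -, -, ε, hε, H⟩ := exists_analyticAt_planar 0
    (e₁ := fun z => e₁ (x + z.1, z.2.1, z.2.2.1)) (e₂ := fun z => e₂ (x + z.1, z.2.1, z.2.2.1))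
    (h₁.comp_of_eq hsh (by simp)) (h₂.comp_of_eq hsh (by simp))
  obtain ⟨-, H⟩ := H (u x) (v x) 0 (by simpa using hε) (by simpa using hε) (by simpa using hε)
  have hline : AnalyticAt ℝ (fun ξ : ℝ => (ξ - x, u x, v x, (0:ℝ))) x := by fun_prop
  have cu : ∀ᶠ s in 𝓝 x, |u s - u x| < ε :=
    hu.self_of_nhds.continuousAt.eventually (Metric.ball_mem_nhds _ hε)
  have cv : ∀ᶠ s in 𝓝 x, |v s - v x| < ε :=
    hv.self_of_nhds.continuousAt.eventually (Metric.ball_mem_nhds _ hε)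
  obtain ⟨δ, hδ, hball⟩ := Metric.eventually_nhds_iff.1 ((hu.and hv).and (cu.and cv))
  have key : ∀ᶠ s in 𝓝 x, u s = X (s - x, u x, v x, 0) ∧ v s = Y (s - x, u x, v x, 0) := by
    filter_upwards [Metric.ball_mem_nhds x (lt_min hδ hε)] with s hs
    rw [Metric.mem_ball, Real.dist_eq, lt_min_iff] at hs
    have hin : ∀ t ∈ uIcc 0 (s - x), dist (x + t) x < δ := fun t ht => by
      have := Set.abs_sub_left_of_mem_uIcc ht
      rw [Real.dist_eq, add_sub_cancel_left]
      simp only [sub_zero] at this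
      exact this.trans_lt hs.1
    have hr : ∀ t : ℝ, HasDerivAt (fun t : ℝ => x + t) 1 t := fun t => (hasDerivAt_id t).const_add x
    have du : ∀ t ∈ uIcc 0 (s - x), HasDerivAt (fun t => u (x + t)) (e₁ (x + t, u (x + t), v (x + t))) t :=
      fun t ht => by simpa [Function.comp_def] using (hball (hin t ht)).1.1.comp t (hr t)
    have dv : ∀ t ∈ uIcc 0 (s - x), HasDerivAt (fun t => v (x + t)) (e₂ (x + t, u (x + t), v (x + t))) t :=
      fun t ht => by simpa [Function.comp_def] using (hball (hin t ht)).1.2.comp t (hr t)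
    have := H (fun t => u (x + t)) (fun t => v (x + t)) (s - x) hs.2
      (fun t ht => (du t ht).continuousAt.continuousWithinAt)
      (fun t ht => (dv t ht).continuousAt.continuousWithinAt) (by simp) (by simp)
      (fun t ht => (hball (hin t ht)).2)
      (fun t ht _ _ => ⟨⟨_, du t ht, by simp⟩, dv t ht⟩)
    simpa using this
  exact ⟨(hX.comp_of_eq hline (by simp)).congr (key.mono fun s hs => hs.1.symm),
    (hY.comp_of_eq hline (by simp)).congr (key.mono fun s hs => hs.2.symm)⟩

theorem analyticAt_of_hasDerivAt {f g : ℝ → ℝ} {x : ℝ} (hg : AnalyticAt ℝ g x)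
    (hf : ∀ᶠ s in 𝓝 x, HasDerivAt f (g s) s) : AnalyticAt ℝ f x :=
  (analyticAt_of_hasDerivAt_planar (v := fun _ => 0) (e₁ := fun z => g z.1) (e₂ := fun _ => 0)
    (hg.comp_of_eq (f := fun z : ℝ × ℝ × ℝ => z.1) (by fun_prop) rfl) analyticAt_const hf
    (Eventually.of_forall fun s => hasDerivAt_const s 0)).1

/-- Analytic extension across both endpoints of `(0, 1)`. -/
theorem exists_analyticOnNhd_extension {f f₀ f₁ : ℝ → ℝ} (h : ∀ x ∈ Ioo (0:ℝ) 1, AnalyticAt ℝ f x)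
    (h₀ : AnalyticAt ℝ f₀ 0) (h₁ : AnalyticAt ℝ f₁ 1) (e₀ : ∀ᶠ x in 𝓝[>] 0, f x = f₀ x)
    (e₁ : ∀ᶠ x in 𝓝[<] 1, f x = f₁ x) : ∃ g : ℝ → ℝ, AnalyticOnNhd ℝ g (Icc 0 1) ∧
      (∀ x ∈ Ioo (0:ℝ) 1, g x = f x) ∧ g 0 = f₀ 0 ∧ g 1 = f₁ 1 := by
  refine ⟨fun x => if x ≤ 0 then f₀ x else if 1 ≤ x then f₁ x else f x, ?_, ?_, ?_, ?_⟩
  · rintro x ⟨hx0, hx1⟩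
    rcases hx0.eq_or_lt with rfl | hx0
    · refine h₀.congr ?_
      filter_upwards [eventually_nhdsWithin_iff.1 e₀, gt_mem_nhds (zero_lt_one' ℝ)] with s hs hs1
      rcases le_or_gt s 0 with h | h
      · simp [h]
      · simp [h.not_ge, hs1.not_ge, hs h]
    rcases hx1.eq_or_lt with rfl | hx1
    · refine h₁.congr ?_
      filter_upwards [eventually_nhdsWithin_iff.1 e₁, lt_mem_nhds (zero_lt_one' ℝ)] with s hs hs1
      rcases le_or_gt 1 s with h | h
      · simp [h, hs1.not_ge]
      · simp [h.not_ge, hs1.not_ge, hs h]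
    · refine (h x ⟨hx0, hx1⟩).congr ?_
      filter_upwards [lt_mem_nhds hx0, gt_mem_nhds hx1] with s hs hs1
      simp [hs.not_ge, hs1.not_ge]
  · intro x hx
    simp [hx.1.not_ge, hx.2.not_ge]
  · simp
  · simp

theorem IsSol.exists_extension {α c : ℝ} {F P : ℝ → ℝ} (h0 : 0 ≤ α) (h1 : α < 1 / 2)
    (h : IsSol α 1 c 1 F P) (hF : Tendsto F (𝓝[<] 1) (𝓝 (π / 2))) :
    ∃ G N : ℝ → ℝ, AnalyticOnNhd ℝ G (Icc 0 1) ∧ AnalyticOnNhd ℝ N (Icc 0 1) ∧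
      G 0 = 0 ∧ N 0 = 0 ∧ G 1 = π / 2 ∧ ∀ ξ ∈ Ioo (0:ℝ) 1, G ξ = F ξ ∧ N ξ = P ξ / ξ := by
  obtain ⟨f, p, hf, hp, hf1, hev⟩ := h.exists_analyticAt_horizon h0 h1 hF
  obtain ⟨Φ, Ψ, hΦ, hΨ, -, -, δ, hδ, H⟩ := exists_local_rep h0 h1 c 1
  obtain ⟨-, -, H⟩ := H c 1 (by simpa using hδ) (by simpa using hδ) zero_le_one
  have hline : AnalyticAt ℝ (fun ξ : ℝ => (ξ, c, (1:ℝ))) 0 := by fun_prop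
  have hnear : ∀ᶠ ξ in 𝓝[>] (0:ℝ), F ξ = ξ * Φ (ξ, c, 1) ∧ P ξ / ξ = ξ * Ψ (ξ, c, 1) := by
    filter_upwards [Ioo_mem_nhdsGT (lt_min hδ one_pos)] with ξ hξ
    have h2 := lt_min_iff.1 hξ.2
    obtain ⟨e1, e2⟩ := H 1 F P h ξ hξ.1 h2.2 h2.1
    refine ⟨e1, ?_⟩
    rw [e2, div_eq_iff hξ.1.ne']
    ring
  have hintegr : ∀ ξ ∈ Ioo (0:ℝ) 1, AnalyticAt ℝ F ξ ∧ AnalyticAt ℝ P ξ := by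
    intro ξ hξ
    have hm : Ioo (0:ℝ) 1 ∈ 𝓝 ξ := isOpen_Ioo.mem_nhds hξ
    obtain ⟨a1, a2⟩ := analyticAt_vF_vP (α := α) h0 h1 (z := (ξ, F ξ, P ξ, 1)) hξ.1.ne'
      (by simp only; nlinarith [hξ.1, hξ.2])
    have hsh : AnalyticAt ℝ (fun z : ℝ × ℝ × ℝ => (z.1, z.2.1, z.2.2, (1:ℝ))) (ξ, F ξ, P ξ) := by
      fun_prop
    refine analyticAt_of_hasDerivAt_planar (a1.comp_of_eq hsh rfl) (a2.comp_of_eq hsh rfl) ?_ ?_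
    · filter_upwards [hm] with s hs using h.hF s hs
    · filter_upwards [hm] with s hs using h.hP s hs
  obtain ⟨G, hG, hG1, hG2, hG3⟩ := exists_analyticOnNhd_extension (fun ξ hξ => (hintegr ξ hξ).1)
    (f₀ := fun ξ => ξ * Φ (ξ, c, 1)) (analyticAt_id.mul (hΦ.comp_of_eq hline rfl)) hf
    (hnear.mono fun _ h => h.1) (hev.mono fun _ h => h.1)
  obtain ⟨N, hN, hN1, hN2, -⟩ := exists_analyticOnNhd_extension (f := fun ξ => P ξ / ξ)
    (fun ξ hξ => (hintegr ξ hξ).2.div analyticAt_id hξ.1.ne')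
    (f₀ := fun ξ => ξ * Ψ (ξ, c, 1)) (f₁ := fun ξ => p ξ / ξ)
    (analyticAt_id.mul (hΨ.comp_of_eq hline rfl)) (hp.div analyticAt_id one_ne_zero)
    (hnear.mono fun _ h => h.2) (hev.mono fun ξ h => by rw [h.2])
  exact ⟨G, N, hG, hN, by simpa using hG2, by simpa using hN2, by rw [hG3, hf1],
    fun ξ hξ => ⟨hG1 ξ hξ, hN1 ξ hξ⟩⟩

theorem AnalyticAt.dslope_zero {f : ℝ → ℝ} {x : ℝ} (h0 : AnalyticAt ℝ f 0) (hx : AnalyticAt ℝ f x) :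
    AnalyticAt ℝ (dslope f 0) x := by
  rcases eq_or_ne x 0 with rfl | h
  · obtain ⟨p, hp⟩ := h0
    exact hp.has_fpower_series_dslope_fslope.analyticAt
  · have : AnalyticAt ℝ (fun s => (f s - f 0) / s) x :=
      (hx.sub analyticAt_const).div analyticAt_id h
    refine this.congr ?_
    filter_upwards [isOpen_ne.mem_nhds h] with s hs
    rw [dslope_of_ne _ hs, slope_def_field, sub_zero]

/-- Analytic solution of `x ζ' = ζ / B(ζ)` connecting the two endpoints of `[0, 1]`. -/
theorem exists_change_of_variable {B : ℝ → ℝ} (hB : AnalyticOnNhd ℝ B (Icc 0 1)) (hB0 : B 0 = 1)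
    (hpos : ∀ x ∈ Icc (0:ℝ) 1, 0 < B x) : ∃ ζ : ℝ → ℝ, AnalyticOnNhd ℝ ζ (Icc 0 1) ∧ ζ 0 = 0 ∧
      ζ 1 = 1 ∧ BijOn ζ (Ioo 0 1) (Ioo 0 1) ∧ MapsTo ζ (Icc 0 1) (Icc 0 1) ∧
      ∀ x ∈ Ioo (0:ℝ) 1, HasDerivAt ζ (ζ x / (x * B (ζ x))) x := by
  have hloc : ∀ x ∈ Icc (0:ℝ) 1, ∃ ε > 0, ∀ s, dist s x < ε → AnalyticAt ℝ B s ∧ 0 < B s := fun x hx =>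
    Metric.eventually_nhds_iff.1 ((hB x hx).eventually_analyticAt.and
      ((hB x hx).continuousAt.eventually (lt_mem_nhds (hpos x hx))))
  obtain ⟨ε₀, hε₀, H₀⟩ := hloc 0 (by simp)
  obtain ⟨ε₁, hε₁, H₁⟩ := hloc 1 (by simp)
  set U : Set ℝ := Ioo (-ε₀) (1 + ε₁) with hU
  have hUI : Icc (0:ℝ) 1 ⊆ U := fun x hx => ⟨by linarith [hx.1], by linarith [hx.2]⟩
  have hUB : ∀ x ∈ U, AnalyticAt ℝ B x ∧ 0 < B x := by
    intro x hx
    by_cases h0 : x < 0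
    · exact H₀ x (by rw [Real.dist_eq, abs_lt]; constructor <;> linarith [hx.1])
    by_cases h1 : 1 < x
    · exact H₁ x (by rw [Real.dist_eq, abs_lt]; constructor <;> linarith [hx.2])
    · exact ⟨hB x ⟨by linarith, by linarith⟩, hpos x ⟨by linarith, by linarith⟩⟩
  have hUo : IsOpen U := isOpen_Ioo
  have hUc : OrdConnected U := ordConnected_Ioo
  have h1U : (1:ℝ) ∈ U := hUI (by simp)
  have h0U : (0:ℝ) ∈ U := hUI (by simp)
  set k := dslope B 0 with hk
  have hka : ∀ x ∈ U, AnalyticAt ℝ k x := fun x hx => (hUB 0 h0U).1.dslope_zero (hUB x hx).1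
  have hkB : ∀ x, 1 + x * k x = B x := fun x => by
    have := sub_smul_dslope B 0 x
    rw [sub_zero, smul_eq_mul, hB0] at this
    rw [this]; ring
  have hkc : ContinuousOn k U := fun x hx => (hka x hx).continuousAt.continuousWithinAt
  set g : ℝ → ℝ := fun z => ∫ s in (1:ℝ)..z, k s with hg
  have hgd : ∀ x ∈ U, HasDerivAt g (k x) x := fun x hx =>
    intervalIntegral.integral_hasDerivAt_right
      ((hkc.mono (hUc.uIcc_subset h1U hx)).intervalIntegrable)
      (hkc.stronglyMeasurableAtFilter hUo x hx) (hka x hx).continuousAt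
  have hga : ∀ x ∈ U, AnalyticAt ℝ g x := fun x hx =>
    analyticAt_of_hasDerivAt (hka x hx) (by filter_upwards [hUo.mem_nhds hx] with s hs using hgd s hs)
  set r : ℝ → ℝ := fun z => z * exp (g z) with hr
  have hra : ∀ x ∈ U, AnalyticAt ℝ r x := fun x hx =>
    analyticAt_id.mul (hga x hx).rexp
  have hrd : ∀ x ∈ U, HasDerivAt r (exp (g x) * B x) x := fun x hx => by
    refine ((hasDerivAt_id x).mul (hgd x hx).exp).congr_deriv ?_
    rw [← hkB]; simp only [id]; ring
  have hrm : StrictMonoOn r U := strictMonoOn_of_deriv_pos (convex_Ioo _ _)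
    (fun x hx => (hra x hx).continuousAt.continuousWithinAt) fun x hx => by
      rw [hUo.interior_eq] at hx
      rw [(hrd x hx).deriv]
      exact mul_pos (exp_pos _) (hUB x hx).2
  have hr0 : r 0 = 0 := by simp [hr]
  have hr1 : r 1 = 1 := by simp [hr, hg]
  set ζ := Function.invFunOn r U with hζ
  have hζr : ∀ x ∈ U, ζ (r x) = x := fun x hx => hrm.injOn.leftInvOn_invFunOn hx
  have hsurj : ∀ y ∈ Icc (0:ℝ) 1, ∃ x ∈ Icc (0:ℝ) 1, r x = y := by
    have := intermediate_value_Icc (zero_le_one' ℝ) (f := r)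
      fun x hx => (hra x (hUI hx)).continuousAt.continuousWithinAt
    rw [hr0, hr1] at this
    exact this
  have hrlt : ∀ x ∈ U, (r x ∈ Ioo (0:ℝ) 1 ↔ x ∈ Ioo (0:ℝ) 1) := fun x hx => by
    have e1 := hrm.lt_iff_lt h0U hx
    have e2 := hrm.lt_iff_lt hx h1U
    rw [hr0] at e1
    rw [hr1] at e2
    simp only [mem_Ioo, e1, e2]
  have hζa : ∀ x ∈ U, AnalyticAt ℝ ζ (r x) ∧ HasDerivAt ζ (exp (g x) * B x)⁻¹ (r x) := fun x hx => by
    have hne : deriv r x ≠ 0 := by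
      rw [(hrd x hx).deriv]
      exact (mul_pos (exp_pos _) (hUB x hx).2).ne'
    have hst := (hra x hx).hasStrictDerivAt
    have ha := (hra x hx).analyticAt_localInverse hne
    set l := hst.localInverse r (deriv r x) x hne with hl
    have hlx : l (r x) = x := hst.hasStrictFDerivAt_equiv hne |>.localInverse_apply_image
    have hr' : ∀ᶠ y in 𝓝 (r x), r (l y) = y := hst.eventually_right_inverse hne
    have hin : ∀ᶠ y in 𝓝 (r x), l y ∈ U := ha.continuousAt.eventually
      (by rw [hlx]; exact hUo.mem_nhds hx)
    have heq : l =ᶠ[𝓝 (r x)] ζ := by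
      filter_upwards [hr', hin] with y h1 h2
      rw [← hζr _ h2, h1]
    refine ⟨ha.congr heq, ?_⟩
    have := (hst.to_localInverse hne).hasDerivAt.congr_of_eventuallyEq heq.symm
    rwa [(hrd x hx).deriv] at this
  refine ⟨ζ, ?_, by simpa [hr0] using hζr 0 h0U, by simpa [hr1] using hζr 1 h1U, ⟨?_, ?_, ?_⟩, ?_, ?_⟩
  · intro y hy
    obtain ⟨x, hx, rfl⟩ := hsurj y hy
    exact (hζa x (hUI hx)).1
  · intro y hy
    obtain ⟨x, hx, rfl⟩ := hsurj y (Ioo_subset_Icc_self hy)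
    rw [hζr x (hUI hx)]
    exact (hrlt x (hUI hx)).1 hy
  · intro y hy y' hy' h
    obtain ⟨x, hx, rfl⟩ := hsurj y (Ioo_subset_Icc_self hy)
    obtain ⟨x', hx', rfl⟩ := hsurj y' (Ioo_subset_Icc_self hy')
    rw [hζr x (hUI hx), hζr x' (hUI hx')] at h
    rw [h]
  · intro x hx
    have hxU := hUI (Ioo_subset_Icc_self hx)
    exact ⟨r x, (hrlt x hxU).2 hx, hζr x hxU⟩
  · intro y hy
    obtain ⟨x, hx, rfl⟩ := hsurj y hy
    rwa [hζr x (hUI hx)]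
  · intro y hy
    obtain ⟨x, hx, rfl⟩ := hsurj y (Ioo_subset_Icc_self hy)
    have hxU := hUI hx
    have hx0 := ((hrlt x hxU).1 hy).1
    refine (hζa x hxU).2.congr_deriv ?_
    rw [hζr x hxU, hr]
    have := (hUB x hxU).2
    field_simp

/-- In a coordinate `x` with `x Z' = Z R / A`, a solution of the reduced system satisfies the
equations for the wave map, the metric function and the constraint. -/
theorem IsSol.css_equations {α c : ℝ} {F P ζ : ℝ → ℝ} (h0 : 0 ≤ α) (h1 : α < 1 / 2)
    (h : IsSol α 1 c 1 F P) {B : ℝ → ℝ} (hB : ∀ ξ ∈ Ioo (0:ℝ) 1, B ξ =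
      Af α (1 - 1 * ξ ^ 2) (F ξ) (P ξ / ξ) / Rf α (1 - 1 * ξ ^ 2) (F ξ) (P ξ / ξ))
    (hm : MapsTo ζ (Ioo 0 1) (Ioo 0 1))
    (hζ : ∀ x ∈ Ioo (0:ℝ) 1, HasDerivAt ζ (ζ x / (x * B (ζ x))) x) {G A : ℝ → ℝ}
    (hG : ∀ x ∈ Ioo (0:ℝ) 1, G x = F (ζ x))
    (hA : ∀ x ∈ Ioo (0:ℝ) 1, A x = Af α (1 - 1 * ζ x ^ 2) (F (ζ x)) (P (ζ x) / ζ x)) :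
    ∀ x ∈ Ioo (0:ℝ) 1,
      deriv (deriv G) x + (2 / x) * deriv G x - α * (1 + ζ x ^ 2) * x * deriv G x ^ 3
        - sin (2 * G x) / (A x * x ^ 2 * (1 - ζ x ^ 2)) = 0 ∧
      deriv A x = -2 * α * x * A x * deriv G x ^ 2 ∧
      x * deriv ζ x = ζ x * (1 + α * (1 - ζ x ^ 2) * x ^ 2 * deriv G x ^ 2) ∧
      1 - A x - 2 * α * sin (G x) ^ 2 + α * A x * x ^ 2 * deriv G x ^ 2 * (1 - ζ x ^ 2) = 0 := by
  have hy : ∀ x ∈ Ioo (0:ℝ) 1, 0 < 1 - 1 * ζ x ^ 2 := fun x hx => by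
    have := hm hx
    nlinarith [this.1, this.2]
  have hApos : ∀ x ∈ Ioo (0:ℝ) 1, 0 < A x := fun x hx => by
    rw [hA x hx]; exact Af_pos h0 h1 (hy x hx).le
  have dG : ∀ x ∈ Ioo (0:ℝ) 1, HasDerivAt G (P (ζ x) / ζ x / (x * A x)) x := by
    intro x hx
    have hR := Rf_pos (F := F (ζ x)) (N := P (ζ x) / ζ x) h0 h1 (hy x hx).le
    have hA0 := hApos x hx
    rw [hA x hx] at hA0 ⊢
    have hz := (hm hx).1
    have hx0 := hx.1
    have ev : G =ᶠ[𝓝 x] F ∘ ζ := by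
      filter_upwards [isOpen_Ioo.mem_nhds hx] with s hs using hG s hs
    refine (((h.hF _ (hm hx)).comp x (hζ x hx)).congr_of_eventuallyEq ev).congr_deriv ?_
    rw [hB _ (hm hx), vF_eq]
    generalize Rf α (1 - 1 * ζ x ^ 2) (F (ζ x)) (P (ζ x) / ζ x) = R at hR ⊢
    field_simp
  intro x hx
  have hx0 := hx.1
  have hz := hm hx
  have hz0 := hz.1
  have hyx := hy x hx
  have hAx := hA x hx
  have hA0 := hApos x hx
  have hR := Rf_pos (F := F (ζ x)) (N := P (ζ x) / ζ x) h0 h1 hyx.le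
  have hBx := hB _ hz
  have hA2 := Af_sq (F := F (ζ x)) (N := P (ζ x) / ζ x) h0 h1 hyx.le
  have hReq : Rf α (1 - 1 * ζ x ^ 2) (F (ζ x)) (P (ζ x) / ζ x) = _ := Rf_eq
  have dA : HasDerivAt A (-2 * α * (P (ζ x) / ζ x) ^ 2 / (x * A x)) x := by
    have ev : A =ᶠ[𝓝 x] (fun ξ => Af α (1 - 1 * ξ ^ 2) (F ξ) (P ξ / ξ)) ∘ ζ := by
      filter_upwards [isOpen_Ioo.mem_nhds hx] with s hs using hA s hs
    refine (((hasDerivAt_Af h0 h1 hz0.ne' hyx (h.hF _ hz) (h.hP _ hz)).comp x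
      (hζ x hx)).congr_of_eventuallyEq ev).congr_deriv ?_
    rw [hBx, ← hAx]
    generalize Rf α (1 - 1 * ζ x ^ 2) (F (ζ x)) (P (ζ x) / ζ x) = R at hR ⊢
    field_simp
  have dN : HasDerivAt (fun x => P (ζ x) / ζ x) ((sin (2 * F (ζ x)) / (1 - 1 * ζ x ^ 2) -
      P (ζ x) / ζ x * Rf α (1 - 1 * ζ x ^ 2) (F (ζ x)) (P (ζ x) / ζ x) / A x) / x) x := by
    have e := hζ x hx
    refine (((h.hP _ hz).comp x e).div e hz0.ne').congr_deriv ?_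
    simp only [Function.comp]
    rw [hBx, ← hAx]
    unfold vP
    rw [← hAx]
    generalize Rf α (1 - 1 * ζ x ^ 2) (F (ζ x)) (P (ζ x) / ζ x) = R at hR ⊢
    generalize 1 - 1 * ζ x ^ 2 = y at hyx ⊢
    field_simp
  have ddG : HasDerivAt (deriv G) (((sin (2 * F (ζ x)) / (1 - 1 * ζ x ^ 2) -
      P (ζ x) / ζ x * Rf α (1 - 1 * ζ x ^ 2) (F (ζ x)) (P (ζ x) / ζ x) / A x) / x * (x * A x) -
      P (ζ x) / ζ x * (1 * A x + x * (-2 * α * (P (ζ x) / ζ x) ^ 2 / (x * A x)))) / (x * A x) ^ 2) x := by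
    have ev : deriv G =ᶠ[𝓝 x] fun x => P (ζ x) / ζ x / (x * A x) := by
      filter_upwards [isOpen_Ioo.mem_nhds hx] with s hs using (dG s hs).deriv
    exact (dN.div ((hasDerivAt_id x).mul dA) (mul_pos hx0 hA0).ne').congr_of_eventuallyEq ev
  rw [ddG.deriv, (dG x hx).deriv, dA.deriv, (hζ x hx).deriv, hG x hx, hBx, ← hAx]
  rw [← hAx] at hReq hA2
  unfold qf at hReq hA2
  rw [hReq] at hR ⊢
  generalize P (ζ x) / ζ x = N at *
  generalize A x = a at *
  generalize ζ x = z at *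
  have hy' : 1 - z ^ 2 ≠ 0 := by linarith
  rw [one_mul] at *
  refine ⟨?_, ?_, ?_, ?_⟩
  · field_simp
    linear_combination -(1 - z ^ 2) * N * hA2
  · field_simp
  · field_simp
    linear_combination hA2
  · field_simp
    linear_combination -hA2

/-- Theorem 1: for every `0 ≤ α < 1/2` and every `n : ℕ` there is a
real-analytic solution of the CSS system on `[0,1]` with the stated boundary
values whose profile `F - π/2` has exactly `n` zeros in `(0,1)`. -/
theorem theorem1 (α : ℝ) (hα0 : 0 ≤ α) (hα : α < 1 / 2) (n : ℕ) :
    ∃ F A Z : ℝ → ℝ, Thm1Sol α n F A Z := by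
  obtain ⟨c, -, F, P, h, hF, hfin, hcard⟩ := exists_shooting hα0 hα n
  obtain ⟨G, N, hG, hN, hG0, hN0, hG1, hGN⟩ := h.exists_extension hα0 hα hF
  have hy : ∀ ξ ∈ Icc (0:ℝ) 1, 0 ≤ 1 - 1 * ξ ^ 2 := fun ξ hξ => by nlinarith [hξ.1, hξ.2]
  set R : ℝ → ℝ := fun ξ => Rf α (1 - 1 * ξ ^ 2) (G ξ) (N ξ) with hR
  set A : ℝ → ℝ := fun ξ => Af α (1 - 1 * ξ ^ 2) (G ξ) (N ξ) with hA
  have hRa : AnalyticOnNhd ℝ R (Icc 0 1) := fun ξ hξ => by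
    have a1 := hG ξ hξ
    have a2 := hN ξ hξ
    refine AnalyticAt.comp_of_eq (g := fun z : ℝ × ℝ × ℝ => Rf α z.1 z.2.1 z.2.2)
      (f := fun ξ : ℝ => (1 - 1 * ξ ^ 2, G ξ, N ξ)) (analyticAt_Rf ?_) (by fun_prop) rfl
    exact (radicand_pos hα0 hα (hy ξ hξ)).ne'
  have hAa : AnalyticOnNhd ℝ A (Icc 0 1) := fun ξ hξ => by
    have a1 := hG ξ hξ
    have a2 := hRa ξ hξ
    have a3 : AnalyticAt ℝ (fun ξ => qf α (G ξ)) ξ := by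
      unfold qf
      exact analyticAt_const.sub (analyticAt_const.mul ((Real.analyticAt_sin.comp a1).pow 2))
    exact (a2.add a3).div analyticAt_const two_ne_zero
  have hRp : ∀ ξ ∈ Icc (0:ℝ) 1, 0 < R ξ := fun ξ hξ => Rf_pos hα0 hα (hy ξ hξ)
  have hAp : ∀ ξ ∈ Icc (0:ℝ) 1, 0 < A ξ := fun ξ hξ => Af_pos hα0 hα (hy ξ hξ)
  have hA0 : A 0 = 1 := by norm_num [hA, Af, Rf, qf, hG0, hN0]
  have hR0 : R 0 = 1 := by norm_num [hR, Rf, qf, hG0, hN0]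
  have hA1 : A 1 = 1 - 2 * α := by
    simp [hA, Af, Rf, qf, hG1, Real.sqrt_sq (show 0 ≤ 1 - 2 * α by linarith)]
  obtain ⟨ζ, hζa, hζ0, hζ1, hbij, hmaps, hζd⟩ := exists_change_of_variable (B := fun ξ => A ξ / R ξ)
    (fun ξ hξ => (hAa ξ hξ).div (hRa ξ hξ) (hRp ξ hξ).ne') (by simp [hA0, hR0])
    fun ξ hξ => div_pos (hAp ξ hξ) (hRp ξ hξ)
  have hset : ζ '' {ρ ∈ Ioo (0:ℝ) 1 | G (ζ ρ) = π / 2} = {ξ ∈ Ioo (0:ℝ) 1 | F ξ = π / 2} := by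
    ext ξ
    constructor
    · rintro ⟨ρ, ⟨hρ, hρ2⟩, rfl⟩
      exact ⟨hbij.mapsTo hρ, by rw [← (hGN _ (hbij.mapsTo hρ)).1, hρ2]⟩
    · rintro ⟨hξ, hξ2⟩
      obtain ⟨ρ, hρ, rfl⟩ := hbij.surjOn hξ
      exact ⟨ρ, ⟨hρ, by rw [(hGN _ hξ).1, hξ2]⟩, rfl⟩
  have hinj : InjOn ζ {ρ ∈ Ioo (0:ℝ) 1 | G (ζ ρ) = π / 2} := hbij.injOn.mono fun ρ hρ => hρ.1
  refine ⟨fun ρ => G (ζ ρ), fun ρ => A (ζ ρ), ζ, fun ρ hρ => (hG _ (hmaps hρ)).comp (hζa ρ hρ),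
    fun ρ hρ => (hAa _ (hmaps hρ)).comp (hζa ρ hρ), hζa, ?_, ?_, hζ0, ?_, ?_, hζ1, ?_, ?_, ?_⟩
  · refine h.css_equations hα0 hα (B := fun ξ => A ξ / R ξ) (fun ξ hξ => ?_) hbij.mapsTo hζd (fun x hx => ?_) fun x hx => ?_
    · simp only [hA, hR, (hGN ξ hξ).1, (hGN ξ hξ).2]
    · exact (hGN _ (hbij.mapsTo hx)).1
    · simp only [hA, (hGN _ (hbij.mapsTo hx)).1, (hGN _ (hbij.mapsTo hx)).2]
  · simp [hζ0, hG0]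
  · simp [hζ0, hA0]
  · simp [hζ1, hG1]
  · simp [hζ1, hA1]
  · exact Finite.of_finite_image (hset ▸ hfin) hinj
  · rw [← hcard, ← hset, hinj.ncard_image]
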